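/- arXiv:0807.3603 — 2 statements merged into one kernel-verified Lean document; each statement's English description precedes it below -/
import Mathlib

section
/- Let τ be in the complex upper half-plane, let α, β ∈ ℝ with ατ+β ∉ ℤτ+ℤ, and let u ∈ ℂ with u ∉ ℤτ+ℤ. Then ϑ(u;τ)³ · (4πi ∂/∂τ + ∂²/∂u²)[ e^{2πiαu − πiα²τ} μ(u, ατ+β; τ) ] = e^{2πiαu − πiα²τ} · (16π² η(τ)⁶ / ϑ(ατ+β;τ)²) · [ a₁^{α,β}(τ) ϑ₀(2u+ατ+β; 2τ) − a₀^{α,β}(τ) ϑ₁(2u+ατ+β; 2τ) ], where the heat operator 4πi ∂/∂τ + ∂²/∂u² is applied to the bracketed expression as a function of (u,τ). -/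
open Complex Real Filter

noncomputable section

/-- The Jacobi theta function ϑ(u;τ) = Σ_{ν∈ℤ+1/2} e^{πiν²τ + 2πiν(u+1/2)}. -/
def jTheta (u τ : ℂ) : ℂ :=
  ∑' n : ℤ, Complex.exp (π * I * ((n : ℂ) + 1/2)^2 * τ + 2 * π * I * ((n : ℂ) + 1/2) * (u + 1/2))

/-- ϑ₀(u;τ) = Σ_{n∈ℤ} e^{πin²τ + 2πinu}. -/
def jTheta0 (u τ : ℂ) : ℂ :=
  ∑' n : ℤ, Complex.exp (π * I * (n : ℂ)^2 * τ + 2 * π * I * (n : ℂ) * u)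

/-- ϑ₁(u;τ) = Σ_{n∈1/2+ℤ} e^{πin²τ + 2πinu}. -/
def jTheta1 (u τ : ℂ) : ℂ :=
  ∑' n : ℤ, Complex.exp (π * I * ((n : ℂ) + 1/2)^2 * τ + 2 * π * I * ((n : ℂ) + 1/2) * u)

/-- The Dedekind eta function. -/
def dedekindEta (τ : ℂ) : ℂ :=
  Complex.exp (π * I * τ / 12) * ∏' n : ℕ, (1 - Complex.exp (2 * π * I * ((n : ℂ) + 1) * τ))

/-- The Lerch sum μ(u,v;τ). -/
def lerchMu (u v τ : ℂ) : ℂ :=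
  Complex.exp (π * I * u) / jTheta v τ *
    ∑' n : ℤ, (-1 : ℂ) ^ n * Complex.exp (π * I * ((n : ℂ)^2 + (n : ℂ)) * τ + 2 * π * I * v * (n : ℂ)) /
      (1 - Complex.exp (2 * π * I * (n : ℂ) * τ + 2 * π * I * u))

/-- a₀^{α,β}(τ). -/
def aCoef0 (α β : ℝ) (τ : ℂ) : ℂ :=
  ∑' n : ℤ, ((n : ℂ) + (α : ℂ)/2) *
    Complex.exp (2 * π * I * (n : ℂ)^2 * τ + 2 * π * I * (n : ℂ) * ((α : ℂ) * τ + (β : ℂ)))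

/-- a₁^{α,β}(τ). -/
def aCoef1 (α β : ℝ) (τ : ℂ) : ℂ :=
  ∑' n : ℤ, (((n : ℂ) + 1/2) + (α : ℂ)/2) *
    Complex.exp (2 * π * I * ((n : ℂ) + 1/2)^2 * τ + 2 * π * I * ((n : ℂ) + 1/2) * ((α : ℂ) * τ + (β : ℂ)))

/-- Finite q-Pochhammer symbol (a;q)_n. -/
def qPochN (a q : ℂ) (n : ℕ) : ℂ := ∏ j ∈ Finset.range n, (1 - a * q ^ j)

/-- Infinite q-Pochhammer symbol (a;q)_∞. -/
def qPochInf (a q : ℂ) : ℂ := ∏' j : ℕ, (1 - a * q ^ j)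

/-- The modified rank generating function R*(z;q). -/
def rankStar (z q : ℂ) : ℂ :=
  (qPochInf q q)⁻¹ * ∑' n : ℤ, (-1 : ℂ) ^ n * q ^ (n * (3 * n + 1) / 2) / (1 - z * q ^ n)

/-- The modified crank generating function C*(z;q). -/
def crankStar (z q : ℂ) : ℂ :=
  (1 - z)⁻¹ * ∏' n : ℕ, ((1 - q ^ (n + 1)) / ((1 - z * q ^ (n + 1)) * (1 - z⁻¹ * q ^ (n + 1))))

/-- N(1,0,z;q), the overpartition-rank generating function. -/
def nGen10 (z q : ℂ) : ℂ :=
  ∑' n : ℕ, qPochN (-1) q n * q ^ (n * (n + 1) / 2) / (qPochN (z * q) q n * qPochN (z⁻¹ * q) q n)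

/-- N*(1,0,z;q). -/
def nStar10 (z q : ℂ) : ℂ := nGen10 z q / (1 - z)

/-- N(1,1/q,z;q²), the M2-rank generating function for overpartitions. -/
def nGenM2over (z q : ℂ) : ℂ :=
  ∑' n : ℕ, qPochN (-1) (q^2) n * qPochN (-q) (q^2) n * q ^ n /
    (qPochN (z * q^2) (q^2) n * qPochN (z⁻¹ * q^2) (q^2) n)

/-- N*(1,1/q,z;q²). -/
def nStarM2over (z q : ℂ) : ℂ := nGenM2over z q / (1 - z)

/-- N(0,1/q,z;q²), the M2-rank generating function for partitions without repeated odd parts. -/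
def nGenM2 (z q : ℂ) : ℂ :=
  ∑' n : ℕ, qPochN (-q) (q^2) n * q ^ (n^2) /
    (qPochN (z * q^2) (q^2) n * qPochN (z⁻¹ * q^2) (q^2) n)

/-- N*(0,1/q,z;q²). -/
def nStarM2 (z q : ℂ) : ℂ := nGenM2 z q / (1 - z)

/-- The odd-rank generating function R^o(z;q). -/
def oddRank (z q : ℂ) : ℂ :=
  (qPochInf (q^2) (q^2))⁻¹ * ∑' n : ℤ, (-1 : ℂ) ^ n * q ^ (3 * n^2 + 3 * n + 1) / (1 - z * q ^ (2 * n + 1))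

open Topology

/-- The point `u` does not belong to the lattice `ℤτ + ℤ`. -/
def OffLattice (τ u : ℂ) : Prop := ∀ m n : ℤ, u ≠ (m : ℂ) * τ + (n : ℂ)

namespace OffLattice

variable {τ u : ℂ}

lemma add_lattice (h : OffLattice τ u) (m n : ℤ) : OffLattice τ (u + m * τ + n) := by
  intro k l e
  refine h (k - m) (l - n) ?_
  push_cast
  linear_combination e

lemma add_one (h : OffLattice τ u) : OffLattice τ (u + 1) := by
  simpa using h.add_lattice 0 1

lemma add_self (h : OffLattice τ u) : OffLattice τ (u + τ) := by
  simpa using h.add_lattice 1 0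

lemma add_int_mul_ne (h : OffLattice τ u) (n m : ℤ) : u + n * τ ≠ m := by
  intro e
  refine h (-n) m ?_
  push_cast
  linear_combination e

end OffLattice

lemma exists_norm_le_of_lattice_ne_zero {τ : ℂ} (hτ : 0 < τ.im) :
    ∃ δ > 0, ∀ m n : ℤ, (m : ℂ) * τ + n ≠ 0 → δ ≤ ‖(m : ℂ) * τ + n‖ := by
  refine ⟨min 1 τ.im, lt_min one_pos hτ, fun m n h => ?_⟩
  rcases eq_or_ne m 0 with rfl | hm
  · have hn : n ≠ 0 := by rintro rfl; simp at h
    have : (1 : ℝ) ≤ |(n : ℝ)| := by exact_mod_cast Int.one_le_abs hn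
    simpa using Or.inl this
  · have h1 : (1 : ℝ) ≤ |(m : ℝ)| := by exact_mod_cast Int.one_le_abs hm
    refine (min_le_right _ _).trans (le_trans ?_ (Complex.abs_im_le_norm _))
    simp only [add_im, mul_im, intCast_re, intCast_im, zero_mul, add_zero, abs_mul, abs_of_pos hτ]
    nlinarith

lemma eventually_offLattice {τ : ℂ} (hτ : 0 < τ.im) (z : ℂ) :
    ∀ᶠ w in 𝓝[≠] z, OffLattice τ w := by
  obtain ⟨δ, hδ, h⟩ := exists_norm_le_of_lattice_ne_zero hτ
  by_cases hz : ∃ m n : ℤ, (m : ℂ) * τ + n ≠ z ∧ dist ((m : ℂ) * τ + n) z < δ / 2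
  · obtain ⟨m, n, hne, hd⟩ := hz
    have hpos : 0 < min (δ / 2) (dist ((m : ℂ) * τ + n) z) :=
      lt_min (by positivity) (dist_pos.2 hne)
    filter_upwards [nhdsWithin_le_nhds (Metric.ball_mem_nhds z hpos)] with w hw k l e
    rw [Metric.mem_ball, lt_min_iff] at hw
    have hkl : ((k - m : ℤ) : ℂ) * τ + (l - n : ℤ) = w - (m * τ + n) := by
      push_cast; rw [e]; ring
    refine absurd (h (k - m) (l - n) ?_) ?_
    · rw [hkl, sub_ne_zero]
      rintro rfl
      exact lt_irrefl _ hw.2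
    · rw [hkl, ← dist_eq_norm, not_le]
      calc dist w (m * τ + n) ≤ dist w z + dist ((m : ℂ) * τ + n) z := dist_triangle_right _ _ _
        _ < δ := by linarith [hw.1]
  · push Not at hz
    filter_upwards [nhdsWithin_le_nhds (Metric.ball_mem_nhds z (half_pos hδ)),
      self_mem_nhdsWithin] with w hw hwz k l e
    have := hz k l (e ▸ hwz)
    rw [← e] at this
    exact absurd hw (not_lt.2 this)

lemma OffLattice.eventually {τ z : ℂ} (hτ : 0 < τ.im) (hz : OffLattice τ z) :
    ∀ᶠ w in 𝓝 z, OffLattice τ w := by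
  have := eventually_nhdsWithin_iff.1 (eventually_offLattice hτ z)
  filter_upwards [this] with w hw
  rcases eq_or_ne w z with rfl | h
  · exact hz
  · exact hw h

/-- Every complex number is a lattice translate of a point of a compact set. -/
lemma exists_compact_fundamental {τ : ℂ} (hτ : 0 < τ.im) :
    ∃ K : Set ℂ, IsCompact K ∧ ∀ u : ℂ, ∃ w ∈ K, ∃ m n : ℤ, u = w + m * τ + n := by
  refine ⟨(fun p : ℝ × ℝ => (p.1 : ℂ) * τ + p.2) '' (Set.Icc 0 1 ×ˢ Set.Icc 0 1),
    (isCompact_Icc.prod isCompact_Icc).image (by fun_prop), fun u => ?_⟩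
  set x := u.im / τ.im with hx
  set y := u.re - x * τ.re with hy
  refine ⟨_, ⟨(Int.fract x, Int.fract y),
    ⟨⟨Int.fract_nonneg _, (Int.fract_lt_one _).le⟩, ⟨Int.fract_nonneg _, (Int.fract_lt_one _).le⟩⟩,
    rfl⟩, ⌊x⌋, ⌊y⌋, ?_⟩
  have e1 : (Int.fract x : ℝ) + (⌊x⌋ : ℝ) = x := Int.fract_add_floor x
  have e2 : (Int.fract y : ℝ) + (⌊y⌋ : ℝ) = y := Int.fract_add_floor y
  have hxτ : x * τ.im = u.im := div_mul_cancel₀ _ hτ.ne'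
  apply Complex.ext
  · simp
    linear_combination hy - e1 * τ.re - e2
  · simp
    linear_combination -hxτ - e1 * τ.im

/-- A function holomorphic off the lattice, bounded near the lattice, and elliptic up to
nontrivial unitary multipliers vanishes. -/
theorem eq_zero_of_unitary_multipliers {τ : ℂ} (hτ : 0 < τ.im) {f : ℂ → ℂ} {A B : ℂ}
    (hA : ‖A‖ = 1) (hB : ‖B‖ = 1) (hAB : A ≠ 1 ∨ B ≠ 1)
    (hd : ∀ u, OffLattice τ u → DifferentiableAt ℂ f u)
    (hb : ∃ M : ℝ, ∀ᶠ u in 𝓝[≠] (0 : ℂ), ‖f u‖ ≤ M)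
    (h1 : ∀ u, OffLattice τ u → f (u + 1) = A * f u)
    (h2 : ∀ u, OffLattice τ u → f (u + τ) = B * f u) :
    ∀ u, OffLattice τ u → f u = 0 := by
  classical
  set g : ℂ → ℝ := fun u => if OffLattice τ u then ‖f u‖ else 0 with hg
  have hoff1 : ∀ u, OffLattice τ (u + 1) ↔ OffLattice τ u := fun u =>
    ⟨fun h => by simpa using h.add_lattice 0 (-1), fun h => h.add_one⟩
  have hoff2 : ∀ u, OffLattice τ (u + τ) ↔ OffLattice τ u := fun u =>
    ⟨fun h => by simpa using h.add_lattice (-1) 0, fun h => h.add_self⟩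
  have p1 : Function.Periodic g 1 := fun u => by
    by_cases h : OffLattice τ u
    · simp [hg, hoff1, h, h1 u h, hA]
    · simp [hg, hoff1, h]
  have p2 : Function.Periodic g τ := fun u => by
    by_cases h : OffLattice τ u
    · simp [hg, hoff2, h, h2 u h, hB]
    · simp [hg, hoff2, h]
  have hnorm : ∀ u, OffLattice τ u → ∀ m n : ℤ, ‖f (u + m * τ + n)‖ = ‖f u‖ := fun u hu m n => by
    have e1 := (p1.int_mul n) (u + m * τ)
    have e2 := (p2.int_mul m) u
    have := e1.trans e2
    simpa [hg, hu, hu.add_lattice] using this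
  have hloc : ∀ z, ∃ M : ℝ, ∀ᶠ u in 𝓝[≠] z, ‖f u‖ ≤ M := fun z => by
    by_cases hz : OffLattice τ z
    · refine ⟨‖f z‖ + 1, nhdsWithin_le_nhds ?_⟩
      exact (hd z hz).continuousAt.norm.eventually (eventually_le_nhds (by linarith))
    · simp only [OffLattice, not_forall, ne_eq, not_not] at hz
      obtain ⟨m, n, rfl⟩ := hz
      obtain ⟨M, hM⟩ := hb
      refine ⟨M, ?_⟩
      have ht : Tendsto (fun u : ℂ => u - (m * τ + n)) (𝓝[≠] (m * τ + n)) (𝓝[≠] 0) := by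
        refine tendsto_nhdsWithin_iff.2 ⟨?_, ?_⟩
        · refine (Continuous.tendsto' (by fun_prop) _ _ (by simp)).mono_left nhdsWithin_le_nhds
        · filter_upwards [self_mem_nhdsWithin] with u hu
          exact sub_ne_zero.2 hu
      filter_upwards [ht.eventually hM, ht.eventually (eventually_offLattice hτ 0)] with u hu ho
      have := hnorm _ ho m n
      rw [← this] at hu
      convert hu using 3
      ring
  set F : ℂ → ℂ := fun z => limUnder (𝓝[≠] z) f with hF
  have hFf : ∀ z, OffLattice τ z → F z = f z := fun z hz =>
    ((hd z hz).continuousAt.tendsto.mono_left nhdsWithin_le_nhds).limUnder_eq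
  have hFd : Differentiable ℂ F := fun z => by
    obtain ⟨M, hM⟩ := hloc z
    have h3 := eventually_nhdsWithin_iff.1 (hM.and (eventually_offLattice hτ z))
    set s := {w | w ∈ ({z} : Set ℂ)ᶜ → ‖f w‖ ≤ M ∧ OffLattice τ w} with hs
    have hsz : s ∈ 𝓝 z := h3
    have hu : DifferentiableOn ℂ (Function.update f z (limUnder (𝓝[≠] z) f)) s := by
      refine differentiableOn_update_limUnder_of_bddAbove hsz ?_ ?_
      · exact fun w hw => (hd w (hw.1 hw.2).2).differentiableWithinAt
      · refine ⟨M, ?_⟩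
        rintro _ ⟨w, hw, rfl⟩
        exact (hw.1 hw.2).1
    refine (hu.differentiableAt hsz).congr_of_eventuallyEq ?_
    filter_upwards [hsz] with w hw
    rcases eq_or_ne w z with rfl | hne
    · simp [hF]
    · rw [Function.update_of_ne hne]
      exact hFf w (hw hne).2
  have hdense : Dense {u | OffLattice τ u} := fun z => by
    refine mem_closure_iff_frequently.2 ?_
    exact ((eventually_offLattice hτ z).frequently).filter_mono nhdsWithin_le_nhds
  have hF1 : ∀ u, F (u + 1) = A * F u := fun u => congrFun
    (Continuous.ext_on hdense (hFd.continuous.comp (by fun_prop : Continuous fun u : ℂ => u + 1))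
      (continuous_const.mul hFd.continuous) (fun u hu => by
        simp only [Function.comp, Pi.mul_apply, hFf _ hu, hFf _ (OffLattice.add_one hu), h1 u hu])) u
  have hF2 : ∀ u, F (u + τ) = B * F u := fun u => congrFun
    (Continuous.ext_on hdense (hFd.continuous.comp (by fun_prop : Continuous fun u : ℂ => u + τ))
      (continuous_const.mul hFd.continuous) (fun u hu => by
        simp only [Function.comp, Pi.mul_apply, hFf _ hu, hFf _ (OffLattice.add_self hu), h2 u hu])) u
  have hbdd : Bornology.IsBounded (Set.range F) := by
    obtain ⟨K, hK, hcov⟩ := exists_compact_fundamental hτ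
    obtain ⟨M, hM⟩ := isBounded_iff_forall_norm_le.1 (hK.image hFd.continuous).isBounded
    refine isBounded_iff_forall_norm_le.2 ⟨M, ?_⟩
    rintro _ ⟨u, rfl⟩
    obtain ⟨w, hw, m, n, rfl⟩ := hcov u
    have q1 : Function.Periodic (fun u => ‖F u‖) 1 := fun u => by simp [hF1, hA]
    have q2 : Function.Periodic (fun u => ‖F u‖) τ := fun u => by simp [hF2, hB]
    have e := (q1.int_mul n (w + m * τ)).trans (q2.int_mul m w)
    simp only [mul_one] at e
    rw [e]
    exact hM _ ⟨w, hw, rfl⟩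
  have hconst := hFd.apply_eq_apply_of_bounded hbdd
  intro u hu
  rw [← hFf u hu]
  rcases hAB with h | h
  · have := hF1 u
    rw [hconst (u + 1) u] at this
    have : (A - 1) * F u = 0 := by linear_combination -this
    exact (mul_eq_zero.1 this).resolve_left (sub_ne_zero.2 h)
  · have := hF2 u
    rw [hconst (u + τ) u] at this
    have : (B - 1) * F u = 0 := by linear_combination -this
    exact (mul_eq_zero.1 this).resolve_left (sub_ne_zero.2 h)

lemma jTheta_eq_jacobiTheta₂ (u τ : ℂ) :
    jTheta u τ = Complex.exp (π * I * τ / 4 + π * I * (u + 1 / 2)) *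
      jacobiTheta₂ (u + 1 / 2 + τ / 2) τ := by
  rw [jTheta, jacobiTheta₂, ← tsum_mul_left]
  refine tsum_congr fun n => ?_
  rw [jacobiTheta₂_term, ← Complex.exp_add]
  congr 1
  ring

lemma jTheta0_eq_jacobiTheta₂ (u τ : ℂ) : jTheta0 u τ = jacobiTheta₂ u τ := by
  rw [jTheta0, jacobiTheta₂]
  refine tsum_congr fun n => ?_
  rw [jacobiTheta₂_term, add_comm]

lemma jTheta1_eq_jacobiTheta₂ (u τ : ℂ) :
    jTheta1 u τ = Complex.exp (π * I * τ / 4 + π * I * u) * jacobiTheta₂ (u + τ / 2) τ := by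
  rw [jTheta1, jacobiTheta₂, ← tsum_mul_left]
  refine tsum_congr fun n => ?_
  rw [jacobiTheta₂_term, ← Complex.exp_add]
  congr 1
  ring

lemma differentiable_jTheta {τ : ℂ} (hτ : 0 < τ.im) : Differentiable ℂ (fun u => jTheta u τ) := by
  intro u
  simp only [jTheta_eq_jacobiTheta₂]
  refine DifferentiableAt.mul (by fun_prop) ?_
  exact (differentiableAt_jacobiTheta₂_fst _ hτ).comp u
    (by fun_prop : DifferentiableAt ℂ (fun u : ℂ => u + 1 / 2 + τ / 2) u)

lemma jTheta_add_one (u τ : ℂ) : jTheta (u + 1) τ = -jTheta u τ := by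
  rw [jTheta_eq_jacobiTheta₂, jTheta_eq_jacobiTheta₂,
    show u + 1 + 1 / 2 + τ / 2 = u + 1 / 2 + τ / 2 + 1 by ring, jacobiTheta₂_add_left,
    show π * I * τ / 4 + π * I * (u + 1 + 1 / 2) = (π * I * τ / 4 + π * I * (u + 1 / 2)) + π * I by
      ring, Complex.exp_add _ (π * I), Complex.exp_pi_mul_I]
  ring

lemma neg_cexp (z : ℂ) : -Complex.exp z = Complex.exp (z + π * I) := by
  rw [Complex.exp_add, Complex.exp_pi_mul_I, mul_neg_one]

lemma jTheta_add_self (u τ : ℂ) :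
    jTheta (u + τ) τ = -Complex.exp (-π * I * τ - 2 * π * I * u) * jTheta u τ := by
  rw [jTheta_eq_jacobiTheta₂, jTheta_eq_jacobiTheta₂,
    show u + τ + 1 / 2 + τ / 2 = u + 1 / 2 + τ / 2 + τ by ring, jacobiTheta₂_add_left',
    neg_cexp, ← mul_assoc, ← mul_assoc, ← Complex.exp_add, ← Complex.exp_add]
  congr 1
  rw [Complex.exp_eq_exp_iff_exists_int]
  exact ⟨-1, by push_cast; ring⟩

lemma jTheta_neg (u τ : ℂ) : jTheta (-u) τ = -jTheta u τ := by
  rw [jTheta_eq_jacobiTheta₂, jTheta_eq_jacobiTheta₂,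
    show -u + 1 / 2 + τ / 2 = -(u + 1 / 2 + τ / 2) + τ + 1 by ring, jacobiTheta₂_add_left,
    jacobiTheta₂_add_left', jacobiTheta₂_neg_left, ← mul_assoc, ← Complex.exp_add,
    ← neg_mul, neg_cexp]
  congr 1
  rw [Complex.exp_eq_exp_iff_exists_int]
  exact ⟨0, by push_cast; ring⟩

lemma jTheta_zero (τ : ℂ) : jTheta 0 τ = 0 := by
  have := jTheta_neg 0 τ
  rw [neg_zero] at this
  linear_combination this / 2

lemma hasSum_jTheta {τ : ℂ} (hτ : 0 < τ.im) (u : ℂ) :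
    HasSum (fun n : ℤ => Complex.exp (π * I * ((n : ℂ) + 1/2)^2 * τ +
      2 * π * I * ((n : ℂ) + 1/2) * (u + 1/2))) (jTheta u τ) := by
  rw [jTheta_eq_jacobiTheta₂]
  convert! (hasSum_jacobiTheta₂_term (u + 1 / 2 + τ / 2) hτ).mul_left
    (Complex.exp (π * I * τ / 4 + π * I * (u + 1 / 2))) using 2 with n
  rw [jacobiTheta₂_term, ← Complex.exp_add]
  congr 1
  ring

lemma hasSum_jTheta0 {τ : ℂ} (hτ : 0 < τ.im) (u : ℂ) :
    HasSum (fun n : ℤ => Complex.exp (π * I * (n : ℂ)^2 * τ + 2 * π * I * (n : ℂ) * u))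
      (jTheta0 u τ) := by
  rw [jTheta0_eq_jacobiTheta₂]
  convert! hasSum_jacobiTheta₂_term u hτ using 2 with n
  rw [jacobiTheta₂_term, add_comm]

lemma hasSum_jTheta1 {τ : ℂ} (hτ : 0 < τ.im) (u : ℂ) :
    HasSum (fun n : ℤ => Complex.exp (π * I * ((n : ℂ) + 1/2)^2 * τ +
      2 * π * I * ((n : ℂ) + 1/2) * u)) (jTheta1 u τ) := by
  rw [jTheta1_eq_jacobiTheta₂]
  convert! (hasSum_jacobiTheta₂_term (u + τ / 2) hτ).mul_left
    (Complex.exp (π * I * τ / 4 + π * I * u)) using 2 with n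
  rw [jacobiTheta₂_term, ← Complex.exp_add]
  congr 1
  ring

/-- The theta function near the origin, with its zero divided out. -/
lemma exists_jTheta_eq_mul {τ : ℂ} (hτ : 0 < τ.im) :
    ∃ h : ℂ → ℂ, Differentiable ℂ h ∧ h 0 = deriv (fun u => jTheta u τ) 0 ∧ deriv h 0 = 0 ∧
      ∀ u, jTheta u τ = u * h u := by
  have hd := differentiable_jTheta hτ
  set h := dslope (fun u => jTheta u τ) 0 with hh
  have hD : Differentiable ℂ h := by
    have := (Complex.differentiableOn_dslope (f := fun u => jTheta u τ) (c := 0)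
      (s := Set.univ) Filter.univ_mem).2 hd.differentiableOn
    exact differentiableOn_univ.1 this
  have hmul : ∀ u, jTheta u τ = u * h u := fun u => by
    have := sub_smul_dslope (fun u => jTheta u τ) 0 u
    simp only [jTheta_zero, sub_zero, smul_eq_mul] at this
    exact this.symm
  have heven : ∀ u, h (-u) = h u := fun u => by
    rcases eq_or_ne u 0 with rfl | hu
    · simp
    · have h1 := hmul u
      have h2 := hmul (-u)
      rw [jTheta_neg, h1] at h2
      have : u * (h (-u) - h u) = 0 := by linear_combination h2
      exact sub_eq_zero.1 ((mul_eq_zero.1 this).resolve_left hu)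
  refine ⟨h, hD, dslope_same _ _, ?_, hmul⟩
  have e := deriv_comp_neg h 0
  have : (fun x => h (-x)) = h := funext heven
  rw [this, neg_zero] at e
  linear_combination e / 2

/-- Pairs of integers, sorted by the parity of their sum. -/
def intPairParityEquiv : (ℤ × ℤ) ⊕ (ℤ × ℤ) ≃ ℤ × ℤ where
  toFun := Sum.elim (fun p => (p.1 + p.2, p.1 - p.2)) (fun p => (p.1 + p.2, p.1 - p.2 - 1))
  invFun p := if (p.1 + p.2) % 2 = 0 then Sum.inl ((p.1 + p.2) / 2, (p.1 - p.2) / 2)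
    else Sum.inr ((p.1 + p.2 + 1) / 2, (p.1 - p.2 - 1) / 2)
  left_inv p := by
    rcases p with ⟨a, b⟩ | ⟨a, b⟩
    · have : (a + b + (a - b)) % 2 = 0 := by omega
      simp only [Sum.elim_inl, this, if_true, Sum.inl.injEq, Prod.mk.injEq]
      omega
    · have : ¬ (a + b + (a - b - 1)) % 2 = 0 := by omega
      simp only [Sum.elim_inr, this, if_false, Sum.inr.injEq, Prod.mk.injEq]
      omega
  right_inv p := by
    rcases p with ⟨a, b⟩
    by_cases h : (a + b) % 2 = 0
    · simp only [h, if_true, Sum.elim_inl, Prod.mk.injEq]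
      omega
    · simp only [h, if_false, Sum.elim_inr, Prod.mk.injEq]
      omega

/-- A product of two theta functions in terms of theta functions of doubled modulus. -/
theorem jTheta_mul_jTheta {τ : ℂ} (hτ : 0 < τ.im) (x y : ℂ) :
    jTheta (x + y) τ * jTheta (x - y) τ =
      jTheta0 (2 * x) (2 * τ) * jTheta1 (2 * y) (2 * τ) -
        jTheta1 (2 * x) (2 * τ) * jTheta0 (2 * y) (2 * τ) := by
  have h2τ : 0 < (2 * τ).im := by simpa using hτ
  have hmul {f g : ℤ → ℂ} {a b : ℂ} (hf : HasSum f a) (hg : HasSum g b) :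
      HasSum (fun p : ℤ × ℤ => f p.1 * g p.2) (a * b) :=
    hf.mul hg (summable_mul_of_summable_norm hf.summable.norm hg.summable.norm)
  have hL := intPairParityEquiv.hasSum_iff.2
    (hmul (hasSum_jTheta hτ (x + y)) (hasSum_jTheta hτ (x - y)))
  have h1 := (hmul (hasSum_jTheta1 h2τ (2 * x)) (hasSum_jTheta0 h2τ (2 * y))).neg
  have h2 := hmul (hasSum_jTheta0 h2τ (2 * x)) (hasSum_jTheta1 h2τ (2 * y))
  refine (hL.unique (HasSum.sum ?_ ?_)).trans (neg_add_eq_sub _ _)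
  · convert! h1 using 2 with p
    simp only [Function.comp, intPairParityEquiv, Equiv.coe_fn_mk, Sum.elim_inl]
    rw [← Complex.exp_add, ← Complex.exp_add, neg_cexp, Complex.exp_eq_exp_iff_exists_int]
    exact ⟨p.1, by push_cast; ring⟩
  · convert! h2 using 2 with p
    simp only [Function.comp, intPairParityEquiv, Equiv.coe_fn_mk, Sum.elim_inr]
    rw [← Complex.exp_add, ← Complex.exp_add, Complex.exp_eq_exp_iff_exists_int]
    exact ⟨p.1, by push_cast; ring⟩

lemma hasDerivAt_jTheta0 {α β : ℝ} {τ : ℂ} (hτ : 0 < τ.im) :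
    HasDerivAt (fun y => jTheta0 y (2 * τ))
      (2 * π * I * (aCoef0 α β τ - α / 2 * jTheta0 (α * τ + β) (2 * τ))) (α * τ + β) := by
  have h2τ : 0 < (2 * τ).im := by simpa using hτ
  simp only [jTheta0_eq_jacobiTheta₂]
  convert! hasDerivAt_jacobiTheta₂_fst ((α : ℂ) * τ + β) h2τ using 1
  have h := ((hasSum_jacobiTheta₂'_term ((α : ℂ) * τ + β) h2τ).mul_left (1 / (2 * π * I))).add
    ((hasSum_jacobiTheta₂_term ((α : ℂ) * τ + β) h2τ).mul_left ((α : ℂ) / 2))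
  have : aCoef0 α β τ = _ := Eq.trans (tsum_congr fun n => ?_) h.tsum_eq
  · rw [this]
    field_simp
    ring
  · simp only [jacobiTheta₂'_term, jacobiTheta₂_term]
    field_simp
    ring_nf

lemma hasDerivAt_jTheta1 {α β : ℝ} {τ : ℂ} (hτ : 0 < τ.im) :
    HasDerivAt (fun y => jTheta1 y (2 * τ))
      (2 * π * I * (aCoef1 α β τ - α / 2 * jTheta1 (α * τ + β) (2 * τ))) (α * τ + β) := by
  have h2τ : 0 < (2 * τ).im := by simpa using hτ
  simp only [jTheta1_eq_jacobiTheta₂]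
  set v : ℂ := α * τ + β with hv
  set e : ℂ := Complex.exp (π * I * (2 * τ) / 4 + π * I * v) with he
  have h1 : HasDerivAt (fun y : ℂ => Complex.exp (π * I * (2 * τ) / 4 + π * I * y))
      (e * (π * I)) v := by
    convert! (((hasDerivAt_id v).const_mul (π * I)).const_add (π * I * (2 * τ) / 4)).cexp using 1
    simp [he]
  have h2 : HasDerivAt (fun y : ℂ => jacobiTheta₂ (y + 2 * τ / 2) (2 * τ))
      (jacobiTheta₂' (v + 2 * τ / 2) (2 * τ)) v := by
    simpa using! (hasDerivAt_jacobiTheta₂_fst (v + 2 * τ / 2) h2τ).comp v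
      ((hasDerivAt_id v).add_const (2 * τ / 2))
  convert! h1.mul h2 using 1
  have h := (((hasSum_jacobiTheta₂'_term (v + 2 * τ / 2) h2τ).mul_left (1 / (2 * π * I))).add
    ((hasSum_jacobiTheta₂_term (v + 2 * τ / 2) h2τ).mul_left (1 / 2 + (α : ℂ) / 2))).mul_left e
  have : aCoef1 α β τ = _ := Eq.trans (tsum_congr fun n => ?_) h.tsum_eq
  · rw [this, ← he]
    field_simp
    ring
  · rw [jacobiTheta₂'_term, ← hv]
    have : Complex.exp (2 * π * I * ((n : ℂ) + 1/2)^2 * τ + 2 * π * I * ((n : ℂ) + 1/2) * v)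
        = e * jacobiTheta₂_term n (v + 2 * τ / 2) (2 * τ) := by
      rw [jacobiTheta₂_term, he, ← Complex.exp_add]
      congr 1
      ring
    rw [this]
    field_simp
    ring

/-- The right-hand side as a Wronskian of theta functions. -/
theorem aCoef_mul_sub {α β : ℝ} {τ : ℂ} (hτ : 0 < τ.im) (u : ℂ) :
    4 * π * I * (aCoef1 α β τ * jTheta0 (2 * u + α * τ + β) (2 * τ)
      - aCoef0 α β τ * jTheta1 (2 * u + α * τ + β) (2 * τ)) =
    deriv (fun w => jTheta w τ) (u + (α * τ + β)) * jTheta u τ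
      - jTheta (u + (α * τ + β)) τ * deriv (fun w => jTheta w τ) u
      + 2 * π * I * α * jTheta (u + (α * τ + β)) τ * jTheta u τ := by
  rw [show 2 * u + α * τ + β = 2 * u + (α * τ + β) by ring]
  have d0 := hasDerivAt_jTheta0 (α := α) (β := β) hτ
  have d1 := hasDerivAt_jTheta1 (α := α) (β := β) hτ
  set v : ℂ := α * τ + β with hv
  have hR := (d1.const_mul (jTheta0 (2 * u + v) (2 * τ))).sub
    (d0.const_mul (jTheta1 (2 * u + v) (2 * τ)))
  have hprod (y : ℂ) : jTheta (u + v / 2 + y / 2) τ * jTheta (u + v / 2 - y / 2) τ =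
      jTheta0 (2 * u + v) (2 * τ) * jTheta1 y (2 * τ) -
        jTheta1 (2 * u + v) (2 * τ) * jTheta0 y (2 * τ) := by
    rw [jTheta_mul_jTheta hτ]
    congr 3 <;> ring_nf
  have ep : u + v / 2 + v / 2 = u + v := by ring
  have em : u + v / 2 - v / 2 = u := by ring
  have hL1 : HasDerivAt (fun y : ℂ => jTheta (u + v / 2 + y / 2) τ)
      (deriv (fun w => jTheta w τ) (u + v) * (1 / 2)) v := by
    have := (differentiable_jTheta hτ (u + v / 2 + v / 2)).hasDerivAt.comp v
      (((hasDerivAt_id v).div_const 2).const_add (u + v / 2))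
    rw [ep] at this
    exact this
  have hL2 : HasDerivAt (fun y : ℂ => jTheta (u + v / 2 - y / 2) τ)
      (deriv (fun w => jTheta w τ) u * (-(1 / 2))) v := by
    have := (differentiable_jTheta hτ (u + v / 2 - v / 2)).hasDerivAt.comp v
      (((hasDerivAt_id v).div_const 2).const_sub (u + v / 2))
    rw [em] at this
    exact this
  have hL := hL1.mul hL2
  have e := (hL.congr_of_eventuallyEq
    (Eventually.of_forall fun y => (hprod y).symm)).unique hR
  have hv' := hprod v
  rw [ep, em] at e hv'
  linear_combination (-2) * e + (2 * π * I * α) * (-hv')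

/-- The Gaussian binomial coefficient, by its Pascal recursion. -/
def gaussBinom (q : ℂ) : ℕ → ℕ → ℂ
  | _, 0 => 1
  | 0, _ + 1 => 0
  | n + 1, m + 1 => q ^ (m + 1) * gaussBinom q n (m + 1) + gaussBinom q n m

lemma gaussBinom_eq_zero (q : ℂ) : ∀ {n m : ℕ}, n < m → gaussBinom q n m = 0
  | 0, _ + 1, _ => by simp [gaussBinom]
  | n + 1, m + 1, h => by
    rw [gaussBinom, gaussBinom_eq_zero q (by omega), gaussBinom_eq_zero q (by omega)]
    simp

lemma gaussBinom_mul (q : ℂ) : ∀ a b : ℕ,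
    gaussBinom q (a + b) a * (qPochN q q a * qPochN q q b) = qPochN q q (a + b)
  | 0, b => by simp [gaussBinom, qPochN]
  | a + 1, 0 => by
    have h := gaussBinom_mul q a 0
    simp only [add_zero] at h ⊢
    rw [gaussBinom, gaussBinom_eq_zero q (Nat.lt_succ_self a)]
    simp only [qPochN, Finset.prod_range_succ, Finset.prod_range_zero, mul_one] at h ⊢
    linear_combination (1 - q * q ^ a) * h
  | a + 1, b + 1 => by
    have h1 := gaussBinom_mul q (a + 1) b
    have h2 := gaussBinom_mul q a (b + 1)
    rw [show a + 1 + (b + 1) = (a + b + 1) + 1 by ring, gaussBinom]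
    rw [show a + 1 + b = a + b + 1 by ring] at h1
    rw [show a + (b + 1) = a + b + 1 by ring] at h2
    have e (n : ℕ) : qPochN q q (n + 1) = qPochN q q n * (1 - q * q ^ n) := by
      simp [qPochN, Finset.prod_range_succ]
    rw [e (a + b + 1)]
    have ea := e a
    have eb := e b
    linear_combination (q ^ (a + 1) * (1 - q * q ^ b)) * h1 + (1 - q * q ^ a) * h2 +
      gaussBinom q (a + b + 1) (a + 1) * q ^ (a + 1) * qPochN q q (a + 1) * eb
      + gaussBinom q (a + b + 1) a * qPochN q q (b + 1) * ea
termination_by a b => a + b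

/-- The finite `q`-binomial theorem. -/
lemma qPochN_eq_sum (q : ℂ) (n : ℕ) : ∀ x : ℂ, qPochN x q n =
    ∑ m ∈ Finset.range (n + 1), (-1) ^ m * q ^ (m.choose 2) * gaussBinom q n m * x ^ m := by
  induction n with
  | zero => intro x; simp [qPochN, gaussBinom]
  | succ n ih =>
    intro x
    have h : qPochN x q (n + 1) = (1 - x) * qPochN (x * q) q n := by
      simp only [qPochN, Finset.prod_range_succ', pow_zero, mul_one]
      rw [mul_comm]
      congr 1
      refine Finset.prod_congr rfl fun j _ => ?_
      ring
    rw [h, ih, sub_mul, one_mul]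
    have e1 : ∑ m ∈ Finset.range (n + 1),
        (-1) ^ m * q ^ (m.choose 2) * gaussBinom q n m * (x * q) ^ m =
        ∑ m ∈ Finset.range (n + 2),
        (-1) ^ m * q ^ (m.choose 2) * gaussBinom q n m * (x * q) ^ m := by
      rw [Finset.sum_range_succ _ (n + 1), gaussBinom_eq_zero q (Nat.lt_succ_self n)]
      simp
    rw [Finset.mul_sum, e1, Finset.sum_range_succ' _ (n + 1), Finset.sum_range_succ' _ (n + 1),
      add_sub_right_comm, ← Finset.sum_sub_distrib]
    congr 1
    · refine Finset.sum_congr rfl fun m _ => ?_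
      rw [gaussBinom, Nat.choose_succ_succ' m 1, Nat.choose_one_right]
      ring
    · cases n <;> simp [gaussBinom]

lemma qPochN_inv_pow (q : ℂ) (hq : q ≠ 0) (N : ℕ) : qPochN (q⁻¹ ^ N) q N =
    (-1) ^ N * q⁻¹ ^ (N * (N + 1) / 2) * qPochN q q N := by
  rw [qPochN, ← Finset.prod_range_reflect]
  have : ∀ j ∈ Finset.range N, (1 - q⁻¹ ^ N * q ^ (N - 1 - j)) =
      (-1) * q⁻¹ ^ (j + 1) * (1 - q * q ^ j) := fun j hj => by
    have hj := Finset.mem_range.1 hj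
    obtain ⟨r, rfl⟩ : ∃ r, N = r + (j + 1) := ⟨N - (j + 1), by omega⟩
    rw [show r + (j + 1) - 1 - j = r by omega]
    simp only [inv_pow, pow_add, pow_one]
    field_simp
    ring
  rw [Finset.prod_congr rfl this, Finset.prod_mul_distrib, Finset.prod_mul_distrib,
    Finset.prod_const, Finset.card_range, Finset.prod_pow_eq_pow_sum, qPochN]
  congr 3
  have h := Finset.sum_range_id (N + 1)
  rw [Finset.sum_range_succ', Nat.add_sub_cancel, mul_comm] at h
  simpa using h

/-- The finite form of Jacobi's identity. -/
lemma finite_jacobi (q : ℂ) (hq : q ≠ 0) (M : ℕ) :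
    ∑ m ∈ Finset.range (2 * (M + 1) + 1), (((M + 1 : ℕ) : ℂ) - m) * ((-1) ^ m * q ^ (m.choose 2) *
      gaussBinom q (2 * (M + 1)) m * (q⁻¹ ^ (M + 1)) ^ m) =
    (-1) ^ (M + 1) * q⁻¹ ^ ((M + 1) * (M + 2) / 2) * qPochN q q (M + 1) * qPochN q q M := by
  set X : ℂ := q⁻¹ ^ (M + 1) with hX
  have hXq : X * q ^ (M + 1) = 1 := by rw [hX, ← mul_pow, inv_mul_cancel₀ hq, one_pow]
  have hfac : ∀ x : ℂ, qPochN x q (2 * (M + 1)) =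
      qPochN x q (M + 1) * ((∏ j ∈ Finset.range M, (1 - x * q ^ (M + 1 + (j + 1)))) *
        (1 - x * q ^ (M + 1))) := fun x => by
    rw [qPochN, two_mul, Finset.prod_range_add,
      Finset.prod_range_succ' (fun j => 1 - x * q ^ (M + 1 + j)), qPochN, add_zero]
  have hdiff1 : Differentiable ℂ fun x => qPochN x q (M + 1) *
      ∏ j ∈ Finset.range M, (1 - x * q ^ (M + 1 + (j + 1))) := by
    unfold qPochN
    fun_prop
  have hprod : ∏ j ∈ Finset.range M, (1 - X * q ^ (M + 1 + (j + 1))) = qPochN q q M := by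
    refine Finset.prod_congr rfl fun j _ => ?_
    rw [pow_add q (M + 1), ← mul_assoc, hXq, pow_succ']
    ring
  have hd1 : HasDerivAt (fun x => qPochN x q (2 * (M + 1)))
      (-(qPochN X q (M + 1) * qPochN q q M) * q ^ (M + 1)) X := by
    have h1 : HasDerivAt (fun x : ℂ => 1 - x * q ^ (M + 1)) (-(1 * q ^ (M + 1))) X :=
      ((hasDerivAt_id X).mul_const (q ^ (M + 1))).const_sub 1
    have := (hdiff1 X).hasDerivAt.mul h1
    refine (this.congr_of_eventuallyEq (Eventually.of_forall fun x => ?_)).congr_deriv ?_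
    · simp only [hfac, Pi.mul_apply]; ring
    · simp only [hXq, hprod]; ring
  have hd2 : HasDerivAt (fun x => qPochN x q (2 * (M + 1)))
      (∑ m ∈ Finset.range (2 * (M + 1) + 1), (-1) ^ m * q ^ (m.choose 2) *
      gaussBinom q (2 * (M + 1)) m * (m * X ^ (m - 1))) X := by
    refine (HasDerivAt.fun_sum fun m _ => (hasDerivAt_pow m X).const_mul _).congr_of_eventuallyEq
      (Eventually.of_forall fun x => qPochN_eq_sum q _ x)
  have h0 : qPochN X q (2 * (M + 1)) = 0 := by rw [hfac, hXq]; simp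
  have hder := hd1.unique hd2
  rw [qPochN_eq_sum] at h0
  have e : ∑ m ∈ Finset.range (2 * (M + 1) + 1), (((M + 1 : ℕ) : ℂ) - m) * ((-1) ^ m *
      q ^ (m.choose 2) * gaussBinom q (2 * (M + 1)) m * X ^ m) =
      ((M + 1 : ℕ) : ℂ) * (∑ m ∈ Finset.range (2 * (M + 1) + 1), (-1) ^ m *
      q ^ (m.choose 2) * gaussBinom q (2 * (M + 1)) m * X ^ m) -
      X * (∑ m ∈ Finset.range (2 * (M + 1) + 1), (-1) ^ m * q ^ (m.choose 2) *
      gaussBinom q (2 * (M + 1)) m * (m * X ^ (m - 1))) := by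
    rw [Finset.mul_sum, Finset.mul_sum, ← Finset.sum_sub_distrib]
    refine Finset.sum_congr rfl fun m _ => ?_
    rcases m with _ | m
    · simp
    · simp only [Nat.add_sub_cancel]
      ring
  rw [e, h0, ← hder, qPochN_inv_pow q hq]
  linear_combination ((-1) ^ (M + 1) * q⁻¹ ^ ((M + 1) * (M + 2) / 2) * qPochN q q (M + 1) *
    qPochN q q M) * hXq

lemma cexp_pow_half (τ : ℂ) {n k : ℕ} (h : 2 * n = k) :
    cexp (2 * π * I * τ) ^ n = cexp (π * I * k * τ) := by
  rw [← Complex.exp_nat_mul, ← h]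
  congr 1
  push_cast
  ring

/-- The finite form of Jacobi's identity, summed over a symmetric interval. -/
lemma finite_jacobi_symm (τ : ℂ) (M : ℕ) :
    ∑ k ∈ Finset.Icc (-((M + 1 : ℕ) : ℤ)) ((M + 1 : ℕ) : ℤ),
      jacobiTheta₂'_term k (1 / 2 + τ / 2) τ *
        gaussBinom (cexp (2 * π * I * τ)) (2 * (M + 1)) (((M + 1 : ℕ) : ℤ) - k).toNat =
    2 * π * I * (qPochN (cexp (2 * π * I * τ)) (cexp (2 * π * I * τ)) (M + 1) *
      qPochN (cexp (2 * π * I * τ)) (cexp (2 * π * I * τ)) M) := by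
  have hJ := finite_jacobi (cexp (2 * π * I * τ)) (Complex.exp_ne_zero _) M
  set q := cexp (2 * π * I * τ) with hq
  have hN : q⁻¹ ^ ((M + 1) * (M + 2) / 2) = cexp (-(π * I * ((M + 1) * (M + 2)) * τ)) := by
    rw [inv_pow, hq, cexp_pow_half τ (Nat.mul_div_cancel' (Nat.even_mul_succ_self (M + 1)).two_dvd),
      ← Complex.exp_neg]
    push_cast
    ring_nf
  have key : ∀ m ∈ Finset.range (2 * (M + 1) + 1),
      jacobiTheta₂'_term (((M + 1 : ℕ) : ℤ) - m) (1 / 2 + τ / 2) τ * gaussBinom q (2 * (M + 1)) m =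
      2 * π * I * ((-1) ^ (M + 1) * cexp (π * I * ((M + 1) * (M + 2)) * τ)) *
      ((((M + 1 : ℕ) : ℂ) - m) * ((-1) ^ m * q ^ (m.choose 2) *
      gaussBinom q (2 * (M + 1)) m * (q⁻¹ ^ (M + 1)) ^ m)) := fun m _ => by
    have e1 : q ^ m.choose 2 = cexp (π * I * (m * (m - 1)) * τ) := by
      rw [← Complex.exp_nat_mul, Nat.cast_choose_two]
      congr 1
      ring
    have e2 : (q⁻¹ ^ (M + 1)) ^ m = cexp (-(2 * π * I * ((M + 1) * m) * τ)) := by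
      rw [hq, ← Complex.exp_neg, ← pow_mul, ← Complex.exp_nat_mul]
      congr 1
      push_cast
      ring
    have e3 : ((-1 : ℂ)) ^ (M + 1) * (-1) ^ m = cexp (π * I * ((M + 1) - m)) := by
      have : cexp (π * I * ((M + 1) - m)) = cexp (((M + 1 + m : ℕ) : ℂ) * (π * I)) *
          cexp ((-(m : ℤ) : ℤ) * (2 * π * I)) := by
        rw [← Complex.exp_add]
        congr 1
        push_cast
        ring
      rw [this, Complex.exp_int_mul_two_pi_mul_I, mul_one, Complex.exp_nat_mul, Complex.exp_pi_mul_I,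
        ← pow_add]
    have e4 : jacobiTheta₂_term (((M + 1 : ℕ) : ℤ) - m) (1 / 2 + τ / 2) τ =
        (-1) ^ (M + 1) * (-1) ^ m * (cexp (π * I * ((M + 1) * (M + 2)) * τ) * q ^ m.choose 2 *
          (q⁻¹ ^ (M + 1)) ^ m) := by
      rw [e1, e2, e3, jacobiTheta₂_term, ← Complex.exp_add, ← Complex.exp_add, ← Complex.exp_add]
      congr 1
      push_cast
      ring
    rw [jacobiTheta₂'_term, e4]
    push_cast
    ring
  have hre : ∑ k ∈ Finset.Icc (-((M + 1 : ℕ) : ℤ)) ((M + 1 : ℕ) : ℤ),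
      jacobiTheta₂'_term k (1 / 2 + τ / 2) τ *
        gaussBinom q (2 * (M + 1)) (((M + 1 : ℕ) : ℤ) - k).toNat =
      ∑ m ∈ Finset.range (2 * (M + 1) + 1),
      jacobiTheta₂'_term (((M + 1 : ℕ) : ℤ) - m) (1 / 2 + τ / 2) τ *
        gaussBinom q (2 * (M + 1)) m := by
    refine Finset.sum_nbij' (fun k => (((M + 1 : ℕ) : ℤ) - k).toNat)
      (fun m => ((M + 1 : ℕ) : ℤ) - m) ?_ ?_ ?_ ?_ ?_
    · intro k hk; simp only [Finset.mem_Icc, Finset.mem_range] at *; omega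
    · intro k hk; simp only [Finset.mem_Icc, Finset.mem_range] at *; omega
    · intro k hk; simp only [Finset.mem_Icc] at *; omega
    · intro k hk; omega
    · intro k hk
      simp only [Finset.mem_Icc] at hk
      rw [show ((M + 1 : ℕ) : ℤ) - ((((M + 1 : ℕ) : ℤ) - k).toNat : ℤ) = k by omega]
  rw [hre, Finset.sum_congr rfl key, ← Finset.mul_sum, hJ, hN]
  have hs : ((-1 : ℂ) ^ (M + 1)) * (-1) ^ (M + 1) = 1 := by
    rw [← mul_pow]; simp
  have he : cexp (π * I * ((M + 1) * (M + 2)) * τ) * cexp (-(π * I * ((M + 1) * (M + 2)) * τ)) = 1 := by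
    rw [← Complex.exp_add]; simp
  linear_combination (2 * π * I * (qPochN q q (M + 1) * qPochN q q M)) *
    (cexp (π * I * ((M + 1) * (M + 2)) * τ) * cexp (-(π * I * ((M + 1) * (M + 2)) * τ))) * hs +
    (2 * π * I * (qPochN q q (M + 1) * qPochN q q M)) * he

lemma norm_cexp_two_pi_mul_I_lt_one {τ : ℂ} (hτ : 0 < τ.im) : ‖cexp (2 * π * I * τ)‖ < 1 := by
  rw [Complex.norm_exp]
  simp
  positivity

lemma qPochN_self_ne_zero {q : ℂ} (hq : ‖q‖ < 1) (n : ℕ) : qPochN q q n ≠ 0 := by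
  refine Finset.prod_ne_zero_iff.2 fun j _ h => ?_
  have : ‖q ^ (j + 1)‖ = 1 := by rw [pow_succ', ← sub_eq_zero.1 h, norm_one]
  rw [norm_pow] at this
  exact (pow_lt_one₀ (norm_nonneg _) hq (Nat.succ_ne_zero j)).ne this

lemma tendsto_qPochN_self {q : ℂ} (hq : ‖q‖ < 1) :
    Tendsto (qPochN q q) atTop (𝓝 (∏' n : ℕ, (1 - q ^ (n + 1)))) := by
  have := (ModularForm.multipliable_one_sub_pow hq).hasProd.tendsto_prod_nat
  refine this.congr fun n => Finset.prod_congr rfl fun j _ => ?_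
  rw [pow_succ']

lemma tprod_one_sub_pow_ne_zero {q : ℂ} (hq : ‖q‖ < 1) : ∏' n : ℕ, (1 - q ^ (n + 1)) ≠ 0 := by
  have hs : Summable fun n : ℕ => ‖-q ^ (n + 1)‖ := by
    simp only [norm_neg, norm_pow]
    exact (summable_nat_add_iff 1).2 (summable_geometric_of_lt_one (norm_nonneg _) hq)
  have := tprod_one_add_ne_zero_of_summable (f := fun n : ℕ => -q ^ (n + 1)) (fun n h => ?_) hs
  · simpa [sub_eq_add_neg] using this
  · have : ‖q ^ (n + 1)‖ = 1 := by
      rw [← sub_eq_add_neg] at h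
      rw [← sub_eq_zero.1 h, norm_one]
    rw [norm_pow] at this
    exact (pow_lt_one₀ (norm_nonneg _) hq (Nat.succ_ne_zero n)).ne this

lemma jacobiTheta₂'_half_period {τ : ℂ} (hτ : 0 < τ.im) : jacobiTheta₂' (1 / 2 + τ / 2) τ =
    2 * π * I * (∏' n : ℕ, (1 - cexp (2 * π * I * τ) ^ (n + 1))) ^ 3 := by
  have hq := norm_cexp_two_pi_mul_I_lt_one hτ
  have hfin := finite_jacobi_symm τ
  set q := cexp (2 * π * I * τ)
  set P := ∏' n : ℕ, (1 - q ^ (n + 1)) with hP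
  have hP0 : P ≠ 0 := tprod_one_sub_pow_ne_zero hq
  have ht := tendsto_qPochN_self hq
  have hn := qPochN_self_ne_zero hq
  obtain ⟨C, hC⟩ : ∃ C, ∀ n, ‖qPochN q q n‖ ≤ C := by
    obtain ⟨C, hC⟩ := (Metric.isBounded_range_of_tendsto _ ht).exists_norm_le
    exact ⟨C, fun n => hC _ ⟨n, rfl⟩⟩
  obtain ⟨C', hC'⟩ : ∃ C, ∀ n, ‖(qPochN q q n)⁻¹‖ ≤ C := by
    obtain ⟨C, hC⟩ := (Metric.isBounded_range_of_tendsto _ (ht.inv₀ hP0)).exists_norm_le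
    exact ⟨C, fun n => hC _ ⟨n, rfl⟩⟩
  have hCn : 0 ≤ C := (norm_nonneg _).trans (hC 0)
  have hCn' : 0 ≤ C' := (norm_nonneg _).trans (hC' 0)
  set T : ℤ → ℂ := fun k => jacobiTheta₂'_term k (1 / 2 + τ / 2) τ with hT
  have hTs : Summable T := (summable_jacobiTheta₂'_term_iff _ _).2 hτ
  let g : ℕ → ℤ → ℂ := fun M k => (Finset.Icc (-((M + 1 : ℕ) : ℤ)) ((M + 1 : ℕ) : ℤ) : Set ℤ).indicator
    (fun k => T k * gaussBinom q (2 * (M + 1)) (((M + 1 : ℕ) : ℤ) - k).toNat) k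
  have hG : ∀ (M : ℕ) (k : ℤ), k ∈ Finset.Icc (-((M + 1 : ℕ) : ℤ)) ((M + 1 : ℕ) : ℤ) →
      gaussBinom q (2 * (M + 1)) (((M + 1 : ℕ) : ℤ) - k).toNat =
      qPochN q q (2 * (M + 1)) * ((qPochN q q (((M + 1 : ℕ) : ℤ) - k).toNat)⁻¹ *
        (qPochN q q (((M + 1 : ℕ) : ℤ) + k).toNat)⁻¹) := fun M k hk => by
    rw [Finset.mem_Icc] at hk
    have := gaussBinom_mul q (((M + 1 : ℕ) : ℤ) - k).toNat (((M + 1 : ℕ) : ℤ) + k).toNat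
    rw [show (((M + 1 : ℕ) : ℤ) - k).toNat + (((M + 1 : ℕ) : ℤ) + k).toNat = 2 * (M + 1) by
      omega] at this
    rw [← mul_inv, ← this, mul_assoc, mul_inv_cancel₀ (mul_ne_zero (hn _) (hn _)), mul_one]
  have hlim : Tendsto (fun M => ∑' k, g M k) atTop (𝓝 (∑' k, T k * (P * (P⁻¹ * P⁻¹)))) := by
    refine tendsto_tsum_of_dominated_convergence (bound := fun k => ‖T k‖ * (C * (C' * C')))
      (hTs.norm.mul_right _) (fun k => ?_) (Eventually.of_forall fun M k => ?_)
    · have h1 : Tendsto (fun M : ℕ => 2 * (M + 1)) atTop atTop :=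
        tendsto_atTop_mono (fun M => (by omega : M ≤ 2 * (M + 1))) tendsto_id
      have h2 (l : ℤ) : Tendsto (fun M : ℕ => (((M + 1 : ℕ) : ℤ) + l).toNat) atTop atTop := by
        refine tendsto_atTop.2 fun b => ?_
        filter_upwards [eventually_ge_atTop (b + l.natAbs)] with M hM
        omega
      have := ((ht.comp h1).mul (((ht.comp (h2 (-k))).inv₀ hP0).mul
        ((ht.comp (h2 k)).inv₀ hP0))).const_mul (T k)
      refine this.congr' ?_
      filter_upwards [eventually_ge_atTop k.natAbs] with M hM
      have hk : k ∈ Finset.Icc (-((M + 1 : ℕ) : ℤ)) ((M + 1 : ℕ) : ℤ) := by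
        rw [Finset.mem_Icc]; omega
      simp only [g]
      rw [Set.indicator_of_mem (by exact_mod_cast hk), hG M k hk]
      simp [sub_eq_add_neg]
    · by_cases hk : k ∈ Finset.Icc (-((M + 1 : ℕ) : ℤ)) ((M + 1 : ℕ) : ℤ)
      · simp only [g]
        rw [Set.indicator_of_mem (by exact_mod_cast hk), hG M k hk]
        simp only [norm_mul]
        gcongr
        exacts [hC _, hC' _, hC' _]
      · simp only [g]
        rw [Set.indicator_of_notMem (by exact_mod_cast hk), norm_zero]
        positivity
  have hg : ∀ M, ∑' k, g M k = 2 * π * I * (qPochN q q (M + 1) * qPochN q q M) := fun M => by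
    rw [← hfin M]
    rw [tsum_eq_sum (s := Finset.Icc (-((M + 1 : ℕ) : ℤ)) ((M + 1 : ℕ) : ℤ))]
    · refine Finset.sum_congr rfl fun k hk => ?_
      exact Set.indicator_of_mem (by exact_mod_cast hk) _
    · intro k hk
      exact Set.indicator_of_notMem (by exact_mod_cast hk) _
  have hlim2 := ((ht.comp (tendsto_add_atTop_nat 1)).mul ht).const_mul (2 * π * I : ℂ)
  have := tendsto_nhds_unique (hlim.congr hg) hlim2
  rw [tsum_mul_right] at this
  rw [jacobiTheta₂']
  field_simp at this
  linear_combination this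

lemma dedekindEta_eq (τ : ℂ) : dedekindEta τ =
    cexp (π * I * τ / 12) * ∏' n : ℕ, (1 - cexp (2 * π * I * τ) ^ (n + 1)) := by
  rw [dedekindEta]
  congr 1
  refine tprod_congr fun n => ?_
  rw [← Complex.exp_nat_mul]
  push_cast
  ring_nf

lemma dedekindEta_ne_zero {τ : ℂ} (hτ : 0 < τ.im) : dedekindEta τ ≠ 0 := by
  rw [dedekindEta_eq]
  exact mul_ne_zero (Complex.exp_ne_zero _)
    (tprod_one_sub_pow_ne_zero (norm_cexp_two_pi_mul_I_lt_one hτ))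

lemma deriv_jTheta_zero {τ : ℂ} (hτ : 0 < τ.im) :
    deriv (fun u => jTheta u τ) 0 = -2 * π * dedekindEta τ ^ 3 := by
  have h0 : jacobiTheta₂ (1 / 2 + τ / 2) τ = 0 := by
    have := jTheta_zero τ
    rw [jTheta_eq_jacobiTheta₂, zero_add] at this
    exact (mul_eq_zero.1 this).resolve_left (Complex.exp_ne_zero _)
  have h1 : HasDerivAt (fun u => jacobiTheta₂ (u + 1 / 2 + τ / 2) τ)
      (jacobiTheta₂' (1 / 2 + τ / 2) τ) 0 := by
    have h := hasDerivAt_jacobiTheta₂_fst (0 + (1 / 2 + τ / 2)) hτ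
    simpa [add_assoc] using h.comp_add_const 0 (1 / 2 + τ / 2)
  have h2 : HasDerivAt (fun u : ℂ => cexp (π * I * τ / 4 + π * I * (u + 1 / 2)))
      (cexp (π * I * τ / 4 + π * I * (0 + 1 / 2)) * (π * I)) 0 := by
    refine HasDerivAt.cexp ?_
    simpa only [mul_one, id] using (((hasDerivAt_id (0 : ℂ)).add_const (1 / 2)).const_mul
      (π * I : ℂ)).const_add (π * I * τ / 4)
  have h3 := (h2.mul h1).deriv
  have h4 : (fun u => jTheta u τ) = (fun u : ℂ => cexp (π * I * τ / 4 + π * I * (u + 1 / 2))) *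
      fun u => jacobiTheta₂ (u + 1 / 2 + τ / 2) τ := by
    ext u
    rw [jTheta_eq_jacobiTheta₂, Pi.mul_apply]
  rw [h4, h3, zero_add, h0, jacobiTheta₂'_half_period hτ, dedekindEta_eq, mul_pow,
    ← Complex.exp_nat_mul, Complex.exp_add, show (π * I * (1 / 2) : ℂ) = π / 2 * I by ring,
    Complex.exp_pi_div_two_mul_I, show ((3 : ℕ) : ℂ) * (π * I * τ / 12) = π * I * τ / 4 by
      push_cast; ring]
  linear_combination (cexp (π * I * τ / 4) * 2 * π *
    (∏' n : ℕ, (1 - cexp (2 * π * I * τ) ^ (n + 1))) ^ 3) * I_sq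

/-- The kernel `1 / (1 - exp (2πiw))` of Lerch sums. -/
def lerchKernel (w : ℂ) : ℂ := (1 - cexp (2 * π * I * w))⁻¹

lemma cexp_two_pi_mul_ne_one {w : ℂ} (h : ∀ m : ℤ, w ≠ m) : cexp (2 * π * I * w) ≠ 1 := by
  intro e
  obtain ⟨m, hm⟩ := Complex.exp_eq_one_iff.1 e
  refine h m ?_
  have : (2 * π * I : ℂ) ≠ 0 := by simp [pi_ne_zero]
  exact mul_left_cancel₀ this (by rw [hm]; ring)

lemma hasDerivAt_lerchKernel {w : ℂ} (h : cexp (2 * π * I * w) ≠ 1) :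
    HasDerivAt lerchKernel (2 * π * I * (lerchKernel w ^ 2 - lerchKernel w)) w := by
  have h0 : 1 - cexp (2 * π * I * w) ≠ 0 := sub_ne_zero.2 h.symm
  have h1 : HasDerivAt (fun w : ℂ => 1 - cexp (2 * π * I * w))
      (-(cexp (2 * π * I * w) * (2 * π * I * 1))) w :=
    ((hasDerivAt_id w).const_mul (2 * π * I : ℂ)).cexp.const_sub 1
  refine (h1.inv h0).congr_deriv ?_
  rw [lerchKernel]
  field_simp
  ring

lemma norm_lerchKernel_le_two {w : ℂ} (h : 1 ≤ |w.im|) :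
    cexp (2 * π * I * w) ≠ 1 ∧ ‖lerchKernel w‖ ≤ 2 := by
  have hn : ‖cexp (2 * π * I * w)‖ = rexp (-(2 * π * w.im)) := by
    rw [Complex.norm_exp]; simp
  suffices 1 / 2 ≤ ‖1 - cexp (2 * π * I * w)‖ by
    constructor
    · intro e
      rw [e] at this
      norm_num at this
    · rw [lerchKernel, norm_inv]
      exact inv_le_of_inv_le₀ (by norm_num) (by simpa using this)
  have h2 : 2 ≤ rexp (2 * π) := by
    have := Real.add_one_le_exp (2 * π)
    linarith [pi_gt_three]
  rcases le_abs.1 h with h | h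
  · have : rexp (-(2 * π * w.im)) ≤ 1 / 2 := by
      calc rexp (-(2 * π * w.im)) ≤ rexp (-(2 * π)) := by
            exact Real.exp_le_exp.2 (by nlinarith [pi_pos])
        _ ≤ 1 / 2 := by
            rw [Real.exp_neg, one_div]
            exact inv_anti₀ two_pos h2
    have h3 := norm_sub_norm_le (1 : ℂ) (cexp (2 * π * I * w))
    rw [hn, norm_one] at h3
    linarith
  · have : 2 ≤ rexp (-(2 * π * w.im)) := by
      refine h2.trans (Real.exp_le_exp.2 ?_)
      nlinarith [pi_pos]
    have h3 := norm_sub_norm_le (cexp (2 * π * I * w)) (1 : ℂ)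
    rw [hn, norm_one, norm_sub_rev] at h3
    linarith

lemma eventually_norm_lerchKernel_le {τ : ℂ} (hτ : 0 < τ.im) (z : ℂ) {s : Set ℤ}
    (hs : ∀ n ∈ s, ∀ m : ℤ, z + n * τ ≠ m) : ∃ M : ℝ, 0 ≤ M ∧ ∀ᶠ p : ℂ × ℂ in 𝓝 (z, τ), ∀ n ∈ s,
      cexp (2 * π * I * (p.1 + n * p.2)) ≠ 1 ∧ ‖lerchKernel (p.1 + n * p.2)‖ ≤ M := by
  classical
  obtain ⟨N, hN⟩ := exists_nat_ge ((|z.im| + 2) / (τ.im / 2))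
  rw [div_le_iff₀ (by positivity)] at hN
  let F : Finset ℤ := (Finset.Icc (-(N : ℤ)) N).filter (· ∈ s)
  refine ⟨2 + ∑ n ∈ F, (‖lerchKernel (z + n * τ)‖ + 1), by positivity, ?_⟩
  have hfin : ∀ᶠ p : ℂ × ℂ in 𝓝 (z, τ), ∀ n ∈ F, cexp (2 * π * I * (p.1 + n * p.2)) ≠ 1 ∧
      ‖lerchKernel (p.1 + n * p.2)‖ ≤ ‖lerchKernel (z + n * τ)‖ + 1 := by
    rw [Filter.eventually_all_finset]
    intro n hn
    have h1 : cexp (2 * π * I * (z + n * τ)) ≠ 1 :=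
      cexp_two_pi_mul_ne_one (hs n (Finset.mem_filter.1 hn).2)
    have hc : ContinuousAt (fun p : ℂ × ℂ => p.1 + n * p.2) (z, τ) := by fun_prop
    have hc1 : ContinuousAt (fun p : ℂ × ℂ => cexp (2 * π * I * (p.1 + n * p.2))) (z, τ) := by
      fun_prop
    have hc2 : ContinuousAt (fun p : ℂ × ℂ => ‖lerchKernel (p.1 + n * p.2)‖) (z, τ) :=
      ((hasDerivAt_lerchKernel h1).continuousAt.comp_of_eq hc rfl).norm
    refine (hc1.eventually_ne h1).and ?_
    filter_upwards [hc2.eventually_lt_const (lt_add_one _)] with p hp using hp.le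
  have h1 : ∀ᶠ p : ℂ × ℂ in 𝓝 (z, τ), τ.im / 2 < p.2.im :=
    (show ContinuousAt (fun p : ℂ × ℂ => p.2.im) (z, τ) by fun_prop).eventually_const_lt
      (by simpa using hτ)
  have h2 : ∀ᶠ p : ℂ × ℂ in 𝓝 (z, τ), |p.1.im| < |z.im| + 1 :=
    (show ContinuousAt (fun p : ℂ × ℂ => |p.1.im|) (z, τ) by fun_prop).eventually_lt_const
      (lt_add_one _)
  filter_upwards [hfin, h1, h2] with p hp hp1 hp2 n hn
  have hpos : 0 ≤ ∑ n ∈ F, (‖lerchKernel (z + n * τ)‖ + 1) := by positivity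
  by_cases hnF : n ∈ F
  · refine ⟨(hp n hnF).1, (hp n hnF).2.trans ?_⟩
    have := Finset.single_le_sum (f := fun n : ℤ => ‖lerchKernel (z + n * τ)‖ + 1)
      (fun _ _ => by positivity) hnF
    linarith
  · have hlarge : (N : ℝ) ≤ |(n : ℝ)| := by
      have : (N : ℤ) ≤ |n| := by
        by_contra! h
        refine hnF (Finset.mem_filter.2 ⟨Finset.mem_Icc.2 ?_, hn⟩)
        rw [abs_lt] at h
        omega
      exact_mod_cast this
    have him : 1 ≤ |(p.1 + n * p.2).im| := by
      have e : (p.1 + n * p.2).im = n * p.2.im - (-p.1.im) := by simp; ring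
      have h3 := abs_sub_abs_le_abs_sub (n * p.2.im) (-p.1.im)
      rw [e]
      rw [abs_mul, abs_neg, abs_of_pos (by linarith : 0 < p.2.im)] at h3
      have h4 : (N : ℝ) * (τ.im / 2) ≤ |(n : ℝ)| * p.2.im := by gcongr
      linarith
    have := norm_lerchKernel_le_two him
    exact ⟨this.1, this.2.trans (by linarith)⟩

lemma OffLattice.cexp_ne_one {τ u : ℂ} (h : OffLattice τ u) (n : ℤ) :
    cexp (2 * π * I * (u + n * τ)) ≠ 1 :=
  cexp_two_pi_mul_ne_one (h.add_int_mul_ne n)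

lemma exists_norm_lerchKernel_le {τ : ℂ} (hτ : 0 < τ.im) {u : ℂ} (hu : OffLattice τ u) :
    ∃ M : ℝ, 0 ≤ M ∧ ∀ n : ℤ, ‖lerchKernel (u + n * τ)‖ ≤ M := by
  obtain ⟨M, hM0, hM⟩ := eventually_norm_lerchKernel_le hτ u (s := Set.univ)
    (fun n _ m => hu.add_int_mul_ne n m)
  exact ⟨M, hM0, fun n => (hM.self_of_nhds n trivial).2⟩

lemma summable_mul_lerchKernel_pow {τ : ℂ} (hτ : 0 < τ.im) {u : ℂ} (hu : OffLattice τ u)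
    {b : ℤ → ℂ} (hb : Summable b) (k : ℕ) :
    Summable fun n : ℤ => b n * lerchKernel (u + n * τ) ^ k := by
  obtain ⟨M, hM0, hM⟩ := exists_norm_lerchKernel_le hτ hu
  refine .of_norm_bounded (hb.norm.mul_right (M ^ k)) fun n => ?_
  rw [norm_mul, norm_pow]
  gcongr
  exact hM n

/-- Termwise differentiation of Lerch-type sums in the elliptic variable, away from the poles of
the terms that are actually present. -/
lemma hasDerivAt_tsum_lerchKernel_pow {τ : ℂ} (hτ : 0 < τ.im) {z : ℂ} {b : ℤ → ℂ}
    (hb : Summable b) (hz : ∀ n, b n ≠ 0 → ∀ m : ℤ, z + n * τ ≠ m) (k : ℕ) :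
    HasDerivAt (fun u => ∑' n : ℤ, b n * lerchKernel (u + n * τ) ^ k)
      (∑' n : ℤ, b n * (2 * π * I * k *
        (lerchKernel (z + n * τ) ^ (k + 1) - lerchKernel (z + n * τ) ^ k))) z := by
  obtain ⟨M, hM0, hM⟩ := eventually_norm_lerchKernel_le hτ z (s := {n | b n ≠ 0}) hz
  have hev : ∀ᶠ u in 𝓝 z, ∀ n, b n ≠ 0 → cexp (2 * π * I * (u + n * τ)) ≠ 1 ∧
      ‖lerchKernel (u + n * τ)‖ ≤ M :=
    (show ContinuousAt (fun u : ℂ => (u, τ)) z by fun_prop).eventually hM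
  obtain ⟨ε, hε, hball⟩ := Metric.eventually_nhds_iff_ball.1 hev
  refine hasDerivAt_tsum_of_isPreconnected (t := Metric.ball z ε)
    (g := fun n u => b n * lerchKernel (u + n * τ) ^ k) (g' := fun n z => b n * (2 * π * I * k *
        (lerchKernel (z + n * τ) ^ (k + 1) - lerchKernel (z + n * τ) ^ k)))
    (u := fun n => ‖b n‖ * (2 * π * k * (M ^ (k + 1) + M ^ k)))
    (hb.norm.mul_right _) Metric.isOpen_ball
    (convex_ball z ε).isPreconnected (fun n y hy => ?_) (fun n y hy => ?_)
    (Metric.mem_ball_self hε) ?_ (Metric.mem_ball_self hε)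
  · by_cases hn : b n = 0
    · simpa [hn] using hasDerivAt_const y (0 : ℂ)
    · have h1 := (hasDerivAt_lerchKernel (hball y hy n hn).1).comp_add_const y (n * τ)
      refine ((h1.pow k).const_mul (b n)).congr_deriv ?_
      rcases k with _ | k
      · simp
      · simp only [Nat.add_sub_cancel]
        push_cast
        ring
  · by_cases hn : b n = 0
    · simp [hn]
    · have hR := (hball y hy n hn).2
      rw [norm_mul, norm_mul]
      have h2 : ‖(2 * π * I * k : ℂ)‖ = 2 * π * k := by
        simp [abs_of_pos pi_pos]
      rw [h2]
      gcongr
      refine (norm_sub_le _ _).trans ?_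
      rw [norm_pow, norm_pow]
      gcongr
  · refine .of_norm_bounded (hb.norm.mul_right (M ^ k)) fun n => ?_
    by_cases hn : b n = 0
    · simp [hn]
    · rw [norm_mul, norm_pow]
      gcongr
      exact (hball z (Metric.mem_ball_self hε) n hn).2

lemma summable_pow_mul_jacobiTheta₂_term {τ : ℂ} (hτ : 0 < τ.im) (z : ℂ) (k : ℕ) :
    Summable fun n : ℤ => (n : ℂ) ^ k * jacobiTheta₂_term n z τ := by
  refine .of_norm_bounded (summable_pow_mul_jacobiTheta₂_term_bound |z.im| hτ k) fun n => ?_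
  rw [norm_mul, norm_pow, Complex.norm_intCast, Int.cast_abs]
  gcongr
  rw [← Int.cast_abs]
  exact norm_jacobiTheta₂_term_le hτ le_rfl le_rfl n

/-- Termwise differentiation of Lerch sums in the modular variable. -/
lemma hasDerivAt_tsum_jacobiTheta₂_term_mul_lerchKernel {τ : ℂ} (hτ : 0 < τ.im) {u : ℂ}
    (hu : OffLattice τ u) (a b : ℂ) :
    HasDerivAt (fun t => ∑' n : ℤ, jacobiTheta₂_term n (a * t + b) t * lerchKernel (u + n * t))
      (∑' n : ℤ, jacobiTheta₂_term n (a * τ + b) τ *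
        (π * I * (n ^ 2 + 2 * n * a) * lerchKernel (u + n * τ) +
        2 * π * I * n * (lerchKernel (u + n * τ) ^ 2 - lerchKernel (u + n * τ)))) τ := by
  obtain ⟨M, hM0, hM⟩ := eventually_norm_lerchKernel_le hτ u (s := Set.univ)
    (fun n _ m => hu.add_int_mul_ne n m)
  set S : ℝ := |(a * τ + b).im| + 1
  have hT : 0 < τ.im / 2 := by positivity
  have hev : ∀ᶠ t in 𝓝 τ, (∀ n : ℤ, cexp (2 * π * I * (u + n * t)) ≠ 1 ∧
      ‖lerchKernel (u + n * t)‖ ≤ M) ∧ |(a * t + b).im| < S ∧ τ.im / 2 < t.im := by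
    refine ((((show ContinuousAt (fun t : ℂ => (u, t)) τ by fun_prop).eventually hM).mono
      fun t ht n => ht n trivial)).and (.and ?_ ?_)
    · exact (show ContinuousAt (fun t : ℂ => |(a * t + b).im|) τ by fun_prop).eventually_lt_const
        (lt_add_one _)
    · exact (show ContinuousAt (fun t : ℂ => t.im) τ by fun_prop).eventually_const_lt
        (by linarith)
  obtain ⟨ε, hε, hball⟩ := Metric.eventually_nhds_iff_ball.1 hev
  let B : ℤ → ℝ := fun n => rexp (-π * (τ.im / 2 * n ^ 2 - 2 * S * |n|))
  have hB : ∀ k : ℕ, Summable fun n : ℤ => (|n| ^ k : ℝ) * B n := fun k =>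
    summable_pow_mul_jacobiTheta₂_term_bound S hT k
  refine hasDerivAt_tsum_of_isPreconnected (t := Metric.ball τ ε)
    (g := fun n t => jacobiTheta₂_term n (a * t + b) t * lerchKernel (u + n * t))
    (g' := fun n t => jacobiTheta₂_term n (a * t + b) t *
        (π * I * (n ^ 2 + 2 * n * a) * lerchKernel (u + n * t) +
        2 * π * I * n * (lerchKernel (u + n * t) ^ 2 - lerchKernel (u + n * t))))
    (u := fun n : ℤ => π * M * ((|n| ^ 2 : ℝ) * B n) +
      (π * 2 * ‖a‖ * M + 2 * π * (M ^ 2 + M)) * ((|n| ^ 1 : ℝ) * B n))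
    (((hB 2).mul_left _).add ((hB 1).mul_left _)) Metric.isOpen_ball
    (convex_ball τ ε).isPreconnected (fun n t ht => ?_) (fun n t ht => ?_)
    (Metric.mem_ball_self hε) ?_ (Metric.mem_ball_self hε)
  · have h1 : HasDerivAt (fun t : ℂ => u + n * t) (n : ℂ) t := by
      simpa using ((hasDerivAt_id t).const_mul (n : ℂ)).const_add u
    have h2 := (hasDerivAt_lerchKernel ((hball t ht).1 n).1).comp t h1
    have h3 : HasDerivAt (fun t => jacobiTheta₂_term n (a * t + b) t)
        (jacobiTheta₂_term n (a * t + b) t * (2 * π * I * n * a + π * I * n ^ 2)) t := by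
      refine HasDerivAt.cexp ?_
      have := ((((hasDerivAt_id t).const_mul a).add_const b).const_mul (2 * π * I * n)).fun_add
        ((hasDerivAt_id t).const_mul (π * I * n ^ 2 : ℂ))
      simpa using this
    refine (h3.mul h2).congr_deriv ?_
    simp only [Function.comp_apply]
    ring
  · have hR := ((hball t ht).1 n).2
    have hc : ‖jacobiTheta₂_term n (a * t + b) t‖ ≤ B n :=
      norm_jacobiTheta₂_term_le hT (hball t ht).2.1.le (hball t ht).2.2.le n
    have e1 : ‖(π * I * (n ^ 2 + 2 * n * a) * lerchKernel (u + n * t) : ℂ)‖ ≤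
        π * (|(n : ℝ)| ^ 2 + 2 * |(n : ℝ)| * ‖a‖) * M := by
      rw [norm_mul]
      gcongr
      rw [norm_mul, norm_mul, Complex.norm_real, norm_I, mul_one, Real.norm_of_nonneg pi_pos.le]
      gcongr
      refine (norm_add_le _ _).trans ?_
      simp
    have e2 : ‖(2 * π * I * n * (lerchKernel (u + n * t) ^ 2 - lerchKernel (u + n * t)) : ℂ)‖ ≤
        2 * π * |(n : ℝ)| * (M ^ 2 + M) := by
      rw [norm_mul]
      gcongr
      · simp [abs_of_pos pi_pos]
      · refine (norm_sub_le _ _).trans ?_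
        rw [norm_pow]
        gcongr
    rw [norm_mul]
    calc _ ≤ B n * (π * (|(n : ℝ)| ^ 2 + 2 * |(n : ℝ)| * ‖a‖) * M +
          2 * π * |(n : ℝ)| * (M ^ 2 + M)) := by
          gcongr
          exact (norm_add_le _ _).trans (add_le_add e1 e2)
      _ = _ := by push_cast; ring
  · have := summable_mul_lerchKernel_pow hτ hu
      (by simpa using summable_pow_mul_jacobiTheta₂_term hτ (a * τ + b) 0) 1
    simpa using this

/-- The cubic polynomial in the Lerch kernel produced by the heat operator, together with a
multiple of the kernel itself. -/
def heatPoly (μ lam x R : ℂ) : ℂ :=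
  μ * (2 * R ^ 3 + (2 * x - 3) * R ^ 2 + (x - 1) ^ 2 * R) - lam * R

/-- Lerch-type sums with the polynomial `heatPoly` of the kernel. -/
def lerchSum (μ lam a b τ u : ℂ) : ℂ :=
  ∑' n : ℤ, jacobiTheta₂_term n (a * τ + b) τ * cexp (2 * π * I * a * u) *
    heatPoly μ lam (n + a) (lerchKernel (u + n * τ))

/-- The coefficient of the `k`-th power of the kernel in `lerchSum`. -/
def lerchSumCoef (μ lam a b τ : ℂ) (k : ℕ) (n : ℤ) : ℂ :=
  (match k with
    | 1 => μ * ((n : ℂ) + a - 1) ^ 2 - lam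
    | 2 => μ * (2 * ((n : ℂ) + a) - 3)
    | 3 => 2 * μ
    | _ => 0) * jacobiTheta₂_term n (a * τ + b) τ

lemma summable_quadratic_mul_jacobiTheta₂_term {τ : ℂ} (hτ : 0 < τ.im) (z p q r : ℂ) :
    Summable fun n : ℤ => (p * n ^ 2 + q * n + r) * jacobiTheta₂_term n z τ := by
  have := (((summable_pow_mul_jacobiTheta₂_term hτ z 2).mul_left p).add
    ((summable_pow_mul_jacobiTheta₂_term hτ z 1).mul_left q)).add
    ((summable_pow_mul_jacobiTheta₂_term hτ z 0).mul_left r)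
  refine this.congr fun n => ?_
  ring

lemma summable_lerchSumCoef {τ : ℂ} (hτ : 0 < τ.im) (μ lam a b : ℂ) (k : ℕ) :
    Summable (lerchSumCoef μ lam a b τ k) := by
  have h := summable_quadratic_mul_jacobiTheta₂_term hτ (a * τ + b)
  match k with
  | 0 => exact (h 0 0 0).congr fun n => by simp [lerchSumCoef]
  | 1 => exact (h μ (2 * μ * (a - 1)) (μ * (a - 1) ^ 2 - lam)).congr fun n => by
          simp only [lerchSumCoef]; ring
  | 2 => exact (h 0 (2 * μ) (μ * (2 * a - 3))).congr fun n => by simp only [lerchSumCoef]; ring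
  | 3 => exact (h 0 0 (2 * μ)).congr fun n => by simp only [lerchSumCoef]; ring
  | k + 4 => exact (h 0 0 0).congr fun n => by simp [lerchSumCoef]

lemma hasSum_lerchSum {τ u : ℂ} (hτ : 0 < τ.im) (hu : OffLattice τ u) (μ lam a b : ℂ) :
    HasSum (fun n : ℤ => jacobiTheta₂_term n (a * τ + b) τ * cexp (2 * π * I * a * u) *
    heatPoly μ lam (n + a) (lerchKernel (u + n * τ))) (lerchSum μ lam a b τ u) := by
  refine Summable.hasSum ?_
  have h := fun k => summable_mul_lerchKernel_pow hτ hu (summable_lerchSumCoef hτ μ lam a b k) k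
  refine ((((h 1).add (h 2)).add (h 3)).mul_left (cexp (2 * π * I * a * u))).congr fun n => ?_
  simp only [lerchSumCoef, heatPoly]
  ring

lemma lerchSum_eq {τ u : ℂ} (hτ : 0 < τ.im) (hu : OffLattice τ u) (μ lam a b : ℂ) :
    lerchSum μ lam a b τ u = cexp (2 * π * I * a * u) * ∑ k ∈ ({1, 2, 3} : Finset ℕ),
      ∑' n : ℤ, lerchSumCoef μ lam a b τ k n * lerchKernel (u + n * τ) ^ k := by
  have h := fun k => (summable_mul_lerchKernel_pow hτ hu
    (summable_lerchSumCoef hτ μ lam a b k) k).hasSum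
  refine (hasSum_lerchSum hτ hu μ lam a b).unique ?_
  refine ((hasSum_sum (s := ({1, 2, 3} : Finset ℕ)) fun k _ => h k).mul_left
    (cexp (2 * π * I * a * u))).congr_fun fun n => ?_
  simp [lerchSumCoef, heatPoly]
  ring

lemma differentiableAt_lerchSum {τ u : ℂ} (hτ : 0 < τ.im) (hu : OffLattice τ u) (μ lam a b : ℂ) :
    DifferentiableAt ℂ (lerchSum μ lam a b τ) u := by
  have hd : DifferentiableAt ℂ (fun u => cexp (2 * π * I * a * u) *
      ∑ k ∈ ({1, 2, 3} : Finset ℕ),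
      ∑' n : ℤ, lerchSumCoef μ lam a b τ k n * lerchKernel (u + n * τ) ^ k) u := by
    refine DifferentiableAt.mul (by fun_prop) (DifferentiableAt.fun_sum fun k _ => ?_)
    exact (hasDerivAt_tsum_lerchKernel_pow hτ (summable_lerchSumCoef hτ μ lam a b k)
      (fun n _ => hu.add_int_mul_ne n) k).differentiableAt
  refine hd.congr_of_eventuallyEq ?_
  filter_upwards [OffLattice.eventually hτ hu] with w hw
  exact lerchSum_eq hτ hw μ lam a b

lemma lerchSum_add_one (μ lam a b τ u : ℂ) :
    lerchSum μ lam a b τ (u + 1) = cexp (2 * π * I * a) * lerchSum μ lam a b τ u := by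
  rw [lerchSum, lerchSum, ← tsum_mul_left]
  refine tsum_congr fun n => ?_
  have h : lerchKernel (u + 1 + n * τ) = lerchKernel (u + n * τ) := by
    rw [lerchKernel, lerchKernel, show 2 * π * I * (u + 1 + n * τ) =
      2 * π * I * (u + n * τ) + 2 * π * I by ring, Complex.exp_periodic]
  rw [h, mul_add, mul_one, Complex.exp_add]
  ring

lemma heatPoly_shift (μ lam x : ℂ) {e : ℂ} (h0 : e ≠ 0) (h1 : 1 - e ≠ 0) :
    e⁻¹ * heatPoly μ lam (x - 1) (1 - e)⁻¹ =
      heatPoly μ lam x (1 - e)⁻¹ + (μ * (x - 1) ^ 2 - lam) * e⁻¹ := by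
  rw [heatPoly, heatPoly]
  field_simp
  ring

lemma lerchSum_add_self {τ u : ℂ} (hτ : 0 < τ.im) (hu : OffLattice τ u) {μ lam a b : ℂ}
    (h0 : ∑' n : ℤ, (μ * (n + a) ^ 2 - lam) * jacobiTheta₂_term n (a * τ + b) τ = 0) :
    lerchSum μ lam a b τ (u + τ) =
      cexp (2 * π * I * (u + τ / 2 - b)) * lerchSum μ lam a b τ u := by
  set c : ℤ → ℂ := fun n => jacobiTheta₂_term n (a * τ + b) τ with hc
  have hsum0 : HasSum (fun n : ℤ => (μ * ((n - 1 : ℤ) + a) ^ 2 - lam) * c (n - 1)) 0 := by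
    rw [← h0]
    have hs : Summable fun n : ℤ => (μ * (n + a) ^ 2 - lam) * c n :=
      (summable_quadratic_mul_jacobiTheta₂_term hτ (a * τ + b) μ (2 * μ * a)
        (μ * a ^ 2 - lam)).congr fun n => by ring
    exact (Equiv.subRight (1 : ℤ)).hasSum_iff.2 hs.hasSum
  have hs2 := ((hasSum_lerchSum hτ hu μ lam a b).mul_left
    (cexp (2 * π * I * (u + τ / 2 - b)))).add (hsum0.mul_left (cexp (2 * π * I * a * (u + τ))))
  rw [mul_zero, add_zero] at hs2
  refine HasSum.unique ?_ hs2
  have hs3 := (Equiv.subRight (1 : ℤ)).hasSum_iff.2 (hasSum_lerchSum hτ hu.add_self μ lam a b)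
  refine hs3.congr_fun fun n => ?_
  simp only [Function.comp_apply, Equiv.subRight_apply]
  have hR : lerchKernel (u + τ + ((n - 1 : ℤ) : ℂ) * τ) =
      (1 - cexp (2 * π * I * (u + n * τ)))⁻¹ := by
    rw [lerchKernel]
    congr 4
    push_cast
    ring
  have hsh := heatPoly_shift μ lam (n + a) (Complex.exp_ne_zero (2 * π * I * (u + n * τ)))
    (sub_ne_zero.2 (hu.cexp_ne_one n).symm)
  have hcc : c (n - 1) * cexp (2 * π * I * a * (u + τ)) =
      cexp (2 * π * I * (u + τ / 2 - b)) * (c n * cexp (2 * π * I * a * u)) *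
        (cexp (2 * π * I * (u + n * τ)))⁻¹ := by
    simp only [hc, jacobiTheta₂_term]
    rw [← Complex.exp_neg]
    simp only [← Complex.exp_add]
    congr 1
    push_cast
    ring
  rw [hR, lerchKernel, show (((n - 1 : ℤ) : ℂ) + a) = n + a - 1 by push_cast; ring]
  change cexp _ * (c n * _ * _) + _ = c (n - 1) * _ * _
  linear_combination (μ * (n + a - 1) ^ 2 - lam -
    heatPoly μ lam (n + a - 1) (1 - cexp (2 * π * I * (u + n * τ)))⁻¹) * hcc -
    (cexp (2 * π * I * (u + τ / 2 - b)) * (c n * cexp (2 * π * I * a * u))) * hsh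

lemma iteratedDeriv_two_cexp_mul_tsum_lerchKernel {τ u : ℂ} (hτ : 0 < τ.im)
    (hu : OffLattice τ u) (a b : ℂ) :
    iteratedDeriv 2 (fun w => cexp (2 * π * I * a * w) *
      ∑' n : ℤ, jacobiTheta₂_term n (a * τ + b) τ * lerchKernel (w + n * τ)) u =
    cexp (2 * π * I * a * u) * ((2 * π * I) ^ 2 * ∑' n : ℤ, jacobiTheta₂_term n (a * τ + b) τ *
      (2 * lerchKernel (u + n * τ) ^ 3 + (2 * a - 3) * lerchKernel (u + n * τ) ^ 2 +
        (a - 1) ^ 2 * lerchKernel (u + n * τ))) := by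
  set c : ℤ → ℂ := fun n => jacobiTheta₂_term n (a * τ + b) τ with hc
  have hcs : Summable c := (summable_quadratic_mul_jacobiTheta₂_term hτ (a * τ + b) 0 0 1).congr
    fun n => by simp [hc]
  let Z : ℕ → ℂ → ℂ := fun k w => ∑' n : ℤ, c n * lerchKernel (w + n * τ) ^ k
  have hsum : ∀ w, OffLattice τ w → ∀ k,
      HasSum (fun n : ℤ => c n * lerchKernel (w + n * τ) ^ k) (Z k w) := fun w hw k =>
    (summable_mul_lerchKernel_pow hτ hw hcs k).hasSum
  have hZ : ∀ w, OffLattice τ w → ∀ k,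
      HasDerivAt (Z k) (2 * π * I * k * (Z (k + 1) w - Z k w)) w := fun w hw k => by
    refine (hasDerivAt_tsum_lerchKernel_pow hτ hcs
      (fun n _ => hw.add_int_mul_ne n) k).congr_deriv ?_
    refine HasSum.tsum_eq ?_
    refine (((hsum w hw (k + 1)).sub (hsum w hw k)).mul_left (2 * π * I * k)).congr_fun
      fun n => ?_
    ring
  have hE : ∀ w : ℂ, HasDerivAt (fun w => cexp (2 * π * I * a * w))
      (cexp (2 * π * I * a * w) * (2 * π * I * a)) w := fun w => by
    simpa using ((hasDerivAt_id w).const_mul (2 * π * I * a)).cexp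
  have h0 : (fun w => cexp (2 * π * I * a * w) *
      ∑' n : ℤ, jacobiTheta₂_term n (a * τ + b) τ * lerchKernel (w + n * τ)) =
      fun w => cexp (2 * π * I * a * w) * Z 1 w := by
    simp [Z, hc]
  have h1 : ∀ w, OffLattice τ w → HasDerivAt (fun w => cexp (2 * π * I * a * w) * Z 1 w)
      (2 * π * I * (cexp (2 * π * I * a * w) * (a * Z 1 w + (Z 2 w - Z 1 w)))) w := fun w hw => by
    refine ((hE w).fun_mul (hZ w hw 1)).congr_deriv ?_
    push_cast
    ring
  have h2 : deriv (fun w => cexp (2 * π * I * a * w) * Z 1 w) =ᶠ[𝓝 u]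
      fun w => 2 * π * I * (cexp (2 * π * I * a * w) * (a * Z 1 w + (Z 2 w - Z 1 w))) := by
    filter_upwards [OffLattice.eventually hτ hu] with w hw using (h1 w hw).deriv
  have h3 := ((hE u).fun_mul (((hZ u hu 1).const_mul a).fun_add
    ((hZ u hu 2).fun_sub (hZ u hu 1)))).const_mul (2 * π * I : ℂ)
  have h4 : ∑' n : ℤ, c n * (2 * lerchKernel (u + n * τ) ^ 3 +
      (2 * a - 3) * lerchKernel (u + n * τ) ^ 2 + (a - 1) ^ 2 * lerchKernel (u + n * τ)) =
      2 * Z 3 u + (2 * a - 3) * Z 2 u + (a - 1) ^ 2 * Z 1 u := by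
    refine HasSum.tsum_eq ?_
    refine ((((hsum u hu 3).mul_left 2).add ((hsum u hu 2).mul_left (2 * a - 3))).add
      ((hsum u hu 1).mul_left ((a - 1) ^ 2))).congr_fun fun n => ?_
    ring
  rw [h0, iteratedDeriv_succ, iteratedDeriv_one, h2.deriv_eq, h3.deriv, h4]
  push_cast
  ring

lemma hasDerivAt_jacobiTheta₂_comp_affine {τ : ℂ} (hτ : 0 < τ.im) (a b : ℂ) :
    HasDerivAt (fun t => jacobiTheta₂ (a * t + b) t)
      (π * I * ∑' n : ℤ, (n ^ 2 + 2 * n * a) * jacobiTheta₂_term n (a * τ + b) τ) τ := by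
  have h1 : HasDerivAt (fun t : ℂ => (a * t + b, t)) (a, 1) τ := by
    refine HasDerivAt.prodMk ?_ (hasDerivAt_id τ)
    simpa using ((hasDerivAt_id τ).const_mul a).add_const b
  have h2 := HasFDerivAt.comp_hasDerivAt (f := fun t : ℂ => (a * t + b, t)) τ
    (hasFDerivAt_jacobiTheta₂ (a * τ + b) hτ) h1
  refine h2.congr_deriv ?_
  have h3 := (hasSum_jacobiTheta₂_term_fderiv (a * τ + b) hτ).mapL
    (ContinuousLinearMap.apply ℂ ℂ ((a, 1) : ℂ × ℂ))
  rw [← tsum_mul_left]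
  refine Eq.trans h3.tsum_eq.symm (tsum_congr fun n => ?_)
  simp [jacobiTheta₂_term_fderiv, jacobiTheta₂_term]
  ring

lemma jTheta_mul_cexp_eq (α β : ℝ) (t : ℂ) :
    jTheta (α * t + β) t * cexp (π * I * α ^ 2 * t) =
      cexp (π * I * ((α + 1 / 2) ^ 2 * t + (β + 1 / 2))) *
        jacobiTheta₂ ((α + 1 / 2) * t + (β + 1 / 2)) t := by
  rw [jTheta_eq_jacobiTheta₂, mul_right_comm, ← Complex.exp_add]
  congr 2 <;> ring

lemma cexp_mul_lerchMu (α β : ℝ) (w t : ℂ) :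
    cexp (2 * π * I * α * w - π * I * (α : ℂ) ^ 2 * t) * lerchMu w ((α : ℂ) * t + β) t =
      cexp (2 * π * I * (α + 1 / 2) * w) *
      (∑' n : ℤ, jacobiTheta₂_term n ((α + 1 / 2) * t + (β + 1 / 2)) t * lerchKernel (w + n * t)) /
      (jTheta (α * t + β) t * cexp (π * I * α ^ 2 * t)) := by
  have h : ∀ n : ℤ, (-1 : ℂ) ^ n * cexp (π * I * ((n : ℂ) ^ 2 + (n : ℂ)) * t +
      2 * π * I * (α * t + β) * (n : ℂ)) / (1 - cexp (2 * π * I * (n : ℂ) * t + 2 * π * I * w)) =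
      jacobiTheta₂_term n ((α + 1 / 2) * t + (β + 1 / 2)) t * lerchKernel (w + n * t) := fun n => by
    rw [div_eq_mul_inv, lerchKernel, jacobiTheta₂_term]
    have e1 : (-1 : ℂ) ^ n = cexp (n * (π * I)) := by
      rw [Complex.exp_int_mul, Complex.exp_pi_mul_I]
    rw [e1, ← Complex.exp_add]
    rw [show 2 * π * I * (n : ℂ) * t + 2 * π * I * w = 2 * π * I * (w + n * t) by ring]
    congr 2
    ring
  rw [lerchMu, tsum_congr h]
  generalize (∑' n : ℤ, jacobiTheta₂_term n ((α + 1 / 2) * t + (β + 1 / 2)) t *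
    lerchKernel (w + n * t)) = X
  rw [show 2 * π * I * (α + 1 / 2) * w = 2 * π * I * α * w + π * I * w by ring,
    Complex.exp_sub, Complex.exp_add]
  simp only [div_eq_mul_inv, mul_inv]
  ring

/-- The heat operator applied to the normalised Lerch sum, as a Lerch-type sum. -/
lemma heat_cexp_mul_lerchMu {τ u : ℂ} (hτ : 0 < τ.im) (hu : OffLattice τ u) (α β : ℝ)
    (hv : jTheta (α * τ + β) τ ≠ 0) :
    4 * π * I * deriv (fun t : ℂ =>
        cexp (2 * π * I * α * u - π * I * (α : ℂ) ^ 2 * t) * lerchMu u ((α : ℂ) * t + β) t) τ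
      + iteratedDeriv 2 (fun w : ℂ =>
        cexp (2 * π * I * α * w - π * I * (α : ℂ) ^ 2 * τ) * lerchMu w ((α : ℂ) * τ + β) τ) u =
    (2 * π * I) ^ 2 / (jTheta (α * τ + β) τ * cexp (π * I * α ^ 2 * τ)) *
      lerchSum 1 ((∑' n : ℤ, (n + (α + 1 / 2 : ℂ)) ^ 2 *
        jacobiTheta₂_term n ((α + 1 / 2) * τ + (β + 1 / 2)) τ) /
        jacobiTheta₂ ((α + 1 / 2) * τ + (β + 1 / 2)) τ) (α + 1 / 2) (β + 1 / 2) τ u := by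
  simp only [cexp_mul_lerchMu]
  have hD := jTheta_mul_cexp_eq α β
  have hD0 : jTheta (α * τ + β) τ * cexp (π * I * α ^ 2 * τ) ≠ 0 :=
    mul_ne_zero hv (Complex.exp_ne_zero _)
  simp only [hD] at hD0 ⊢
  set a : ℂ := α + 1 / 2
  set b : ℂ := β + 1 / 2
  have hT0 := right_ne_zero_of_mul hD0
  set E := cexp (2 * π * I * a * u)
  set c : ℤ → ℂ := fun n => jacobiTheta₂_term n (a * τ + b) τ with hc
  have hcsum := summable_quadratic_mul_jacobiTheta₂_term hτ (a * τ + b)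
  have hT := hasDerivAt_jacobiTheta₂_comp_affine hτ a b
  have hS := (hasDerivAt_tsum_jacobiTheta₂_term_mul_lerchKernel hτ hu a b).const_mul E
  have hX : HasDerivAt (fun t : ℂ => cexp (π * I * (a ^ 2 * t + b)))
      (cexp (π * I * (a ^ 2 * τ + b)) * (π * I * a ^ 2)) τ := by
    simpa using ((((hasDerivAt_id τ).const_mul (a ^ 2)).add_const b).const_mul (π * I : ℂ)).cexp
  have ht := (hS.fun_div (hX.fun_mul hT) hD0).deriv
  rw [ht]
  have hdiv : iteratedDeriv 2 (fun w => cexp (2 * π * I * a * w) * (∑' n : ℤ,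
      jacobiTheta₂_term n (a * τ + b) τ * lerchKernel (w + n * τ)) /
      (cexp (π * I * (a ^ 2 * τ + b)) * jacobiTheta₂ (a * τ + b) τ)) u =
      iteratedDeriv 2 (fun w => cexp (2 * π * I * a * w) * (∑' n : ℤ,
      jacobiTheta₂_term n (a * τ + b) τ * lerchKernel (w + n * τ))) u /
      (cexp (π * I * (a ^ 2 * τ + b)) * jacobiTheta₂ (a * τ + b) τ) := by
    simp only [div_eq_inv_mul _ (cexp (π * I * (a ^ 2 * τ + b)) * jacobiTheta₂ (a * τ + b) τ),
      iteratedDeriv_succ, iteratedDeriv_zero, deriv_const_mul_field']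
  rw [hdiv, iteratedDeriv_two_cexp_mul_tsum_lerchKernel hτ hu]
  have hM : ∑' n : ℤ, (n + a) ^ 2 * jacobiTheta₂_term n (a * τ + b) τ =
      (∑' n : ℤ, (n ^ 2 + 2 * n * a) * jacobiTheta₂_term n (a * τ + b) τ) +
        a ^ 2 * jacobiTheta₂ (a * τ + b) τ := by
    refine HasSum.tsum_eq ?_
    refine (((hcsum 1 (2 * a) 0).congr fun n => ?_).hasSum.add
      ((hasSum_jacobiTheta₂_term (a * τ + b) hτ).mul_left (a ^ 2))).congr_fun fun n => ?_
    · ring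
    · ring
  set M : ℂ := ∑' n : ℤ, (n ^ 2 + 2 * n * a) * jacobiTheta₂_term n (a * τ + b) τ
  have hs : ∀ k, Summable fun n : ℤ => c n * lerchKernel (u + n * τ) ^ k := fun k =>
    summable_mul_lerchKernel_pow hτ hu ((hcsum 0 0 1).congr fun n => by simp [hc]) k
  have hsn : ∀ p q k, Summable fun n : ℤ => (p * n ^ 2 + q * n + 0) * c n *
      lerchKernel (u + n * τ) ^ k := fun p q k =>
    summable_mul_lerchKernel_pow hτ hu (hcsum p q 0) k
  have hQ : ∀ l : ℂ, lerchSum 1 l a b τ u = E * ((∑' n : ℤ, c n *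
      (2 * lerchKernel (u + n * τ) ^ 3 + (2 * a - 3) * lerchKernel (u + n * τ) ^ 2 +
        (a - 1) ^ 2 * lerchKernel (u + n * τ))) + (π * I)⁻¹ * (∑' n : ℤ, c n *
        (π * I * (n ^ 2 + 2 * n * a) * lerchKernel (u + n * τ) +
        2 * π * I * n * (lerchKernel (u + n * τ) ^ 2 - lerchKernel (u + n * τ)))) -
        l * ∑' n : ℤ, c n * lerchKernel (u + n * τ)) := fun l => by
    have hpi : (π * I : ℂ) ≠ 0 := by simp [pi_ne_zero]
    have s1 : Summable fun n : ℤ => c n *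
      (2 * lerchKernel (u + n * τ) ^ 3 + (2 * a - 3) * lerchKernel (u + n * τ) ^ 2 +
        (a - 1) ^ 2 * lerchKernel (u + n * τ)) :=
      ((((hs 3).mul_left 2).add ((hs 2).mul_left (2 * a - 3))).add
        ((hs 1).mul_left ((a - 1) ^ 2))).congr fun n => by ring
    have s2 : Summable fun n : ℤ => c n *
        (π * I * (n ^ 2 + 2 * n * a) * lerchKernel (u + n * τ) +
        2 * π * I * n * (lerchKernel (u + n * τ) ^ 2 - lerchKernel (u + n * τ))) :=
      ((hsn (π * I) (π * I * 2 * a - 2 * π * I) 1).add (hsn 0 (2 * π * I) 2)).congr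
        fun n => by ring
    have s3 : Summable fun n : ℤ => c n * lerchKernel (u + n * τ) := by simpa using hs 1
    refine (hasSum_lerchSum hτ hu 1 l a b).unique ?_
    refine (((s1.hasSum.add (s2.hasSum.mul_left (π * I)⁻¹)).sub
      (s3.hasSum.mul_left l)).mul_left E).congr_fun fun n => ?_
    simp only [heatPoly]
    change c n * E * _ = _
    linear_combination -(E * c n * ((n ^ 2 + 2 * n * a) * lerchKernel (u + n * τ) +
      2 * n * (lerchKernel (u + n * τ) ^ 2 - lerchKernel (u + n * τ)))) * inv_mul_cancel₀ hpi
  rw [hQ, hM, show cexp (2 * π * I * a * u) = E from rfl]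
  simp only [hc]
  generalize (∑' n : ℤ, jacobiTheta₂_term n (a * τ + b) τ *
    (2 * lerchKernel (u + n * τ) ^ 3 + (2 * a - 3) * lerchKernel (u + n * τ) ^ 2 +
      (a - 1) ^ 2 * lerchKernel (u + n * τ))) = S₁
  generalize (∑' n : ℤ, jacobiTheta₂_term n (a * τ + b) τ *
    (π * I * (n ^ 2 + 2 * n * a) * lerchKernel (u + n * τ) +
      2 * π * I * n * (lerchKernel (u + n * τ) ^ 2 - lerchKernel (u + n * τ)))) = S₂
  generalize (∑' n : ℤ, jacobiTheta₂_term n (a * τ + b) τ * lerchKernel (u + n * τ)) = S₃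
  have hX0 := Complex.exp_ne_zero (π * I * (a ^ 2 * τ + b))
  have hpi : (π : ℂ) ≠ 0 := by simp [pi_ne_zero]
  field_simp
  ring

lemma AnalyticAt.dslope_self {g : ℂ → ℂ} {z : ℂ} (hg : AnalyticAt ℂ g z) :
    AnalyticAt ℂ (dslope g z) z := by
  obtain ⟨p, hp⟩ := hg
  exact ⟨_, hp.has_fpower_series_dslope_fslope⟩

lemma AnalyticAt.exists_eq_add_mul {g : ℂ → ℂ} (hg : AnalyticAt ℂ g 0) :
    ∃ k : ℂ → ℂ, AnalyticAt ℂ k 0 ∧ k 0 = deriv g 0 ∧ ∀ u, g u = g 0 + u * k u := by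
  refine ⟨dslope g 0, hg.dslope_self, dslope_same g 0, fun u => ?_⟩
  have := sub_smul_dslope g 0 u
  simp only [sub_zero, smul_eq_mul] at this
  rw [this]
  ring

lemma deriv_eventuallyEq_of_simple_pole {f k : ℂ → ℂ} {c : ℂ} (hk : AnalyticAt ℂ k 0)
    (hf : f =ᶠ[𝓝[≠] 0] fun u => c * u⁻¹ + k u) :
    deriv f =ᶠ[𝓝[≠] 0] fun u => -c * (u ^ 2)⁻¹ + deriv k u := by
  filter_upwards [hf.nhdsNE_deriv, nhdsWithin_le_nhds hk.eventually_analyticAt,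
    self_mem_nhdsWithin] with u h1 h2 hu
  rw [h1, (((hasDerivAt_inv hu).const_mul c).fun_add h2.differentiableAt.hasDerivAt).deriv]
  ring

lemma deriv_deriv_eventuallyEq_of_simple_pole {f k : ℂ → ℂ} {c : ℂ} (hk : AnalyticAt ℂ k 0)
    (hf : f =ᶠ[𝓝[≠] 0] fun u => c * u⁻¹ + k u) :
    deriv (deriv f) =ᶠ[𝓝[≠] 0] fun u => 2 * c * (u ^ 3)⁻¹ + deriv (deriv k) u := by
  filter_upwards [(deriv_eventuallyEq_of_simple_pole hk hf).nhdsNE_deriv,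
    nhdsWithin_le_nhds hk.deriv.eventually_analyticAt, self_mem_nhdsWithin] with u h1 h2 hu
  have hu0 : u ≠ 0 := hu
  have h3 : HasDerivAt (fun u : ℂ => (u ^ 2)⁻¹) _ u :=
    (hasDerivAt_pow 2 u).fun_inv (pow_ne_zero 2 hu0)
  rw [h1, ((h3.const_mul (-c)).fun_add h2.differentiableAt.hasDerivAt).deriv]
  field_simp
  simp
  ring

lemma exists_cexp_mul_lerchKernel_eq (a : ℂ) : ∃ k : ℂ → ℂ, AnalyticAt ℂ k 0 ∧
    ∀ u ≠ 0, cexp (2 * π * I * a * u) * lerchKernel u = -(2 * π * I)⁻¹ * u⁻¹ + k u := by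
  have hs : (2 * π * I : ℂ) ≠ 0 := by simp [pi_ne_zero]
  have hg : AnalyticAt ℂ (fun u : ℂ => cexp (2 * π * I * u)) 0 := by fun_prop
  obtain ⟨m, hm, hm0, hmu⟩ := hg.exists_eq_add_mul
  have hd : deriv (fun u : ℂ => cexp (2 * π * I * u)) 0 = 2 * π * I := by
    simpa using (((hasDerivAt_id (0 : ℂ)).const_mul (2 * π * I : ℂ)).cexp).deriv
  rw [hd] at hm0
  have hE : AnalyticAt ℂ (fun u : ℂ => cexp (2 * π * I * a * u)) 0 := by fun_prop
  obtain ⟨k, hk, -, hku⟩ := (hE.fun_mul (hm.fun_inv (hm0 ▸ hs))).fun_neg.exists_eq_add_mul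
  refine ⟨k, hk, fun u hu => ?_⟩
  have h1 := hku u
  have h2 := hmu u
  simp only [mul_zero, Complex.exp_zero, one_mul, hm0] at h1 h2
  rw [lerchKernel, h2, show 1 - (1 + u * m u) = -(u * m u) by ring, inv_neg, mul_inv]
  calc _ = -(cexp (2 * π * I * a * u) * (m u)⁻¹) * u⁻¹ := by ring
    _ = _ := by rw [h1]; field_simp

lemma hasDerivAt_cexp_mul_lerchKernel {u : ℂ} (a : ℂ) (hu : cexp (2 * π * I * u) ≠ 1) :
    HasDerivAt (fun u => cexp (2 * π * I * a * u) * lerchKernel u)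
      (2 * π * I * (cexp (2 * π * I * a * u) *
        (a * lerchKernel u + (lerchKernel u ^ 2 - lerchKernel u)))) u := by
  have hE : HasDerivAt (fun w => cexp (2 * π * I * a * w))
      (cexp (2 * π * I * a * u) * (2 * π * I * a)) u := by
    simpa using ((hasDerivAt_id u).const_mul (2 * π * I * a)).cexp
  exact (hE.fun_mul (hasDerivAt_lerchKernel hu)).congr_deriv (by ring)

lemma cexp_mul_heatPoly_lerchKernel_eventuallyEq {τ : ℂ} (hτ : 0 < τ.im) (μ lam a : ℂ) :
    ∀ᶠ u in 𝓝[≠] (0 : ℂ), cexp (2 * π * I * a * u) * heatPoly μ lam a (lerchKernel u) =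
      μ * ((2 * π * I) ^ 2)⁻¹ *
        deriv (deriv fun u => cexp (2 * π * I * a * u) * lerchKernel u) u -
      lam * (cexp (2 * π * I * a * u) * lerchKernel u) := by
  have hs : (2 * π * I : ℂ) ≠ 0 := by simp [pi_ne_zero]
  have hne : ∀ w, OffLattice τ w → cexp (2 * π * I * w) ≠ 1 := fun w hw => by
    simpa using hw.cexp_ne_one 0
  filter_upwards [eventually_offLattice hτ 0] with u hu
  have hd : deriv (fun u => cexp (2 * π * I * a * u) * lerchKernel u) =ᶠ[𝓝 u] fun u =>
      2 * π * I * (cexp (2 * π * I * a * u) *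
        (a * lerchKernel u + (lerchKernel u ^ 2 - lerchKernel u))) := by
    filter_upwards [OffLattice.eventually hτ hu] with w hw
    exact (hasDerivAt_cexp_mul_lerchKernel a (hne w hw)).deriv
  have hE : HasDerivAt (fun w => cexp (2 * π * I * a * w))
      (cexp (2 * π * I * a * u) * (2 * π * I * a)) u := by
    simpa using ((hasDerivAt_id u).const_mul (2 * π * I * a)).cexp
  have hR := hasDerivAt_lerchKernel (hne u hu)
  rw [hd.deriv_eq, ((hE.fun_mul ((hR.const_mul a).fun_add
    ((hR.fun_pow 2).fun_sub hR))).const_mul (2 * π * I : ℂ)).deriv, heatPoly]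
  push_cast
  field_simp
  ring

lemma exists_cexp_mul_heatPoly_lerchKernel_eq {τ : ℂ} (hτ : 0 < τ.im) (μ lam a : ℂ) :
    ∃ k : ℂ → ℂ, AnalyticAt ℂ k 0 ∧ ∀ᶠ u in 𝓝[≠] (0 : ℂ),
      cexp (2 * π * I * a * u) * heatPoly μ lam a (lerchKernel u) =
      -2 * μ * ((2 * π * I) ^ 3)⁻¹ * (u ^ 3)⁻¹ + lam * (2 * π * I)⁻¹ * u⁻¹ + k u := by
  obtain ⟨k, hk, hku⟩ := exists_cexp_mul_lerchKernel_eq a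
  have hpole : (fun u => cexp (2 * π * I * a * u) * lerchKernel u) =ᶠ[𝓝[≠] 0]
      fun u => -(2 * π * I)⁻¹ * u⁻¹ + k u := by
    filter_upwards [self_mem_nhdsWithin] with u hu using hku u hu
  refine ⟨fun u => μ * ((2 * π * I) ^ 2)⁻¹ * deriv (deriv k) u - lam * k u, ?_, ?_⟩
  · have := hk.deriv.deriv
    fun_prop
  · filter_upwards [cexp_mul_heatPoly_lerchKernel_eventuallyEq hτ μ lam a, hpole,
      deriv_deriv_eventuallyEq_of_simple_pole hk hpole] with u h1 h2 h3
    rw [h1, h2, h3, pow_succ (2 * π * I : ℂ) 2, mul_inv]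
    ring

/-- The principal part of `lerchSum` at the origin. -/
lemma exists_lerchSum_eq {τ : ℂ} (hτ : 0 < τ.im) (μ lam a b : ℂ) :
    ∃ k : ℂ → ℂ, AnalyticAt ℂ k 0 ∧ ∀ᶠ u in 𝓝[≠] (0 : ℂ), lerchSum μ lam a b τ u =
      -2 * μ * ((2 * π * I) ^ 3)⁻¹ * (u ^ 3)⁻¹ + lam * (2 * π * I)⁻¹ * u⁻¹ + k u := by
  classical
  obtain ⟨k, hk, hku⟩ := exists_cexp_mul_heatPoly_lerchKernel_eq hτ μ lam a
  let d : ℕ → ℤ → ℂ := fun j n => if n = 0 then 0 else lerchSumCoef μ lam a b τ j n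
  have hd : ∀ j, Summable (d j) := fun j =>
    .of_norm_bounded (summable_lerchSumCoef hτ μ lam a b j).norm fun n => by
      by_cases h : n = 0 <;> simp [d, h]
  have hz : ∀ᶠ z in 𝓝 (0 : ℂ), ∀ j n, d j n ≠ 0 → ∀ m : ℤ, z + n * τ ≠ m := by
    filter_upwards [eventually_nhdsWithin_iff.1 (eventually_offLattice hτ 0)] with z h j n hn m
    rcases eq_or_ne z 0 with rfl | hz0
    · have hn0 : n ≠ 0 := fun h => hn (by simp [d, h])
      intro e
      have := congr_arg Complex.im e
      simp [hn0, hτ.ne'] at this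
    · exact (h hz0).add_int_mul_ne n m
  have han : ∀ j, AnalyticAt ℂ (fun u => ∑' n : ℤ, d j n * lerchKernel (u + n * τ) ^ j) 0 :=
    fun j => by
      rw [analyticAt_iff_eventually_differentiableAt]
      filter_upwards [hz] with z h
      exact (hasDerivAt_tsum_lerchKernel_pow hτ (hd j) (h j) j).differentiableAt
  refine ⟨fun u => k u + cexp (2 * π * I * a * u) * ((∑' n : ℤ, d 1 n * lerchKernel (u + n * τ) ^ 1)
    + (∑' n : ℤ, d 2 n * lerchKernel (u + n * τ) ^ 2) +
    (∑' n : ℤ, d 3 n * lerchKernel (u + n * τ) ^ 3)), ?_, ?_⟩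
  · have h1 := han 1
    have h2 := han 2
    have h3 := han 3
    have hE : AnalyticAt ℂ (fun u : ℂ => cexp (2 * π * I * a * u)) 0 := by fun_prop
    exact hk.fun_add (hE.fun_mul ((h1.fun_add h2).fun_add h3))
  · filter_upwards [hku, eventually_offLattice hτ 0] with u h hu
    have hsplit : ∀ j : ℕ, ∑' n : ℤ, lerchSumCoef μ lam a b τ j n * lerchKernel (u + n * τ) ^ j =
        lerchSumCoef μ lam a b τ j 0 * lerchKernel u ^ j +
          ∑' n : ℤ, d j n * lerchKernel (u + n * τ) ^ j := fun j => by
      rw [(summable_mul_lerchKernel_pow hτ hu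
        (summable_lerchSumCoef hτ μ lam a b j) j).tsum_eq_add_tsum_ite 0]
      simp [d, ite_mul]
    rw [lerchSum_eq hτ hu, ← add_assoc, ← h]
    simp only [Finset.mem_insert, Finset.mem_singleton, OfNat.one_ne_ofNat, or_self,
      not_false_eq_true, Finset.sum_insert, Nat.reduceEqDiff, Finset.sum_singleton, hsplit]
    simp [lerchSumCoef, heatPoly, jacobiTheta₂_term]
    ring

lemma eq_zero_of_theta_multipliers {τ : ℂ} (hτ : 0 < τ.im) {α β : ℝ}
    (hv : OffLattice τ (α * τ + β)) {f k : ℂ → ℂ}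
    (hd : ∀ u, OffLattice τ u → DifferentiableAt ℂ f u)
    (hk : ContinuousAt k 0) (hfk : f =ᶠ[𝓝[≠] 0] k)
    (h1 : ∀ u, OffLattice τ u → f (u + 1) = cexp (2 * π * I * α) * f u)
    (h2 : ∀ u, OffLattice τ u → f (u + τ) = cexp (-(2 * π * I * β)) * f u) :
    ∀ u, OffLattice τ u → f u = 0 := by
  refine eq_zero_of_unitary_multipliers hτ ?_ ?_ ?_ hd ?_ h1 h2
  · simp [Complex.norm_exp]
  · simp [Complex.norm_exp]
  · by_contra! h
    have hs : (2 * π * I : ℂ) ≠ 0 := by simp [pi_ne_zero]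
    obtain ⟨m, hm⟩ := Complex.exp_eq_one_iff.1 h.1
    obtain ⟨n, hn⟩ := Complex.exp_eq_one_iff.1 h.2
    have hα : (α : ℂ) = m := mul_left_cancel₀ hs (by rw [hm]; ring)
    have hβ : (β : ℂ) = (-n : ℤ) := mul_left_cancel₀ hs (by push_cast; linear_combination -hn)
    exact hv m (-n) (by rw [hα, hβ])
  · obtain ⟨M, hM⟩ := hk.norm.isBoundedUnder_le
    refine ⟨M, ?_⟩
    filter_upwards [hfk, nhdsWithin_le_nhds (eventually_map.1 hM)] with u h1 h2
    rw [h1]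
    exact h2

lemma jTheta_mul_lerchSum_add_one (μ lam β' τ u : ℂ) (α : ℂ) :
    jTheta (u + 1) τ * lerchSum μ lam (α + 1 / 2) β' τ (u + 1) =
      cexp (2 * π * I * α) * (jTheta u τ * lerchSum μ lam (α + 1 / 2) β' τ u) := by
  rw [jTheta_add_one, lerchSum_add_one,
    show 2 * π * I * (α + 1 / 2) = 2 * π * I * α + π * I by ring, ← neg_cexp]
  ring

lemma jTheta_mul_lerchSum_add_self {τ u : ℂ} (hτ : 0 < τ.im) (hu : OffLattice τ u)
    {μ lam a β : ℂ} (h0 : ∑' n : ℤ, (μ * (n + a) ^ 2 - lam) *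
      jacobiTheta₂_term n (a * τ + (β + 1 / 2)) τ = 0) :
    jTheta (u + τ) τ * lerchSum μ lam a (β + 1 / 2) τ (u + τ) =
      cexp (-(2 * π * I * β)) * (jTheta u τ * lerchSum μ lam a (β + 1 / 2) τ u) := by
  rw [jTheta_add_self, lerchSum_add_self hτ hu h0]
  have h : -cexp (-π * I * τ - 2 * π * I * u) * cexp (2 * π * I * (u + τ / 2 - (β + 1 / 2))) =
      cexp (-(2 * π * I * β)) := by
    rw [neg_cexp, ← Complex.exp_add]
    congr 1
    ring
  rw [← h]
  ring

lemma jTheta_affine_ne_zero {τ : ℂ} (hτ : 0 < τ.im) {α β : ℝ}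
    (hv : OffLattice τ (α * τ + β)) : jTheta (α * τ + β) τ ≠ 0 := by
  intro h
  have hs : (2 * π * I : ℂ) ≠ 0 := by simp [pi_ne_zero]
  have hM : jacobiTheta₂ ((α + 1 / 2) * τ + (β + 1 / 2)) τ = 0 := by
    have := jTheta_mul_cexp_eq α β τ
    rw [h, zero_mul] at this
    exact (mul_eq_zero.1 this.symm).resolve_left (Complex.exp_ne_zero _)
  have h0 : ∑' n : ℤ, ((0 : ℂ) * (n + (α + 1 / 2 : ℂ)) ^ 2 - (-1)) *
      jacobiTheta₂_term n ((α + 1 / 2) * τ + (β + 1 / 2)) τ = 0 := by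
    simpa [jacobiTheta₂] using hM
  obtain ⟨h, hh, hh0, -, hhu⟩ := exists_jTheta_eq_mul hτ
  obtain ⟨k, hk, hku⟩ := exists_lerchSum_eq hτ 0 (-1) (α + 1 / 2 : ℂ) (β + 1 / 2)
  have hF : (fun u => jTheta u τ * lerchSum 0 (-1) (α + 1 / 2 : ℂ) (β + 1 / 2) τ u) =ᶠ[𝓝[≠] 0]
      fun u => h u * (-(2 * π * I)⁻¹ + u * k u) := by
    filter_upwards [hku, self_mem_nhdsWithin] with u h1 hu
    have hu0 : u ≠ 0 := hu
    rw [h1, hhu]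
    field_simp
    ring
  have hc : ContinuousAt (fun u => h u * (-(2 * π * I)⁻¹ + u * k u)) 0 := by
    have := hk.continuousAt
    have := hh.continuous
    fun_prop
  have hz := eq_zero_of_theta_multipliers hτ hv
    (fun u hu => (differentiable_jTheta hτ u).mul (differentiableAt_lerchSum hτ hu _ _ _ _)) hc hF
    (fun u _ => jTheta_mul_lerchSum_add_one _ _ _ _ _ _)
    (fun u hu => jTheta_mul_lerchSum_add_self hτ hu h0)
  have hc0 : Tendsto (fun u => h u * (-(2 * π * I)⁻¹ + u * k u)) (𝓝[≠] 0) (𝓝 0) := by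
    refine tendsto_const_nhds.congr' ?_
    filter_upwards [hF, eventually_offLattice hτ 0] with u h1 hu
    rw [← h1]
    exact (hz u hu).symm
  have := tendsto_nhds_unique hc0 (hc.tendsto.mono_left nhdsWithin_le_nhds)
  rw [hh0, deriv_jTheta_zero hτ] at this
  simp [pi_ne_zero, dedekindEta_ne_zero hτ] at this

lemma jTheta_ne_zero {τ u : ℂ} (hτ : 0 < τ.im) (hu : OffLattice τ u) : jTheta u τ ≠ 0 := by
  have h : u = ((u.im / τ.im : ℝ) : ℂ) * τ + ((u.re - u.im / τ.im * τ.re : ℝ) : ℂ) := by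
    refine Complex.ext ?_ ?_
    · simp
    · simp [hτ.ne']
  rw [h] at hu ⊢
  exact jTheta_affine_ne_zero hτ hu

/-- The quotient of theta functions whose derivative is the holomorphic side of the identity. -/
def jThetaQuot (α v τ u : ℂ) : ℂ := cexp (2 * π * I * α * u) * jTheta (u + v) τ / jTheta u τ

lemma differentiableAt_jThetaQuot {τ u : ℂ} (hτ : 0 < τ.im) (hu : OffLattice τ u) (α v : ℂ) :
    DifferentiableAt ℂ (jThetaQuot α v τ) u := by
  have h1 : DifferentiableAt ℂ (fun u => jTheta u τ) u := differentiable_jTheta hτ u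
  have h2 : DifferentiableAt ℂ (fun u => jTheta (u + v) τ) u :=
    differentiableAt_comp_add_const.2 (differentiable_jTheta hτ (u + v))
  have h3 : DifferentiableAt ℂ (fun u => cexp (2 * π * I * α * u)) u := by fun_prop
  exact (h3.fun_mul h2).fun_div h1 (jTheta_ne_zero hτ hu)

lemma jThetaQuot_add_one (α v τ u : ℂ) :
    jThetaQuot α v τ (u + 1) = cexp (2 * π * I * α) * jThetaQuot α v τ u := by
  rw [jThetaQuot, jThetaQuot, add_right_comm, jTheta_add_one, jTheta_add_one, mul_add, mul_one,
    Complex.exp_add, mul_neg, neg_div_neg_eq]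
  ring

lemma jThetaQuot_add_self (α β τ u : ℂ) :
    jThetaQuot α (α * τ + β) τ (u + τ) =
      cexp (-(2 * π * I * β)) * jThetaQuot α (α * τ + β) τ u := by
  rw [jThetaQuot, jThetaQuot, add_right_comm, jTheta_add_self, jTheta_add_self]
  have h : cexp (2 * π * I * α * (u + τ)) * cexp (-π * I * τ - 2 * π * I * (u + (α * τ + β))) =
      cexp (-(2 * π * I * β)) * cexp (2 * π * I * α * u) *
        cexp (-π * I * τ - 2 * π * I * u) := by
    simp only [← Complex.exp_add]
    congr 1
    ring
  rw [← mul_div_assoc, ← mul_div_mul_left _ (jTheta u τ)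
    (neg_ne_zero.2 (Complex.exp_ne_zero (-π * I * τ - 2 * π * I * u)))]
  congr 1
  linear_combination -jTheta (u + (α * τ + β)) τ * h

lemma deriv_jThetaQuot {τ u : ℂ} (hτ : 0 < τ.im) (hu : OffLattice τ u) (α β : ℝ) :
    jTheta u τ ^ 2 * deriv (jThetaQuot α (α * τ + β) τ) u = cexp (2 * π * I * α * u) *
      (4 * π * I * (aCoef1 α β τ * jTheta0 (2 * u + α * τ + β) (2 * τ) -
        aCoef0 α β τ * jTheta1 (2 * u + α * τ + β) (2 * τ))) := by
  have h1 : HasDerivAt (fun u => jTheta u τ) _ u := (differentiable_jTheta hτ u).hasDerivAt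
  have h2 : HasDerivAt (fun u => jTheta (u + (α * τ + β)) τ) _ u :=
    (differentiable_jTheta hτ (u + (α * τ + β))).hasDerivAt.comp_add_const u (α * τ + β)
  have h3 : HasDerivAt (fun w => cexp (2 * π * I * α * w))
      (cexp (2 * π * I * α * u) * (2 * π * I * α)) u := by
    simpa using ((hasDerivAt_id u).const_mul (2 * π * I * α : ℂ)).cexp
  have h0 := jTheta_ne_zero hτ hu
  have h4 : HasDerivAt (jThetaQuot α (α * τ + β) τ) _ u := (h3.fun_mul h2).fun_div h1 h0
  rw [h4.deriv, aCoef_mul_sub hτ u]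
  field_simp
  ring

lemma exists_deriv_jThetaQuot_eq {τ : ℂ} (hτ : 0 < τ.im) (α v : ℂ) :
    ∃ k : ℂ → ℂ, AnalyticAt ℂ k 0 ∧ deriv (jThetaQuot α v τ) =ᶠ[𝓝[≠] 0] fun u =>
      -(jTheta v τ / deriv (fun u => jTheta u τ) 0) * (u ^ 2)⁻¹ + k u := by
  obtain ⟨h, hh, hh0, -, hhu⟩ := exists_jTheta_eq_mul hτ
  have hne : h 0 ≠ 0 := by
    rw [hh0, deriv_jTheta_zero hτ]
    simp [pi_ne_zero, dedekindEta_ne_zero hτ]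
  have hT : Differentiable ℂ fun u => jTheta (u + v) τ :=
    fun u => differentiableAt_comp_add_const.2 (differentiable_jTheta hτ (u + v))
  have hE : AnalyticAt ℂ (fun u : ℂ => cexp (2 * π * I * α * u)) 0 := by fun_prop
  obtain ⟨k, hk, -, hku⟩ := ((hE.fun_mul (hT.analyticAt 0)).fun_div
    (hh.analyticAt 0) hne).exists_eq_add_mul
  refine ⟨deriv k, hk.deriv, deriv_eventuallyEq_of_simple_pole hk ?_⟩
  filter_upwards [self_mem_nhdsWithin] with u hu
  have hu0 : u ≠ 0 := hu
  have h1 := hku u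
  simp only [mul_zero, Complex.exp_zero, one_mul, zero_add, hh0] at h1
  rw [jThetaQuot, hhu u, mul_comm u, ← div_div, h1]
  field_simp

lemma jTheta_mul_lerchSum_eq {τ u : ℂ} (hτ : 0 < τ.im) (hu : OffLattice τ u) {α β : ℝ}
    (hv : OffLattice τ (α * τ + β)) :
    jTheta u τ * lerchSum 1 ((∑' n : ℤ, (n + (α + 1 / 2 : ℂ)) ^ 2 *
        jacobiTheta₂_term n ((α + 1 / 2) * τ + (β + 1 / 2)) τ) /
        jacobiTheta₂ ((α + 1 / 2) * τ + (β + 1 / 2)) τ) (α + 1 / 2) (β + 1 / 2) τ u =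
      2 * deriv (fun u => jTheta u τ) 0 ^ 2 / ((2 * π * I) ^ 3 * jTheta (α * τ + β) τ) *
        deriv (jThetaQuot α (α * τ + β) τ) u := by
  have hv0 := jTheta_affine_ne_zero hτ hv
  have hs : (2 * π * I : ℂ) ≠ 0 := by simp [pi_ne_zero]
  have hM : jacobiTheta₂ ((α + 1 / 2) * τ + (β + 1 / 2)) τ ≠ 0 := by
    have h := mul_ne_zero hv0 (Complex.exp_ne_zero (π * I * α ^ 2 * τ))
    rw [jTheta_mul_cexp_eq] at h
    exact right_ne_zero_of_mul h
  set L : ℂ := (∑' n : ℤ, (n + (α + 1 / 2 : ℂ)) ^ 2 *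
        jacobiTheta₂_term n ((α + 1 / 2) * τ + (β + 1 / 2)) τ) /
        jacobiTheta₂ ((α + 1 / 2) * τ + (β + 1 / 2)) τ with hL
  have h0 : ∑' n : ℤ, ((1 : ℂ) * (n + (α + 1 / 2 : ℂ)) ^ 2 - L) *
      jacobiTheta₂_term n ((α + 1 / 2) * τ + (β + 1 / 2)) τ = 0 := by
    have hq : Summable fun n : ℤ => (n + (α + 1 / 2 : ℂ)) ^ 2 *
        jacobiTheta₂_term n ((α + 1 / 2) * τ + (β + 1 / 2)) τ :=
      (summable_quadratic_mul_jacobiTheta₂_term hτ _ 1 (2 * (α + 1 / 2))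
        ((α + 1 / 2) ^ 2)).congr fun n => by ring
    have hsum := hq.hasSum.sub ((hasSum_jacobiTheta₂_term
      ((α + 1 / 2) * τ + (β + 1 / 2)) hτ).mul_left L)
    rw [hL, div_mul_cancel₀ _ hM, sub_self] at hsum
    exact (hsum.congr_fun fun n => by ring).tsum_eq
  obtain ⟨h, hh, hh0, hh1, hhu⟩ := exists_jTheta_eq_mul hτ
  obtain ⟨h', hh', hh'0, hhu'⟩ := (hh.analyticAt 0).exists_eq_add_mul
  obtain ⟨h'', hh'', -, hhu''⟩ := hh'.exists_eq_add_mul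
  obtain ⟨k, hk, hku⟩ := exists_lerchSum_eq hτ 1 L (α + 1 / 2 : ℂ) (β + 1 / 2)
  obtain ⟨l, hl, hlu⟩ := exists_deriv_jThetaQuot_eq hτ α (α * τ + β)
  have hne : deriv (fun u => jTheta u τ) 0 ≠ 0 := by
    rw [deriv_jTheta_zero hτ]
    simp [pi_ne_zero, dedekindEta_ne_zero hτ]
  set C : ℂ := 2 * deriv (fun u => jTheta u τ) 0 ^ 2 /
    ((2 * π * I) ^ 3 * jTheta (α * τ + β) τ) with hC
  have hF : (fun u => jTheta u τ * lerchSum 1 L (α + 1 / 2 : ℂ) (β + 1 / 2) τ u -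
      C * deriv (jThetaQuot α (α * τ + β) τ) u) =ᶠ[𝓝[≠] 0] fun u =>
      -2 * ((2 * π * I) ^ 3)⁻¹ * h'' u + h u * (L * (2 * π * I)⁻¹ + u * k u) - C * l u := by
    filter_upwards [hku, hlu, self_mem_nhdsWithin] with u h1 h2 hu
    have hu0 : u ≠ 0 := hu
    have h3 : h u = deriv (fun u => jTheta u τ) 0 + u ^ 2 * h'' u := by
      rw [hhu' u, hhu'' u, hh'0, hh1, hh0]
      ring
    have h4 : C * -(jTheta (α * τ + β) τ / deriv (fun u => jTheta u τ) 0) =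
        -2 * deriv (fun u => jTheta u τ) 0 * ((2 * π * I) ^ 3)⁻¹ := by
      rw [hC]
      field_simp
    rw [h1, h2, hhu, mul_add C, ← mul_assoc C, h4, h3]
    field_simp
    ring
  have hc : ContinuousAt (fun u => -2 * ((2 * π * I : ℂ) ^ 3)⁻¹ * h'' u +
      h u * (L * (2 * π * I)⁻¹ + u * k u) - C * l u) 0 := by
    have h1 := hk.continuousAt
    have h2 := hh.continuous
    have h3 := hl.continuousAt
    have h4 := hh''.continuousAt
    fun_prop
  refine sub_eq_zero.1 (eq_zero_of_theta_multipliers hτ hv (fun u hu => ?_) hc hF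
    (fun u hu => ?_) (fun u hu => ?_) u hu)
  · refine ((differentiable_jTheta hτ u).fun_mul
      (differentiableAt_lerchSum hτ hu _ _ _ _)).fun_sub (DifferentiableAt.const_mul ?_ C)
    refine (analyticAt_iff_eventually_differentiableAt.2 ?_).deriv.differentiableAt
    filter_upwards [OffLattice.eventually hτ hu] with w hw
    exact differentiableAt_jThetaQuot hτ hw _ _
  · have hd : deriv (jThetaQuot α (α * τ + β) τ) (u + 1) =
        cexp (2 * π * I * α) * deriv (jThetaQuot α (α * τ + β) τ) u := by
      rw [← deriv_comp_add_const, ← deriv_const_mul_field]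
      simp only [jThetaQuot_add_one]
    rw [jTheta_mul_lerchSum_add_one, hd]
    ring
  · have hd : deriv (jThetaQuot α (α * τ + β) τ) (u + τ) =
        cexp (-(2 * π * I * β)) * deriv (jThetaQuot α (α * τ + β) τ) u := by
      rw [← deriv_comp_add_const, ← deriv_const_mul_field]
      simp only [jThetaQuot_add_self]
    rw [jTheta_mul_lerchSum_add_self hτ hu h0, hd]
    ring

/-- Theorem 1.2 of Bringmann–Zwegers: the general Rank–Crank type PDE. -/
theorem rank_crank_pde_general (τ : ℂ) (hτ : 0 < τ.im) (α β : ℝ) (u : ℂ)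
    (hv : ∀ m n : ℤ, (α : ℂ) * τ + (β : ℂ) ≠ (m : ℂ) * τ + (n : ℂ))
    (hu : ∀ m n : ℤ, u ≠ (m : ℂ) * τ + (n : ℂ)) :
    jTheta u τ ^ 3 *
      (4 * π * I * deriv (fun t : ℂ =>
          Complex.exp (2 * π * I * α * u - π * I * (α : ℂ)^2 * t) * lerchMu u ((α : ℂ) * t + β) t) τ
        + iteratedDeriv 2 (fun w : ℂ =>
          Complex.exp (2 * π * I * α * w - π * I * (α : ℂ)^2 * τ) * lerchMu w ((α : ℂ) * τ + β) τ) u)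
    = Complex.exp (2 * π * I * α * u - π * I * (α : ℂ)^2 * τ) *
        (16 * π^2 * dedekindEta τ ^ 6 / jTheta ((α : ℂ) * τ + β) τ ^ 2) *
        (aCoef1 α β τ * jTheta0 (2 * u + α * τ + β) (2 * τ)
          - aCoef0 α β τ * jTheta1 (2 * u + α * τ + β) (2 * τ)) := by
  have hv0 := jTheta_affine_ne_zero hτ hv
  rw [heat_cexp_mul_lerchMu hτ hu α β hv0]
  have h1 := jTheta_mul_lerchSum_eq hτ hu hv
  have h2 := deriv_jThetaQuot hτ hu α β
  set P := lerchSum 1 _ _ _ τ u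
  set D := deriv (jThetaQuot α (α * τ + β) τ) u
  generalize aCoef1 α β τ * jTheta0 (2 * u + α * τ + β) (2 * τ) -
    aCoef0 α β τ * jTheta1 (2 * u + α * τ + β) (2 * τ) = B at h2 ⊢
  have hs : (2 * π * I : ℂ) ≠ 0 := by simp [pi_ne_zero]
  have hpi : (π : ℂ) ≠ 0 := by simp [pi_ne_zero]
  rw [deriv_jTheta_zero hτ] at h1
  calc _ = (2 * π * I) ^ 2 / (jTheta (α * τ + β) τ * cexp (π * I * α ^ 2 * τ)) *
        jTheta u τ ^ 2 * (jTheta u τ * P) := by ring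
    _ = (2 * π * I) ^ 2 / (jTheta (α * τ + β) τ * cexp (π * I * α ^ 2 * τ)) *
        (2 * (-2 * π * dedekindEta τ ^ 3) ^ 2 / ((2 * π * I) ^ 3 * jTheta (α * τ + β) τ)) *
        (jTheta u τ ^ 2 * D) := by rw [h1]; ring
    _ = _ := by
      rw [h2, Complex.exp_sub]
      have hX := Complex.exp_ne_zero (π * I * α ^ 2 * τ)
      field_simp
      ring

end
end

section
/- Let τ be in the complex upper half-plane, set q = e^{2πiτ}, and let u ∈ ℂ with u ∉ ℤτ+ℤ, z = e^{2πiu}. Then z (q;q)_∞² C*(z;q)³ = (3δ_q + (1/2)δ_z + (1/2)δ_z²) R*(z;q), where the operators δ_q := (2πi)^{−1}∂/∂τ and δ_z := (2πi)^{−1}∂/∂u act on (u,τ) ↦ R*(e^{2πiu}; e^{2πiτ}). -/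
open Complex Real Filter

noncomputable section

open scoped Topology

/-- A function which is periodic with respect to `ℤτ + ℤ`, holomorphic off this lattice, continuous
at the origin and zero there vanishes identically. -/
theorem eq_zero_of_doublyPeriodic {f : ℂ → ℂ} {τ : ℂ} (hτ : 0 < τ.im)
    (hd : ∀ u, (∀ m n : ℤ, u ≠ (m : ℂ) * τ + n) → DifferentiableAt ℂ f u)
    (h1 : ∀ u, f (u + 1) = f u) (h2 : ∀ u, f (u + τ) = f u)
    (hc : ContinuousAt f 0) (h0 : f 0 = 0) (u : ℂ) : f u = 0 := by
  have hp (m n : ℤ) (u : ℂ) : f (u + (m * τ + n)) = f u := by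
    have a : Function.Periodic f 1 := h1
    have b : Function.Periodic f τ := h2
    rw [← add_assoc, ← mul_one (n : ℂ), a.int_mul n, b.int_mul m]
  have hd0 : DifferentiableAt ℂ f 0 := by
    refine (analyticAt_of_differentiable_on_punctured_nhds_of_continuousAt ?_ hc).differentiableAt
    rw [eventually_nhdsWithin_iff]
    filter_upwards [Metric.ball_mem_nhds (0 : ℂ) (lt_min hτ one_pos)] with v hv hv0
    refine hd v fun m n hmn ↦ hv0 ?_
    rw [Metric.mem_ball, dist_zero_right, lt_min_iff] at hv
    have him : |(m : ℝ)| * τ.im < 1 * τ.im := by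
      have := (Complex.abs_im_le_norm v).trans_lt hv.1
      rw [hmn] at this
      simpa [abs_mul, abs_of_pos hτ] using this
    have hm : m = 0 := by
      have := lt_of_mul_lt_mul_right him hτ.le
      exact Int.abs_lt_one_iff.mp (by exact_mod_cast this)
    have hn : n = 0 := by
      have := hv.2
      rw [hmn, hm] at this
      simp only [Int.cast_zero, zero_mul, zero_add, Complex.norm_intCast] at this
      exact Int.abs_lt_one_iff.mp (by exact_mod_cast this)
    simp [hmn, hm, hn]
  have hD : Differentiable ℂ f := by
    intro v
    by_cases hv : ∀ m n : ℤ, v ≠ (m : ℂ) * τ + n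
    · exact hd v hv
    · push Not at hv
      obtain ⟨m, n, rfl⟩ := hv
      have : f = fun w ↦ f (w - (m * τ + n)) := by
        ext w
        rw [← hp m n (w - _), sub_add_cancel]
      rw [this]
      refine DifferentiableAt.comp (f := fun w ↦ w - (m * τ + n)) _ ?_ (by fun_prop)
      rwa [sub_self]
  have hb : Bornology.IsBounded (Set.range f) := by
    have hK : IsCompact ((fun x : ℝ × ℝ ↦ f (x.1 * τ + x.2)) '' (Set.Icc 0 1 ×ˢ Set.Icc 0 1)) :=
      (isCompact_Icc.prod isCompact_Icc).image (hD.continuous.comp (by fun_prop))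
    refine hK.isBounded.subset ?_
    rintro _ ⟨v, rfl⟩
    set b := v.im / τ.im with hb
    set a := v.re - b * τ.re with ha
    have hv : v = b * τ + a := by
      apply Complex.ext <;> simp [ha, hb]
      field_simp
    refine ⟨(Int.fract b, Int.fract a), ⟨⟨Int.fract_nonneg _, (Int.fract_lt_one _).le⟩,
      ⟨Int.fract_nonneg _, (Int.fract_lt_one _).le⟩⟩, ?_⟩
    dsimp only
    rw [← hp ⌊b⌋ ⌊a⌋]
    congr 1
    conv_rhs => rw [hv, ← Int.fract_add_floor b, ← Int.fract_add_floor a]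
    push_cast
    ring
  rw [hD.apply_eq_apply_of_bounded hb u 0, h0]

/-- A family of functions is locally normally summable on `U` if it is locally dominated there by
a summable family of constants. -/
def LocallyNormallySummableOn {ι E : Type*} [TopologicalSpace E] (F : ι → E → ℂ) (U : Set E) :
    Prop :=
  ∀ p ∈ U, ∃ M : ι → ℝ, Summable M ∧ ∀ᶠ x in 𝓝 p, ∀ n, ‖F n x‖ ≤ M n

namespace LocallyNormallySummableOn

variable {ι E : Type*} [NormedAddCommGroup E] [NormedSpace ℂ E] {F : ι → E → ℂ} {U : Set E}

theorem exists_fderiv_bound (h : LocallyNormallySummableOn F U) (hU : IsOpen U)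
    (hF : ∀ n, DifferentiableOn ℂ (F n) U) {p : E} (hp : p ∈ U) :
    ∃ r > 0, ∃ M : ι → ℝ, Summable M ∧ Metric.ball p r ⊆ U ∧
      ∀ x ∈ Metric.ball p r, ∀ n, ‖fderiv ℂ (F n) x‖ ≤ M n := by
  obtain ⟨M, hM, hb⟩ := h p hp
  obtain ⟨R, hR, hRs⟩ := Metric.mem_nhds_iff.mp (inter_mem hb (hU.mem_nhds hp))
  refine ⟨R / 2, by positivity, fun n ↦ 2 * M n / (R / 2), (hM.mul_left 2).div_const _,
    fun x hx ↦ (hRs (Metric.ball_subset_ball (by linarith) hx)).2, fun x hx n ↦ ?_⟩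
  have hsub : Metric.ball x (R / 2) ⊆ Metric.ball p R := by
    refine Metric.ball_subset_ball' ?_
    have := Metric.mem_ball.mp hx
    linarith
  refine Complex.norm_fderiv_le_div_of_mapsTo_ball
    ((hF n).mono fun y hy ↦ (hRs (hsub hy)).2) (fun y hy ↦ ?_) (by positivity)
  rw [mem_closedBall_iff_norm]
  have h1 := (hRs (hsub hy)).1 n
  have h2 := (hRs (hsub (Metric.mem_ball_self (by positivity)))).1 n
  linarith [norm_sub_le (F n y) (F n x)]

theorem hasFDerivAt (h : LocallyNormallySummableOn F U) (hU : IsOpen U)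
    (hF : ∀ n, DifferentiableOn ℂ (F n) U) {p : E} (hp : p ∈ U) :
    HasFDerivAt (fun x ↦ ∑' n, F n x) (∑' n, fderiv ℂ (F n) p) p := by
  obtain ⟨r, hr, M, hM, hrU, hb⟩ := h.exists_fderiv_bound hU hF hp
  obtain ⟨M', hM', hb'⟩ := h p hp
  let _ : NormedSpace ℝ E := NormedSpace.restrictScalars ℝ ℂ E
  exact hasFDerivAt_tsum_of_isPreconnected hM Metric.isOpen_ball
    (convex_ball p r).isPreconnected
    (fun n x hx ↦ ((hF n).differentiableAt (hU.mem_nhds (hrU hx))).hasFDerivAt)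
    (fun n x hx ↦ hb x hx n) (Metric.mem_ball_self hr)
    (hM'.of_norm_bounded hb'.self_of_nhds) (Metric.mem_ball_self hr)

theorem fderiv_apply (h : LocallyNormallySummableOn F U) (hU : IsOpen U)
    (hF : ∀ n, DifferentiableOn ℂ (F n) U) (v : E) :
    LocallyNormallySummableOn (fun n x ↦ fderiv ℂ (F n) x v) U := by
  intro p hp
  obtain ⟨r, hr, M, hM, hrU, hb⟩ := h.exists_fderiv_bound hU hF hp
  refine ⟨fun n ↦ M n * ‖v‖, hM.mul_right _, ?_⟩
  filter_upwards [Metric.ball_mem_nhds p hr] with x hx n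
  exact ContinuousLinearMap.le_of_opNorm_le _ (hb x hx n) v

theorem differentiableOn (h : LocallyNormallySummableOn F U) (hU : IsOpen U)
    (hF : ∀ n, DifferentiableOn ℂ (F n) U) : DifferentiableOn ℂ (fun x ↦ ∑' n, F n x) U :=
  fun _ hp ↦ (h.hasFDerivAt hU hF hp).differentiableAt.differentiableWithinAt

theorem differentiableOn_fderiv_apply (h : LocallyNormallySummableOn F U) (hU : IsOpen U)
    (hF : ∀ n, AnalyticOnNhd ℂ (F n) U) (v : E) :
    DifferentiableOn ℂ (fun x ↦ fderiv ℂ (fun y ↦ ∑' n, F n y) x v) U := by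
  have hF' (n) : DifferentiableOn ℂ (F n) U := (hF n).differentiableOn
  refine ((h.fderiv_apply hU hF' v).differentiableOn hU fun n x hx ↦ ?_).congr fun x hx ↦ ?_
  · exact ((hF n x hx).fderiv.differentiableAt.clm_apply
      (differentiableAt_const v)).differentiableWithinAt
  · obtain ⟨r, hr, M, hM, hrU, hb⟩ := h.exists_fderiv_bound hU hF' hx
    rw [(h.hasFDerivAt hU hF' hx).fderiv]
    exact ContinuousLinearMap.map_tsum (ContinuousLinearMap.apply ℂ ℂ v)
      (hM.of_norm_bounded fun n ↦ hb x (Metric.mem_ball_self hr) n)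

end LocallyNormallySummableOn

section PentagonalNumberTheorem

variable {q : ℂ}

theorem norm_prod_one_sub_pow_le (hq : ‖q‖ < 1) (k n : ℕ) :
    ‖∏ i ∈ Finset.range n, (1 - q ^ (k + i + 1))‖ ≤ Real.exp (1 - ‖q‖)⁻¹ := by
  calc ‖∏ i ∈ Finset.range n, (1 - q ^ (k + i + 1))‖
      ≤ ∏ i ∈ Finset.range n, Real.exp (‖q‖ ^ i) := by
        rw [norm_prod]
        refine Finset.prod_le_prod (fun _ _ ↦ norm_nonneg _) fun i _ ↦ ?_
        refine (norm_sub_le _ _).trans ?_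
        rw [norm_one, norm_pow, add_comm]
        refine le_trans ?_ (Real.add_one_le_exp _)
        gcongr ?_ + 1
        exact pow_le_pow_of_le_one (norm_nonneg _) hq.le (by omega)
    _ ≤ Real.exp (1 - ‖q‖)⁻¹ := by
        rw [← Real.exp_sum, Real.exp_le_exp, ← tsum_geometric_of_lt_one (norm_nonneg _) hq]
        exact (summable_geometric_of_lt_one (norm_nonneg _) hq).sum_le_tsum _
          fun _ _ ↦ by positivity

theorem norm_pow_mul_prod_one_sub_pow_le (hq : ‖q‖ < 1) (k n : ℕ) :
    ‖q ^ ((k + 1) * n) * ∏ i ∈ Finset.range (n + 1), (1 - q ^ (k + i + 1))‖ ≤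
      ‖q‖ ^ n * Real.exp (1 - ‖q‖)⁻¹ := by
  rw [norm_mul, norm_pow]
  exact mul_le_mul
    (pow_le_pow_of_le_one (norm_nonneg _) hq.le (Nat.le_mul_of_pos_left _ (by omega)))
    (norm_prod_one_sub_pow_le hq k (n + 1)) (norm_nonneg _) (by positivity)

theorem summable_neg_one_zpow_mul_pow_pentagonal (hq : ‖q‖ < 1) :
    Summable fun k : ℤ ↦ (-1 : ℂ) ^ k * q ^ pentagonal k := by
  refine .of_norm_bounded ((summable_geometric_of_lt_one (norm_nonneg q) hq).comp_injective
    pentagonal_injective) fun k ↦ ?_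
  simp

/-- **Pentagonal number theorem** for complex numbers. -/
theorem hasSum_pentagonal (hq : ‖q‖ < 1) :
    HasSum (fun k : ℤ ↦ (-1 : ℂ) ^ k * q ^ pentagonal k) (∏' n : ℕ, (1 - q ^ (n + 1))) := by
  have hs := (summable_neg_one_zpow_mul_pow_pentagonal hq).hasSum
  have hs' := hs
  rw [← neg_injective.hasSum_iff (fun x hx ↦ by absurd hx; use -x; simp)] at hs'
  replace hs' := hs'.nat_add_neg_add_one
  have hgeo := summable_geometric_of_lt_one (norm_nonneg q) hq
  have hgeo' := hgeo.mul_right (Real.exp (1 - ‖q‖)⁻¹)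
  have hterm : (fun n : ℕ ↦ ((fun k : ℤ ↦ (-1 : ℂ) ^ k * q ^ pentagonal k) ∘ Neg.neg) (n : ℤ) +
      ((fun k : ℤ ↦ (-1 : ℂ) ^ k * q ^ pentagonal k) ∘ Neg.neg) (-((n : ℤ) + 1))) =
      fun k : ℕ ↦ (-1 : ℂ) ^ k * (q ^ pentagonal (-k) - q ^ pentagonal (k + 1)) := by
    ext n
    simp only [Function.comp_apply, neg_neg, zpow_neg, zpow_natCast, ← inv_pow]
    rw [zpow_add₀ (by simp), zpow_natCast]
    norm_num
    ring
  rw [hterm] at hs'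
  rw [Pentagonal.tprod_one_sub_pow (x := q) ?_ ?_ ?_ hs'.summable ?_, hs'.tsum_eq]
  · exact hs
  · exact tendsto_pow_atTop_nhds_zero_of_norm_lt_one hq
  · exact fun k ↦ .of_norm_bounded hgeo' fun n ↦ norm_pow_mul_prod_one_sub_pow_le hq k n
  · intro k
    simp only [sub_eq_add_neg]
    refine multipliable_one_add_of_summable (.of_nonneg_of_le (fun _ ↦ norm_nonneg _)
      (fun n ↦ ?_) hgeo)
    rw [norm_neg, norm_pow]
    exact pow_le_pow_of_le_one (norm_nonneg _) hq.le (by omega)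
  · refine squeeze_zero_norm (fun k ↦ ?_)
      (a := fun k ↦ ‖q‖ ^ k * ∑' n, ‖q‖ ^ n * Real.exp (1 - ‖q‖)⁻¹) ?_
    · rw [norm_mul, norm_mul, norm_pow, norm_neg, norm_one, one_pow, one_mul, norm_pow]
      refine mul_le_mul (pow_le_pow_of_le_one (norm_nonneg _) hq.le ?_) ?_ (norm_nonneg _)
        (by positivity)
      · rw [Nat.le_div_iff_mul_le (by norm_num)]
        nlinarith
      · exact tsum_of_norm_bounded hgeo'.hasSum fun n ↦ norm_pow_mul_prod_one_sub_pow_le hq k n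
    · simpa using (tendsto_pow_atTop_nhds_zero_of_lt_one (norm_nonneg _) hq).mul_const
        (∑' n, ‖q‖ ^ n * Real.exp (1 - ‖q‖)⁻¹)

end PentagonalNumberTheorem

section InfinitePochhammer

variable {q : ℂ}

theorem summable_norm_mul_pow (hq : ‖q‖ < 1) (a : ℂ) : Summable fun j : ℕ ↦ ‖-(a * q ^ j)‖ := by
  simpa using (summable_geometric_of_lt_one (norm_nonneg q) hq).mul_left ‖a‖

theorem multipliable_one_sub_mul_pow (hq : ‖q‖ < 1) (a : ℂ) :
    Multipliable fun j : ℕ ↦ 1 - a * q ^ j := by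
  simpa only [sub_eq_add_neg] using multipliable_one_add_of_summable (summable_norm_mul_pow hq a)

theorem qPochInf_eq_one_sub_mul (hq : ‖q‖ < 1) (a : ℂ) :
    qPochInf a q = (1 - a) * qPochInf (a * q) q := by
  have h := tprod_eq_zero_mul' (f := fun j : ℕ ↦ 1 - a * q ^ j)
    ((multipliable_one_sub_mul_pow hq (a * q)).congr fun j ↦ by rw [pow_succ']; ring)
  simpa [qPochInf, pow_succ', mul_assoc] using h

theorem qPochInf_ne_zero (hq : ‖q‖ < 1) {a : ℂ} (ha : ∀ j : ℕ, 1 - a * q ^ j ≠ 0) :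
    qPochInf a q ≠ 0 := by
  simp only [sub_eq_add_neg] at ha
  simpa only [qPochInf, sub_eq_add_neg] using
    tprod_one_add_ne_zero_of_summable ha (summable_norm_mul_pow hq a)

theorem differentiable_qPochInf (hq : ‖q‖ < 1) : Differentiable ℂ fun a ↦ qPochInf a q := by
  intro a
  have h : HasProdLocallyUniformlyOn (fun (j : ℕ) (a : ℂ) ↦ 1 + -(a * q ^ j))
      (fun a ↦ ∏' j : ℕ, (1 + -(a * q ^ j))) (Metric.ball 0 (‖a‖ + 1)) :=
    Summable.hasProdLocallyUniformlyOn_nat_one_add Metric.isOpen_ball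
      ((summable_geometric_of_lt_one (norm_nonneg q) hq).mul_left (‖a‖ + 1))
      (.of_forall fun j x hx ↦ by
        rw [norm_neg, norm_mul, norm_pow]
        gcongr
        simpa using (Metric.mem_ball.mp hx).le) fun j ↦ by fun_prop
  have hd := h.differentiableOn (.of_forall fun s ↦ by
    simpa [Finset.prod_fn] using DifferentiableOn.finsetProd (fun _ _ ↦ by fun_prop))
    Metric.isOpen_ball
  simpa only [qPochInf, sub_eq_add_neg] using
    hd.differentiableAt (Metric.isOpen_ball.mem_nhds (by simp))

theorem qPochInf_self_ne_zero (hq : ‖q‖ < 1) : qPochInf q q ≠ 0 := by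
  refine qPochInf_ne_zero hq fun j h ↦ ?_
  rw [← pow_succ', sub_eq_zero] at h
  have := congrArg norm h
  rw [norm_one, norm_pow] at this
  exact (pow_lt_one₀ (norm_nonneg q) hq (Nat.succ_ne_zero j)).ne' this

theorem qPochInf_self_eq_tprod : qPochInf q q = ∏' n : ℕ, (1 - q ^ (n + 1)) := by
  simp [qPochInf, pow_succ']

/-- The theta product `(z;q)_∞ (q/z;q)_∞`. -/
def thetaProd (z q : ℂ) : ℂ := qPochInf z q * qPochInf (z⁻¹ * q) q

theorem thetaProd_mul_self (hq : ‖q‖ < 1) (hq0 : q ≠ 0) {z : ℂ} (hz : z ≠ 0) :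
    thetaProd (z * q) q = -z⁻¹ * thetaProd z q := by
  have h1 : (z * q)⁻¹ * q = z⁻¹ := by field_simp
  rw [thetaProd, thetaProd, h1, qPochInf_eq_one_sub_mul hq z, qPochInf_eq_one_sub_mul hq z⁻¹]
  field_simp
  ring

theorem thetaProd_ne_zero (hq : ‖q‖ < 1) {z : ℂ} (hz : z ≠ 0)
    (h : ∀ n : ℤ, 1 - z * q ^ n ≠ 0) (hq0 : q ≠ 0) : thetaProd z q ≠ 0 := by
  refine mul_ne_zero (qPochInf_ne_zero hq fun j ↦ h j) (qPochInf_ne_zero hq fun j h0 ↦ ?_)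
  refine h (-(j + 1 : ℕ)) ?_
  rw [zpow_neg, zpow_natCast, sub_eq_zero, eq_comm, mul_inv_eq_one₀ (pow_ne_zero _ hq0)]
  rw [mul_assoc, ← pow_succ', sub_eq_zero, eq_comm, inv_mul_eq_one₀ hz] at h0
  exact h0

theorem crankStar_eq_div_thetaProd (hq : ‖q‖ < 1) {z : ℂ} (hz : z ≠ 0)
    (h : ∀ n : ℤ, 1 - z * q ^ n ≠ 0) (hq0 : q ≠ 0) :
    crankStar z q = qPochInf q q / thetaProd z q := by
  have hne := thetaProd_ne_zero hq hz h hq0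
  have h1 : HasProd _ (qPochInf q q) := (multipliable_one_sub_mul_pow hq q).hasProd
  have h2 : HasProd _ (qPochInf (z * q) q) := (multipliable_one_sub_mul_pow hq (z * q)).hasProd
  have h3 : HasProd _ (qPochInf (z⁻¹ * q) q) :=
    (multipliable_one_sub_mul_pow hq (z⁻¹ * q)).hasProd
  rw [thetaProd, qPochInf_eq_one_sub_mul hq z] at hne ⊢
  have hinv {f : ℕ → ℂ} {a : ℂ} (hf : HasProd f a) (ha : a ≠ 0) :
      HasProd (fun n ↦ (f n)⁻¹) a⁻¹ := by
    simpa [HasProd, Finset.prod_inv_distrib] using Tendsto.inv₀ hf ha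
  have h4 := h1.mul ((hinv h2 (right_ne_zero_of_mul (left_ne_zero_of_mul hne))).mul
    (hinv h3 (right_ne_zero_of_mul hne)))
  have h5 : (fun n : ℕ ↦ (1 - q ^ (n + 1)) / ((1 - z * q ^ (n + 1)) * (1 - z⁻¹ * q ^ (n + 1)))) =
      fun n : ℕ ↦ (1 - q * q ^ n) * ((1 - z * q * q ^ n)⁻¹ * (1 - z⁻¹ * q * q ^ n)⁻¹) := by
    ext n
    rw [div_eq_mul_inv, mul_inv, mul_assoc z, mul_assoc z⁻¹, pow_succ']
  rw [crankStar, h5, h4.tprod_eq]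
  simp only [div_eq_mul_inv, mul_inv]
  ring

end InfinitePochhammer

section AppellSum

/-- The exponential `x ↦ e^{2πix}`. -/
def qExp (x : ℂ) : ℂ := Complex.exp (2 * π * I * x)

theorem qExp_ne_zero (x : ℂ) : qExp x ≠ 0 := Complex.exp_ne_zero _

theorem qExp_zero : qExp 0 = 1 := by simp [qExp]

theorem qExp_add (x y : ℂ) : qExp (x + y) = qExp x * qExp y := by
  rw [qExp, mul_add, Complex.exp_add]; rfl

theorem qExp_one : qExp 1 = 1 := by simp [qExp, Complex.exp_two_pi_mul_I]

theorem qExp_add_one (x : ℂ) : qExp (x + 1) = qExp x := by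
  rw [qExp_add, qExp_one, mul_one]

theorem qExp_int_mul (n : ℤ) (x : ℂ) : qExp (n * x) = qExp x ^ n := by
  rw [qExp, qExp, ← Complex.exp_int_mul]; ring_nf

theorem qExp_eq_one_iff {x : ℂ} : qExp x = 1 ↔ ∃ n : ℤ, x = n := by
  rw [qExp, Complex.exp_eq_one_iff]
  refine exists_congr fun n ↦ ?_
  rw [mul_comm, mul_left_inj' two_pi_I_ne_zero]

theorem hasDerivAt_qExp (x : ℂ) : HasDerivAt qExp (2 * π * I * qExp x) x := by
  have := ((hasDerivAt_id x).const_mul (2 * π * I)).cexp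
  rw [mul_one, mul_comm (Complex.exp _)] at this
  exact this

theorem differentiable_qExp : Differentiable ℂ qExp :=
  fun x ↦ (hasDerivAt_qExp x).differentiableAt

theorem continuous_qExp : Continuous qExp := differentiable_qExp.continuous

theorem analyticAt_qExp (x : ℂ) : AnalyticAt ℂ qExp x :=
  differentiable_qExp.analyticAt x

theorem norm_qExp_lt_one {τ : ℂ} (hτ : 0 < τ.im) : ‖qExp τ‖ < 1 := by
  rw [qExp, Complex.norm_exp, Real.exp_lt_one_iff]
  simp
  positivity

theorem isOpen_upperHalf : IsOpen {p : ℂ × ℂ | 0 < p.2.im} :=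
  isOpen_lt continuous_const (Complex.continuous_im.comp continuous_snd)

/-- The denominator `1 - z q ^ n`, as a function of `(u, τ)`. -/
def rankDenom (n : ℤ) (p : ℂ × ℂ) : ℂ := 1 - qExp p.1 * qExp p.2 ^ n

/-- The terms of the series defining `rankStar`, as functions of `(u, τ)`. -/
def rankTerm (n : ℤ) (p : ℂ × ℂ) : ℂ :=
  (-1) ^ n * qExp p.2 ^ (n * (3 * n + 1) / 2) / rankDenom n p

theorem analyticAt_rankDenom (n : ℤ) (p : ℂ × ℂ) : AnalyticAt ℂ (rankDenom n) p := by
  have h1 : AnalyticAt ℂ (fun p : ℂ × ℂ ↦ qExp p.1) p := (analyticAt_qExp _).comp analyticAt_fst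
  have h2 : AnalyticAt ℂ (fun p : ℂ × ℂ ↦ qExp p.2) p := (analyticAt_qExp _).comp analyticAt_snd
  exact analyticAt_const.sub (h1.mul (h2.zpow (qExp_ne_zero _)))

theorem analyticAt_rankTerm {n : ℤ} {p : ℂ × ℂ} (h : rankDenom n p ≠ 0) :
    AnalyticAt ℂ (rankTerm n) p := by
  have h2 : AnalyticAt ℂ (fun p : ℂ × ℂ ↦ qExp p.2) p := (analyticAt_qExp _).comp analyticAt_snd
  exact (analyticAt_const.mul (h2.zpow (qExp_ne_zero _))).div (analyticAt_rankDenom n p) h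

/-- The pairs `(u, τ)` at which no denominator with `n ≠ 0` vanishes. -/
def puncturedDomain : Set (ℂ × ℂ) := {p | 0 < p.2.im ∧ ∀ n : ℤ, n ≠ 0 → rankDenom n p ≠ 0}

theorem exists_eventually_half_le_norm_rankDenom {p₀ : ℂ × ℂ} (hp : 0 < p₀.2.im) :
    ∃ r : ℝ, 0 < r ∧ r < 1 ∧ ∃ N : ℕ, ∀ᶠ p in 𝓝 p₀, ‖qExp p.2‖ ≤ r ∧
      ∀ n : ℤ, N ≤ n.natAbs → 1 / 2 ≤ ‖rankDenom n p‖ := by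
  obtain ⟨r, hr, hr1⟩ := exists_between (norm_qExp_lt_one hp)
  have hr0 : 0 < r := (norm_nonneg _).trans_lt hr
  set b := ‖qExp p₀.1‖ with hb
  have hb0 : 0 < b := norm_pos_iff.mpr (qExp_ne_zero _)
  have hlim := tendsto_pow_atTop_nhds_zero_of_lt_one hr0.le hr1
  obtain ⟨N, hN⟩ := eventually_atTop.mp
    ((hlim.eventually (gt_mem_nhds (show (0 : ℝ) < 1 / (4 * b) by positivity))).and
      (hlim.eventually (gt_mem_nhds (show (0 : ℝ) < b / 4 by positivity))))
  refine ⟨r, hr0, hr1, N, ?_⟩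
  have hc1 : Continuous fun p : ℂ × ℂ ↦ ‖qExp p.1‖ :=
    (continuous_qExp.comp continuous_fst).norm
  have hc2 : Continuous fun p : ℂ × ℂ ↦ ‖qExp p.2‖ :=
    (continuous_qExp.comp continuous_snd).norm
  filter_upwards [hc2.continuousAt.eventually (gt_mem_nhds hr),
    hc1.continuousAt.eventually (gt_mem_nhds (show b < 2 * b by linarith)),
    hc1.continuousAt.eventually (lt_mem_nhds (show b / 2 < b by linarith))] with p h1 h2 h3
  refine ⟨h1.le, fun n hn ↦ ?_⟩
  obtain ⟨h4, h5⟩ := hN n.natAbs hn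
  have hq0 : 0 < ‖qExp p.2‖ := norm_pos_iff.mpr (qExp_ne_zero _)
  have hpow : ‖qExp p.2‖ ^ n.natAbs ≤ r ^ n.natAbs := by gcongr
  rcases le_total 0 n with h0 | h0
  · have hz : ‖qExp p.1 * qExp p.2 ^ n‖ ≤ 1 / 2 := by
      rw [norm_mul, norm_zpow, ← Int.natAbs_of_nonneg h0, zpow_natCast]
      calc ‖qExp p.1‖ * ‖qExp p.2‖ ^ n.natAbs ≤ (2 * b) * (1 / (4 * b)) := by
            gcongr; exact hpow.trans h4.le
        _ = 1 / 2 := by field_simp; norm_num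
    have := norm_sub_norm_le 1 (qExp p.1 * qExp p.2 ^ n)
    rw [norm_one] at this
    rw [rankDenom]; linarith
  · have hz : 2 ≤ ‖qExp p.1 * qExp p.2 ^ n‖ := by
      have hn' : n = -(n.natAbs : ℤ) := by omega
      rw [norm_mul, norm_zpow, hn', zpow_neg, zpow_natCast,
        ← div_eq_mul_inv, le_div_iff₀ (by positivity)]
      linarith
    have := norm_sub_norm_le (qExp p.1 * qExp p.2 ^ n) 1
    rw [norm_one, norm_sub_rev] at this
    rw [rankDenom]; linarith

theorem eventually_forall_ne_zero_of_mem {p₀ : ℂ × ℂ} (hp : p₀ ∈ puncturedDomain) :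
    ∃ r : ℝ, 0 < r ∧ r < 1 ∧ ∃ c : ℤ → ℝ, (∀ n, 0 < c n) ∧
      (∀ᶠ n in cofinite, 1 / 4 ≤ c n) ∧
      ∀ᶠ p in 𝓝 p₀, ‖qExp p.2‖ ≤ r ∧ ∀ n ≠ 0, c n ≤ ‖rankDenom n p‖ := by
  obtain ⟨r, hr0, hr1, N, h⟩ := exists_eventually_half_le_norm_rankDenom hp.1
  have hfin : {n : ℤ | ¬ N ≤ n.natAbs}.Finite :=
    (Set.finite_Icc (-N : ℤ) N).subset fun n hn ↦ by
      simp only [Set.mem_ofPred_eq, Set.mem_Icc] at *; omega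
  refine ⟨r, hr0, hr1, fun n ↦ if n = 0 then 1 else min (1 / 2) (‖rankDenom n p₀‖ / 2),
    fun n ↦ ?_, ?_, ?_⟩
  · dsimp only
    split_ifs with hn
    · norm_num
    · have := norm_pos_iff.mpr (hp.2 n hn)
      positivity
  · have h0 := h.self_of_nhds.2
    filter_upwards [hfin.compl_mem_cofinite] with n hn
    have := h0 n (not_not.mp hn)
    split_ifs
    · norm_num
    · exact le_min (by norm_num) (by linarith)
  · have hev : ∀ᶠ p in 𝓝 p₀, ∀ n ∈ {n : ℤ | ¬ N ≤ n.natAbs}, n ≠ 0 →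
        ‖rankDenom n p₀‖ / 2 < ‖rankDenom n p‖ := by
      rw [eventually_all_finite hfin]
      intro n _
      rw [eventually_imp_distrib_left]
      intro hn
      have := norm_pos_iff.mpr (hp.2 n hn)
      exact (analyticAt_rankDenom n p₀).continuousAt.norm.eventually
        (lt_mem_nhds (by linarith))
    filter_upwards [h, hev] with p h1 h2
    refine ⟨h1.1, fun n hn ↦ ?_⟩
    simp only [hn, if_false]
    by_cases hN : N ≤ n.natAbs
    · exact (min_le_left _ _).trans (h1.2 n hN)
    · exact (min_le_right _ _).trans (h2 n hN hn).le

theorem isOpen_puncturedDomain : IsOpen puncturedDomain := by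
  rw [isOpen_iff_mem_nhds]
  intro p₀ hp
  obtain ⟨r, -, -, c, hc, -, h⟩ := eventually_forall_ne_zero_of_mem hp
  filter_upwards [h, isOpen_upperHalf.mem_nhds hp.1] with p h1 h2
  exact ⟨h2, fun n hn ↦ norm_pos_iff.mp ((hc n).trans_le (h1.2 n hn))⟩

theorem natAbs_le_rank_exponent (n : ℤ) : (n.natAbs : ℤ) ≤ n * (3 * n + 1) / 2 := by
  rw [Int.le_ediv_iff_mul_le (by norm_num)]
  rcases le_total 0 n with h | h
  · rw [Int.natAbs_of_nonneg h]
    rcases h.eq_or_lt with rfl | h'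
    · simp
    · nlinarith
  · rw [Int.ofNat_natAbs_of_nonpos h]
    rcases h.eq_or_lt with rfl | h'
    · simp
    · nlinarith

theorem norm_rankTerm_le {r : ℝ} (hr : r ≤ 1) {c : ℝ} {n : ℤ} {p : ℂ × ℂ}
    (hc : 0 < c) (hq : ‖qExp p.2‖ ≤ r) (h : c ≤ ‖rankDenom n p‖) :
    ‖rankTerm n p‖ ≤ r ^ n.natAbs / c := by
  have hr0 : 0 < r := (norm_pos_iff.mpr (qExp_ne_zero _)).trans_le hq
  rw [rankTerm, norm_div, norm_mul, norm_zpow, norm_neg, norm_one, one_zpow, one_mul, norm_zpow]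
  refine div_le_div₀ (by positivity) ?_ hc h
  obtain ⟨m, hm⟩ := Int.eq_ofNat_of_zero_le
    ((Int.natCast_nonneg _).trans (natAbs_le_rank_exponent n))
  have hle := natAbs_le_rank_exponent n
  rw [hm] at hle ⊢
  rw [zpow_natCast]
  calc ‖qExp p.2‖ ^ m ≤ r ^ m := by gcongr
    _ ≤ r ^ n.natAbs := pow_le_pow_of_le_one hr0.le hr (by exact_mod_cast hle)

theorem summable_pow_natAbs {r : ℝ} (hr0 : 0 ≤ r) (hr : r < 1) :
    Summable fun n : ℤ ↦ r ^ n.natAbs := by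
  refine .of_nat_of_neg ?_ ?_ <;> simpa using summable_geometric_of_lt_one hr0 hr

/-- The series `rankTerm` with the term `n = 0` removed. -/
def rankTail (p : ℂ × ℂ) : ℂ := ∑' n : ℤ, if n = 0 then 0 else rankTerm n p

theorem locallyNormallySummableOn_rankTerm : LocallyNormallySummableOn
    (fun (n : ℤ) p ↦ if n = 0 then 0 else rankTerm n p) puncturedDomain := by
  intro p₀ hp
  obtain ⟨r, hr0, hr1, c, hc, hc4, h⟩ := eventually_forall_ne_zero_of_mem hp
  refine ⟨fun n ↦ r ^ n.natAbs / c n, ?_, ?_⟩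
  · refine .of_norm_bounded_eventually ((summable_pow_natAbs hr0.le hr1).mul_right 4) ?_
    filter_upwards [hc4] with n hn
    have := hc n
    rw [Real.norm_of_nonneg (by positivity), div_le_iff₀ this]
    have : 0 < r ^ n.natAbs := by positivity
    nlinarith
  · filter_upwards [h] with p h1 n
    have := hc n
    split_ifs with hn
    · rw [norm_zero]; positivity
    · exact norm_rankTerm_le hr1.le this h1.1 (h1.2 n hn)

theorem analyticOnNhd_rankTerm (n : ℤ) :
    AnalyticOnNhd ℂ (fun p ↦ if n = 0 then 0 else rankTerm n p) puncturedDomain := by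
  intro p hp
  by_cases hn : n = 0
  · simpa [hn] using analyticAt_const
  · simpa [hn] using analyticAt_rankTerm (hp.2 n hn)

theorem differentiableOn_rankTail : DifferentiableOn ℂ rankTail puncturedDomain :=
  locallyNormallySummableOn_rankTerm.differentiableOn isOpen_puncturedDomain
    fun n ↦ (analyticOnNhd_rankTerm n).differentiableOn

theorem differentiableOn_fderiv_rankTail (v : ℂ × ℂ) :
    DifferentiableOn ℂ (fun p ↦ fderiv ℂ rankTail p v) puncturedDomain :=
  locallyNormallySummableOn_rankTerm.differentiableOn_fderiv_apply isOpen_puncturedDomain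
    analyticOnNhd_rankTerm v

theorem summable_rankTerm {p : ℂ × ℂ} (hp : p ∈ puncturedDomain) :
    Summable fun n ↦ rankTerm n p := by
  obtain ⟨M, hM, h⟩ := locallyNormallySummableOn_rankTerm p hp
  refine (Summable.of_norm_bounded hM h.self_of_nhds).congr_cofinite ?_
  filter_upwards [(Set.finite_singleton (0 : ℤ)).compl_mem_cofinite] with n hn
  have hn : n ≠ 0 := hn
  simp [hn]

theorem tsum_rankTerm {p : ℂ × ℂ} (hp : p ∈ puncturedDomain) :
    ∑' n, rankTerm n p = (1 - qExp p.1)⁻¹ + rankTail p := by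
  rw [(summable_rankTerm hp).tsum_eq_add_tsum_ite 0, rankTail]
  simp [rankTerm, rankDenom]

end AppellSum

section RankFunctionalEquation

/-- The pairs `(u, τ)` with `u` outside the lattice `ℤτ + ℤ`. -/
def regularDomain : Set (ℂ × ℂ) := {p | 0 < p.2.im ∧ ∀ n : ℤ, rankDenom n p ≠ 0}

theorem regularDomain_subset : regularDomain ⊆ puncturedDomain :=
  fun _ hp ↦ ⟨hp.1, fun n _ ↦ hp.2 n⟩

theorem isOpen_regularDomain : IsOpen regularDomain := by
  have : regularDomain = puncturedDomain ∩ {p | rankDenom 0 p ≠ 0} := by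
    ext p
    refine ⟨fun hp ↦ ⟨regularDomain_subset hp, hp.2 0⟩, fun hp ↦ ⟨hp.1.1, fun n ↦ ?_⟩⟩
    rcases eq_or_ne n 0 with rfl | hn
    · exact hp.2
    · exact hp.1.2 n hn
  rw [this]
  refine isOpen_puncturedDomain.inter (isOpen_ne_fun ?_ continuous_const)
  exact continuous_iff_continuousAt.mpr fun p ↦ (analyticAt_rankDenom 0 p).continuousAt

theorem rankDenom_add_tau (n : ℤ) (p : ℂ × ℂ) :
    rankDenom n (p.1 + p.2, p.2) = rankDenom (n + 1) p := by
  simp only [rankDenom, qExp_add, zpow_add_one₀ (qExp_ne_zero _)]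
  ring

theorem add_tau_mem_regularDomain {p : ℂ × ℂ} (hp : p ∈ regularDomain) :
    (p.1 + p.2, p.2) ∈ regularDomain :=
  ⟨hp.1, fun n ↦ by rw [rankDenom_add_tau]; exact hp.2 _⟩

theorem rank_exponent_sub (n : ℤ) : n * (3 * n + 1) / 2 = (pentagonal n : ℤ) + n := by
  have := two_mul_natCast_pentagonal n
  refine Int.ediv_eq_of_eq_mul_left (by norm_num) ?_
  linarith

theorem rankTerm_add_tau {p : ℂ × ℂ} (hp : p ∈ regularDomain) (n : ℤ) :
    rankTerm (n - 1) (p.1 + p.2, p.2) =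
      -qExp p.2 * qExp p.1 ^ 3 * rankTerm n p
      - qExp p.2 * qExp p.1 ^ 2 * ((-1) ^ n * qExp p.2 ^ pentagonal n)
      - qExp p.2 * qExp p.1 * ((-1) ^ n * qExp p.2 ^ ((pentagonal n : ℤ) - n))
      - qExp p.2 * ((-1) ^ n * qExp p.2 ^ ((pentagonal n : ℤ) - 2 * n)) := by
  have hq := qExp_ne_zero p.2
  have hd := hp.2 n
  have hexp : (n - 1) * (3 * (n - 1) + 1) / 2 = (pentagonal n : ℤ) - 2 * n + 1 := by
    have := two_mul_natCast_pentagonal n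
    refine Int.ediv_eq_of_eq_mul_left (by norm_num) ?_
    linarith
  rw [rankTerm, rankTerm, rankDenom_add_tau, sub_add_cancel, hexp, rank_exponent_sub]
  rw [zpow_add_one₀ hq, zpow_sub₀ hq, zpow_sub₀ hq, zpow_add₀ hq, zpow_mul',
    zpow_sub_one₀ (by simp), zpow_natCast]
  have hx : qExp p.2 ^ n ≠ 0 := zpow_ne_zero _ hq
  field_simp
  rw [rankDenom]
  ring

theorem neg_one_zpow_one_sub (n : ℤ) : (-1 : ℂ) ^ (1 - n) = -(-1) ^ n := by
  rw [sub_eq_add_neg, zpow_add₀ (by simp), zpow_neg, ← inv_zpow]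
  norm_num

theorem hasSum_neg_one_zpow_mul_zpow_pentagonal_sub {q : ℂ} (hq : ‖q‖ < 1) (hq0 : q ≠ 0) :
    HasSum (fun n : ℤ ↦ (-1 : ℂ) ^ n * q ^ ((pentagonal n : ℤ) - 2 * n))
      (-q⁻¹ * qPochInf q q) := by
  have h := (hasSum_pentagonal hq).mul_left (-q⁻¹)
  rw [← qPochInf_self_eq_tprod] at h
  rw [← (Equiv.subLeft (1 : ℤ)).hasSum_iff]
  refine h.congr_fun fun n ↦ ?_
  have : (pentagonal (1 - n) : ℤ) - 2 * (1 - n) = pentagonal n - 1 := by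
    have h1 := two_mul_natCast_pentagonal n
    have h2 := two_mul_natCast_pentagonal (1 - n)
    linarith
  rw [Function.comp_apply, Equiv.subLeft_apply, this, neg_one_zpow_one_sub, zpow_sub_one₀ hq0,
    zpow_natCast]
  ring

theorem tsum_rankTerm_add_tau {p : ℂ × ℂ} (hp : p ∈ regularDomain) :
    ∑' n, rankTerm n (p.1 + p.2, p.2) =
      (1 - qExp p.2 * qExp p.1 ^ 2) * qPochInf (qExp p.2) (qExp p.2)
        - qExp p.2 * qExp p.1 ^ 3 * ∑' n, rankTerm n p := by
  have hq0 := qExp_ne_zero p.2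
  have hz0 := qExp_ne_zero p.1
  have hq := norm_qExp_lt_one hp.1
  have h1 := (summable_rankTerm (regularDomain_subset hp)).hasSum
  have h2 := hasSum_pentagonal hq
  rw [← qPochInf_self_eq_tprod] at h2
  have h3 := hasSum_neg_one_zpow_mul_zpow_pentagonal_sub hq hq0
  have h4 := (summable_rankTerm (regularDomain_subset (add_tau_mem_regularDomain hp))).hasSum
  rw [← (Equiv.subRight (1 : ℤ)).hasSum_iff] at h4
  have h5 := ((((h1.mul_left (-qExp p.2 * qExp p.1 ^ 3)).sub
    (h2.mul_left (qExp p.2 * qExp p.1 ^ 2))).sub (h3.mul_left (qExp p.2))).sub h4).mul_left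
    (qExp p.2 * qExp p.1)⁻¹
  set c := (qExp p.2 * qExp p.1)⁻¹ * (-qExp p.2 * qExp p.1 ^ 3 * ∑' n, rankTerm n p -
    qExp p.2 * qExp p.1 ^ 2 * qPochInf (qExp p.2) (qExp p.2) -
    qExp p.2 * (-(qExp p.2)⁻¹ * qPochInf (qExp p.2) (qExp p.2)) -
    ∑' n, rankTerm n (p.1 + p.2, p.2)) with hc
  have h6 : HasSum (fun n : ℤ ↦ (-1 : ℂ) ^ n * qExp p.2 ^ ((pentagonal n : ℤ) - n)) c := by
    refine h5.congr_fun fun n ↦ ?_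
    rw [Function.comp_apply, Equiv.subRight_apply, rankTerm_add_tau hp]
    field_simp
    ring
  have h7 : HasSum (fun n : ℤ ↦ (-1 : ℂ) ^ n * qExp p.2 ^ ((pentagonal n : ℤ) - n)) (-c) := by
    rw [← (Equiv.subLeft (1 : ℤ)).hasSum_iff]
    refine h6.neg.congr_fun fun n ↦ ?_
    have : (pentagonal (1 - n) : ℤ) - (1 - n) = pentagonal n - n := by
      have h1 := two_mul_natCast_pentagonal n
      have h2 := two_mul_natCast_pentagonal (1 - n)
      linarith
    rw [Function.comp_apply, Equiv.subLeft_apply, this, neg_one_zpow_one_sub, neg_mul]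
  have h8 : c = 0 := self_eq_neg.mp (h6.unique h7)
  rw [hc, mul_eq_zero, or_iff_right (by simp [hq0, hz0]), sub_eq_zero] at h8
  rw [← h8]
  field_simp
  ring

end RankFunctionalEquation

section RankCrankOperator

/-- The operator `3 δ_q + (1/2) δ_z + (1/2) δ_z ^ 2` acting on functions of `(u, τ)`. -/
def rankCrankOp (F : ℂ × ℂ → ℂ) (p : ℂ × ℂ) : ℂ :=
  3 * ((2 * π * I)⁻¹ * deriv (fun t ↦ F (p.1, t)) p.2)
    + (1 / 2) * ((2 * π * I)⁻¹ * deriv (fun w ↦ F (w, p.2)) p.1)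
    + (1 / 2) * ((2 * π * I)⁻¹) ^ 2 * deriv (deriv fun w ↦ F (w, p.2)) p.1

/-- The modified rank generating function as a function of `(u, τ)`. -/
def rankFun (p : ℂ × ℂ) : ℂ := rankStar (qExp p.1) (qExp p.2)

/-- Euler's product `(q;q)_∞` as a function of `τ`. -/
def eulerFun (t : ℂ) : ℂ := qPochInf (qExp t) (qExp t)

theorem eulerFun_ne_zero {t : ℂ} (ht : 0 < t.im) : eulerFun t ≠ 0 :=
  qPochInf_self_ne_zero (norm_qExp_lt_one ht)

theorem differentiableAt_eulerFun {t : ℂ} (ht : 0 < t.im) : DifferentiableAt ℂ eulerFun t := by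
  have h1 : DifferentiableAt ℂ (fun q : ℂ ↦ ∏' n : ℕ, (1 - q ^ (n + 1))) (qExp t) :=
    ModularForm.differentiableOn_tprod_one_sub_pow.differentiableAt
      (Metric.isOpen_ball.mem_nhds (by simpa using norm_qExp_lt_one ht))
  refine (h1.comp t (differentiable_qExp t)).congr_of_eventuallyEq (.of_forall fun s ↦ ?_)
  exact qPochInf_self_eq_tprod

theorem rankFun_eq_tsum (p : ℂ × ℂ) : rankFun p = (eulerFun p.2)⁻¹ * ∑' n, rankTerm n p := rfl

theorem rankFun_eq {u τ : ℂ} (hp : (u, τ) ∈ puncturedDomain) :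
    rankFun (u, τ) = (eulerFun τ)⁻¹ * ((1 - qExp u)⁻¹ + rankTail (u, τ)) := by
  rw [rankFun_eq_tsum, tsum_rankTerm hp]

theorem one_sub_qExp_ne_zero {p : ℂ × ℂ} (hp : p ∈ regularDomain) : 1 - qExp p.1 ≠ 0 := by
  simpa [rankDenom] using hp.2 0

theorem differentiableOn_rankFun : DifferentiableOn ℂ rankFun regularDomain := by
  intro p hp
  have hp' := regularDomain_subset hp
  have h1 : DifferentiableAt ℂ (fun p : ℂ × ℂ ↦ eulerFun p.2) p :=
    (differentiableAt_eulerFun hp.1).comp p differentiableAt_snd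
  have h2 : DifferentiableAt ℂ (fun p : ℂ × ℂ ↦ qExp p.1) p :=
    (differentiable_qExp _).comp p differentiableAt_fst
  have h3 := differentiableOn_rankTail.differentiableAt (isOpen_puncturedDomain.mem_nhds hp')
  refine (((h1.fun_inv (eulerFun_ne_zero hp.1)).fun_mul
    (((h2.const_sub 1).fun_inv (one_sub_qExp_ne_zero hp)).fun_add h3)).congr_of_eventuallyEq
      ?_).differentiableWithinAt
  filter_upwards [isOpen_puncturedDomain.mem_nhds hp'] with x hx
  exact rankFun_eq hx

/-- The mock Jacobi transformation of the rank generating function under `u ↦ u + τ`. -/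
theorem rankFun_add_tau {u τ : ℂ} (hp : (u, τ) ∈ regularDomain) :
    rankFun (u + τ, τ) = 1 - qExp τ * qExp u ^ 2 - qExp τ * qExp u ^ 3 * rankFun (u, τ) := by
  have := eulerFun_ne_zero hp.1
  have h := tsum_rankTerm_add_tau hp
  simp only at this h
  rw [rankFun_eq_tsum, rankFun_eq_tsum, h, ← eulerFun]
  field_simp

theorem rankFun_add_one (p : ℂ × ℂ) : rankFun (p.1 + 1, p.2) = rankFun p := by
  rw [rankFun, rankFun, qExp_add_one]

theorem rankCrankOp_rankFun_add_one (u τ : ℂ) :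
    rankCrankOp rankFun (u + 1, τ) = rankCrankOp rankFun (u, τ) := by
  have h1 : (fun w ↦ rankFun (w, τ)) = fun w ↦ rankFun (w + 1, τ) :=
    funext fun w ↦ (rankFun_add_one (w, τ)).symm
  have h2 (t : ℂ) : rankFun (u + 1, t) = rankFun (u, t) := rankFun_add_one (u, t)
  have h3 (w : ℂ) : deriv (fun w ↦ rankFun (w, τ)) (w + 1) = deriv (fun w ↦ rankFun (w, τ)) w := by
    conv_rhs => rw [h1]
    exact (deriv_comp_add_const _ _ _).symm
  have h4 : deriv (deriv fun w ↦ rankFun (w, τ)) (u + 1) = deriv (deriv fun w ↦ rankFun (w, τ)) u := by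
    rw [← deriv_comp_add_const]
    exact congrArg (deriv · u) (funext h3)
  simp only [rankCrankOp, h2, h3, h4]

theorem isOpen_setOf_mem_regularDomain (τ : ℂ) : IsOpen {u : ℂ | (u, τ) ∈ regularDomain} :=
  isOpen_regularDomain.preimage (by fun_prop)

theorem isOpen_setOf_mem_puncturedDomain (τ : ℂ) : IsOpen {u : ℂ | (u, τ) ∈ puncturedDomain} :=
  isOpen_puncturedDomain.preimage (by fun_prop)

theorem differentiableOn_rankFun_left (τ : ℂ) :
    DifferentiableOn ℂ (fun w ↦ rankFun (w, τ)) {u | (u, τ) ∈ regularDomain} :=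
  differentiableOn_rankFun.comp (f := fun w ↦ (w, τ)) (by fun_prop) fun _ h ↦ h

theorem deriv_add_of_quasiperiodic {g : ℂ → ℂ} {V : Set ℂ} {q τ : ℂ} (hV : IsOpen V)
    (hg : DifferentiableOn ℂ g V) (hadd : ∀ w ∈ V, w + τ ∈ V)
    (h : ∀ w ∈ V, g (w + τ) = 1 - q * qExp w ^ 2 - q * qExp w ^ 3 * g w) {w : ℂ} (hw : w ∈ V) :
    deriv g (w + τ) = -(q * (2 * (2 * π * I) * qExp w ^ 2))
      - q * (3 * (2 * π * I) * qExp w ^ 3 * g w + qExp w ^ 3 * deriv g w) := by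
  have hg1 {w : ℂ} (hw : w ∈ V) : HasDerivAt g (deriv g w) w :=
    (hg.differentiableAt (hV.mem_nhds hw)).hasDerivAt
  have h1 := (hg1 (hadd w hw)).comp_add_const w τ
  have hq := hasDerivAt_qExp w
  have h2 := (((hq.fun_pow 2).const_mul q).const_sub 1).fun_sub
    (((hq.fun_pow 3).const_mul q).fun_mul (hg1 hw))
  rw [(h1.congr_of_eventuallyEq (eventually_of_mem (hV.mem_nhds hw) fun x hx ↦ (h x hx).symm)).unique h2]
  push_cast
  ring

theorem deriv_deriv_add_of_quasiperiodic {g : ℂ → ℂ} {V : Set ℂ} {q τ : ℂ} (hV : IsOpen V)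
    (hg : DifferentiableOn ℂ g V) (hadd : ∀ w ∈ V, w + τ ∈ V)
    (h : ∀ w ∈ V, g (w + τ) = 1 - q * qExp w ^ 2 - q * qExp w ^ 3 * g w) {w : ℂ} (hw : w ∈ V) :
    deriv (deriv g) (w + τ) = -(q * (4 * (2 * π * I) ^ 2 * qExp w ^ 2))
      - q * (9 * (2 * π * I) ^ 2 * qExp w ^ 3 * g w + 6 * (2 * π * I) * qExp w ^ 3 * deriv g w
        + qExp w ^ 3 * deriv (deriv g) w) := by
  have hg1 {w : ℂ} (hw : w ∈ V) : HasDerivAt g (deriv g w) w :=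
    (hg.differentiableAt (hV.mem_nhds hw)).hasDerivAt
  have hg2 {w : ℂ} (hw : w ∈ V) : HasDerivAt (deriv g) (deriv (deriv g) w) w :=
    ((hg.deriv hV).differentiableAt (hV.mem_nhds hw)).hasDerivAt
  have h1 := (hg2 (hadd w hw)).comp_add_const w τ
  have hq := hasDerivAt_qExp w
  have h2 := (((hq.fun_pow 2).const_mul (2 * (2 * π * I))).const_mul q).fun_neg.fun_sub
    (((((hq.fun_pow 3).const_mul (3 * (2 * π * I))).fun_mul (hg1 hw)).fun_add
      ((hq.fun_pow 3).fun_mul (hg2 hw))).const_mul q)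
  rw [(h1.congr_of_eventuallyEq (eventually_of_mem (hV.mem_nhds hw) fun x hx ↦
    (deriv_add_of_quasiperiodic hV hg hadd h hx).symm)).unique h2]
  push_cast
  ring

theorem hasFDerivAt_rankFun {p : ℂ × ℂ} (hp : p ∈ regularDomain) :
    HasFDerivAt rankFun (fderiv ℂ rankFun p) p :=
  (differentiableOn_rankFun.differentiableAt (isOpen_regularDomain.mem_nhds hp)).hasFDerivAt

theorem hasDerivAt_rankFun_right {p : ℂ × ℂ} (hp : p ∈ regularDomain) :
    HasDerivAt (fun t ↦ rankFun (p.1, t)) (fderiv ℂ rankFun p (0, 1)) p.2 :=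
  HasFDerivAt.comp_hasDerivAt (f := fun t ↦ (p.1, t)) p.2 (hasFDerivAt_rankFun hp)
    ((hasDerivAt_const p.2 p.1).prodMk (hasDerivAt_id p.2))

theorem hasDerivAt_rankFun_left {p : ℂ × ℂ} (hp : p ∈ regularDomain) :
    HasDerivAt (fun w ↦ rankFun (w, p.2)) (fderiv ℂ rankFun p (1, 0)) p.1 :=
  HasFDerivAt.comp_hasDerivAt (f := fun w ↦ (w, p.2)) p.1 (hasFDerivAt_rankFun hp)
    ((hasDerivAt_id p.1).prodMk (hasDerivAt_const p.1 p.2))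

theorem deriv_rankFun_add_tau {u τ : ℂ} (hp : (u, τ) ∈ regularDomain) :
    deriv (fun t ↦ rankFun (u + τ, t)) τ + deriv (fun w ↦ rankFun (w, τ)) (u + τ) =
      -(2 * π * I * qExp τ * qExp u ^ 2) - (2 * π * I * qExp τ * qExp u ^ 3 * rankFun (u, τ)
        + qExp τ * qExp u ^ 3 * deriv (fun t ↦ rankFun (u, t)) τ) := by
  have hp' : (u + τ, τ) ∈ regularDomain := add_tau_mem_regularDomain hp
  have h1 : HasDerivAt (fun t ↦ rankFun (u + t, t))
      (fderiv ℂ rankFun (u + τ, τ) (1, 1)) τ :=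
    HasFDerivAt.comp_hasDerivAt (f := fun t ↦ (u + t, t)) τ (hasFDerivAt_rankFun hp')
      (((hasDerivAt_id τ).const_add u).prodMk (hasDerivAt_id τ))
  have hsum : fderiv ℂ rankFun (u + τ, τ) (1, 1) =
      fderiv ℂ rankFun (u + τ, τ) (0, 1) + fderiv ℂ rankFun (u + τ, τ) (1, 0) := by
    rw [← map_add]; simp
  rw [(hasDerivAt_rankFun_right hp').deriv, (hasDerivAt_rankFun_left hp').deriv, ← hsum]
  have hq := hasDerivAt_qExp τ
  have h2 := ((hq.mul_const (qExp u ^ 2)).const_sub 1).fun_sub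
    ((hq.mul_const (qExp u ^ 3)).fun_mul (hasDerivAt_rankFun_right hp))
  have hev : ∀ᶠ t in 𝓝 τ, (u, t) ∈ regularDomain :=
    (isOpen_regularDomain.preimage (f := fun t ↦ (u, t)) (by fun_prop)).mem_nhds hp
  rw [(h1.congr_of_eventuallyEq (hev.mono fun t ht ↦ (rankFun_add_tau ht).symm)).unique h2,
    (hasDerivAt_rankFun_right hp).deriv]

theorem rankCrankOp_quasiperiodic_aux {c q z g a a' b b' d d' : ℂ} (hc : c ≠ 0)
    (ha : a' + b' = -(c * q * z ^ 2) - (c * q * z ^ 3 * g + q * z ^ 3 * a))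
    (hb : b' = -(q * (2 * c * z ^ 2)) - q * (3 * c * z ^ 3 * g + z ^ 3 * b))
    (hd : d' = -(q * (4 * c ^ 2 * z ^ 2))
      - q * (9 * c ^ 2 * z ^ 3 * g + 6 * c * z ^ 3 * b + z ^ 3 * d)) :
    3 * (c⁻¹ * a') + 1 / 2 * (c⁻¹ * b') + 1 / 2 * c⁻¹ ^ 2 * d' =
      -(q * z ^ 3) * (3 * (c⁻¹ * a) + 1 / 2 * (c⁻¹ * b) + 1 / 2 * c⁻¹ ^ 2 * d) := by
  rw [eq_sub_of_add_eq ha, hb, hd]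
  field_simp
  ring

theorem rankCrankOp_rankFun_add_tau {u τ : ℂ} (hp : (u, τ) ∈ regularDomain) :
    rankCrankOp rankFun (u + τ, τ) =
      -(qExp τ * qExp u ^ 3) * rankCrankOp rankFun (u, τ) := by
  have hV := isOpen_setOf_mem_regularDomain τ
  have hg := differentiableOn_rankFun_left τ
  have hadd : ∀ w ∈ {u | (u, τ) ∈ regularDomain}, w + τ ∈ {u | (u, τ) ∈ regularDomain} :=
    fun w hw ↦ add_tau_mem_regularDomain hw
  have h : ∀ w ∈ {u | (u, τ) ∈ regularDomain}, rankFun (w + τ, τ) =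
      1 - qExp τ * qExp w ^ 2 - qExp τ * qExp w ^ 3 * rankFun (w, τ) :=
    fun w hw ↦ rankFun_add_tau hw
  have hu : u ∈ {u | (u, τ) ∈ regularDomain} := hp
  exact rankCrankOp_quasiperiodic_aux two_pi_I_ne_zero (deriv_rankFun_add_tau hp)
    (deriv_add_of_quasiperiodic hV hg hadd h hu)
    (deriv_deriv_add_of_quasiperiodic hV hg hadd h hu)

end RankCrankOperator

section RankCrankIdentity

theorem hasDerivAt_inv_one_sub_qExp {u : ℂ} (h : 1 - qExp u ≠ 0) :
    HasDerivAt (fun w ↦ (1 - qExp w)⁻¹) (2 * π * I * (qExp u / (1 - qExp u) ^ 2)) u := by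
  refine (((hasDerivAt_qExp u).const_sub 1).fun_inv h).congr_deriv ?_
  ring

theorem hasDerivAt_qExp_div_one_sub_sq {u : ℂ} (h : 1 - qExp u ≠ 0) :
    HasDerivAt (fun w ↦ qExp w / (1 - qExp w) ^ 2)
      (2 * π * I * (qExp u * (1 + qExp u) / (1 - qExp u) ^ 3)) u := by
  refine ((hasDerivAt_qExp u).fun_div (((hasDerivAt_qExp u).const_sub 1).fun_pow 2)
    (pow_ne_zero 2 h)).congr_deriv ?_
  push_cast
  field_simp
  ring

theorem differentiableOn_rankTail_left (τ : ℂ) :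
    DifferentiableOn ℂ (fun w ↦ rankTail (w, τ)) {u | (u, τ) ∈ puncturedDomain} :=
  differentiableOn_rankTail.comp (f := fun w ↦ (w, τ)) (by fun_prop) fun _ h ↦ h

theorem hasDerivAt_rankTail_right {u τ : ℂ} (hp : (u, τ) ∈ puncturedDomain) :
    HasDerivAt (fun t ↦ rankTail (u, t)) (fderiv ℂ rankTail (u, τ) (0, 1)) τ :=
  HasFDerivAt.comp_hasDerivAt (f := fun t ↦ (u, t)) τ
    (differentiableOn_rankTail.differentiableAt (isOpen_puncturedDomain.mem_nhds hp)).hasFDerivAt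
    ((hasDerivAt_const τ u).prodMk (hasDerivAt_id τ))

theorem deriv_rankFun_right {u τ : ℂ} (hp : (u, τ) ∈ regularDomain) :
    deriv (fun t ↦ rankFun (u, t)) τ =
      deriv (fun t ↦ (eulerFun t)⁻¹) τ * ((1 - qExp u)⁻¹ + rankTail (u, τ))
        + (eulerFun τ)⁻¹ * fderiv ℂ rankTail (u, τ) (0, 1) := by
  have hp' := regularDomain_subset hp
  have h1 := ((differentiableAt_eulerFun hp.1).fun_inv (eulerFun_ne_zero hp.1)).hasDerivAt
  have h2 := h1.fun_mul ((hasDerivAt_rankTail_right hp').const_add (1 - qExp u)⁻¹)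
  have hev : ∀ᶠ t in 𝓝 τ, (u, t) ∈ puncturedDomain :=
    (isOpen_puncturedDomain.preimage (f := fun t ↦ (u, t)) (by fun_prop)).mem_nhds hp'
  exact (h2.congr_of_eventuallyEq (hev.mono fun t ht ↦ rankFun_eq ht)).deriv

theorem deriv_rankFun_left {u τ : ℂ} (hp : (u, τ) ∈ regularDomain) :
    deriv (fun w ↦ rankFun (w, τ)) u = (eulerFun τ)⁻¹ *
      (2 * π * I * (qExp u / (1 - qExp u) ^ 2) + deriv (fun w ↦ rankTail (w, τ)) u) := by
  have hW := (isOpen_setOf_mem_puncturedDomain τ).mem_nhds (regularDomain_subset hp)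
  have h1 := ((differentiableOn_rankTail_left τ).differentiableAt hW).hasDerivAt
  have h2 := ((hasDerivAt_inv_one_sub_qExp (one_sub_qExp_ne_zero hp)).fun_add h1).const_mul
    (eulerFun τ)⁻¹
  exact (h2.congr_of_eventuallyEq (eventually_of_mem hW fun w hw ↦ rankFun_eq hw)).deriv

theorem deriv_deriv_rankFun_left {u τ : ℂ} (hp : (u, τ) ∈ regularDomain) :
    deriv (deriv fun w ↦ rankFun (w, τ)) u = (eulerFun τ)⁻¹ *
      (2 * π * I * (2 * π * I * (qExp u * (1 + qExp u) / (1 - qExp u) ^ 3))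
        + deriv (deriv fun w ↦ rankTail (w, τ)) u) := by
  have hWo := isOpen_setOf_mem_puncturedDomain τ
  have h1 := (((differentiableOn_rankTail_left τ).deriv hWo).differentiableAt
    (hWo.mem_nhds (regularDomain_subset hp))).hasDerivAt
  have h2 := (((hasDerivAt_qExp_div_one_sub_sq (one_sub_qExp_ne_zero hp)).const_mul
    (2 * π * I : ℂ)).fun_add h1).const_mul (eulerFun τ)⁻¹
  have hV := (isOpen_setOf_mem_regularDomain τ).mem_nhds hp
  exact (h2.congr_of_eventuallyEq (eventually_of_mem hV fun w hw ↦ deriv_rankFun_left hw)).deriv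

theorem exists_rankCrankOp_rankFun_eq (τ : ℂ) : ∃ (C : ℂ) (h : ℂ → ℂ),
    DifferentiableOn ℂ h {u | (u, τ) ∈ puncturedDomain} ∧
    ∀ u, (u, τ) ∈ regularDomain → rankCrankOp rankFun (u, τ) =
      (eulerFun τ)⁻¹ * (qExp u / (1 - qExp u) ^ 3) + C * (1 - qExp u)⁻¹ + h u := by
  have hWo := isOpen_setOf_mem_puncturedDomain τ
  have hT := differentiableOn_rankTail_left τ
  have hT' : DifferentiableOn ℂ (fun w ↦ fderiv ℂ rankTail (w, τ) (0, 1))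
      {u | (u, τ) ∈ puncturedDomain} :=
    (differentiableOn_fderiv_rankTail (0, 1)).comp (f := fun w ↦ (w, τ)) (by fun_prop) fun _ h ↦ h
  refine ⟨3 * (2 * π * I)⁻¹ * deriv (fun t ↦ (eulerFun t)⁻¹) τ, fun u ↦
    3 * (2 * π * I)⁻¹ * (deriv (fun t ↦ (eulerFun t)⁻¹) τ * rankTail (u, τ)
      + (eulerFun τ)⁻¹ * fderiv ℂ rankTail (u, τ) (0, 1))
    + (1 / 2) * (2 * π * I)⁻¹ * (eulerFun τ)⁻¹ * deriv (fun w ↦ rankTail (w, τ)) u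
    + (1 / 2) * ((2 * π * I)⁻¹) ^ 2 * (eulerFun τ)⁻¹ * deriv (deriv fun w ↦ rankTail (w, τ)) u,
    ?_, fun u hu ↦ ?_⟩
  · exact ((((hT.const_mul _).fun_add (hT'.const_mul _)).const_mul _).fun_add
      ((hT.deriv hWo).const_mul _)).fun_add (((hT.deriv hWo).deriv hWo).const_mul _)
  · have hc : (2 * π * I : ℂ) ≠ 0 := two_pi_I_ne_zero
    have hz := one_sub_qExp_ne_zero hu
    simp only at hz
    have hφ := eulerFun_ne_zero hu.1
    simp only at hφ
    simp only [rankCrankOp]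
    rw [deriv_rankFun_right hu, deriv_rankFun_left hu, deriv_deriv_rankFun_left hu]
    generalize (2 * π * I : ℂ) = c at *
    generalize qExp u = z at *
    field_simp
    ring

theorem mem_regularDomain_iff {u τ : ℂ} (hτ : 0 < τ.im) :
    (u, τ) ∈ regularDomain ↔ ∀ m n : ℤ, u ≠ m * τ + n := by
  have key (k : ℤ) : rankDenom k (u, τ) = 0 ↔ ∃ n : ℤ, u = (-k : ℤ) * τ + n := by
    rw [rankDenom, ← qExp_int_mul, ← qExp_add, sub_eq_zero, eq_comm, qExp_eq_one_iff]
    refine exists_congr fun n ↦ ?_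
    push_cast
    constructor <;> intro h <;> linear_combination h
  constructor
  · intro h m n hu
    exact h.2 (-m) ((key _).mpr ⟨n, by rwa [neg_neg]⟩)
  · intro h
    refine ⟨hτ, fun k hk ↦ ?_⟩
    obtain ⟨n, hn⟩ := (key k).mp hk
    exact h _ _ hn

theorem zero_mem_puncturedDomain {τ : ℂ} (hτ : 0 < τ.im) : (0, τ) ∈ puncturedDomain := by
  refine ⟨hτ, fun n hn h ↦ ?_⟩
  rw [rankDenom, qExp_zero, one_mul, ← qExp_int_mul, sub_eq_zero, eq_comm, qExp_eq_one_iff] at h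
  obtain ⟨m, hm⟩ := h
  have := congrArg Complex.im hm
  simp [hn, hτ.ne'] at this

theorem add_tau_mem_regularDomain_iff {u τ : ℂ} :
    (u + τ, τ) ∈ regularDomain ↔ (u, τ) ∈ regularDomain := by
  refine ⟨fun h ↦ ⟨h.1, fun n ↦ ?_⟩, fun h ↦ add_tau_mem_regularDomain h⟩
  have h1 := h.2 (n - 1)
  have h2 := rankDenom_add_tau (n - 1) (u, τ)
  rw [sub_add_cancel] at h2
  rwa [← h2]

theorem add_one_mem_regularDomain_iff {u τ : ℂ} :
    (u + 1, τ) ∈ regularDomain ↔ (u, τ) ∈ regularDomain := by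
  have h (n : ℤ) : rankDenom n (u + 1, τ) = rankDenom n (u, τ) := by
    simp only [rankDenom, qExp_add_one]
  constructor <;> exact fun hp ↦ ⟨hp.1, fun n ↦ by simpa only [h] using hp.2 n⟩

open Classical in
/-- The difference of the two sides of the rank-crank identity, multiplied by `J ^ 3 / z` where
`J = thetaProd z q`, and extended by zero to the lattice. -/
def rankCrankDefect (τ u : ℂ) : ℂ :=
  if (u, τ) ∈ regularDomain then
    thetaProd (qExp u) (qExp τ) ^ 3 * rankCrankOp rankFun (u, τ) / qExp u - eulerFun τ ^ 5
  else 0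

theorem rankCrankDefect_add_one (τ u : ℂ) : rankCrankDefect τ (u + 1) = rankCrankDefect τ u := by
  by_cases h : (u, τ) ∈ regularDomain
  · rw [rankCrankDefect, rankCrankDefect, if_pos h, if_pos (add_one_mem_regularDomain_iff.mpr h),
      qExp_add_one, rankCrankOp_rankFun_add_one]
  · rw [rankCrankDefect, rankCrankDefect, if_neg h, if_neg (mt add_one_mem_regularDomain_iff.mp h)]

theorem rankCrankDefect_add_tau {τ : ℂ} (hτ : 0 < τ.im) (u : ℂ) :
    rankCrankDefect τ (u + τ) = rankCrankDefect τ u := by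
  by_cases h : (u, τ) ∈ regularDomain
  · rw [rankCrankDefect, rankCrankDefect, if_pos h, if_pos (add_tau_mem_regularDomain h),
      rankCrankOp_rankFun_add_tau h, qExp_add,
      thetaProd_mul_self (norm_qExp_lt_one hτ) (qExp_ne_zero _) (qExp_ne_zero _)]
    have := qExp_ne_zero u
    have := qExp_ne_zero τ
    field_simp
  · rw [rankCrankDefect, rankCrankDefect, if_neg h, if_neg (mt add_tau_mem_regularDomain_iff.mp h)]

theorem differentiable_qPochInf_qExp_mul {τ : ℂ} (hτ : 0 < τ.im) (b : ℂ) :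
    Differentiable ℂ fun u ↦ qPochInf (qExp u * b) (qExp τ) :=
  (differentiable_qPochInf (norm_qExp_lt_one hτ)).comp (differentiable_qExp.mul_const b)

theorem differentiable_qPochInf_inv_qExp_mul {τ : ℂ} (hτ : 0 < τ.im) (b : ℂ) :
    Differentiable ℂ fun u ↦ qPochInf ((qExp u)⁻¹ * b) (qExp τ) :=
  (differentiable_qPochInf (norm_qExp_lt_one hτ)).comp
    ((differentiable_qExp.fun_inv qExp_ne_zero).mul_const b)

theorem differentiableAt_rankCrankDefect {τ u : ℂ} (hp : (u, τ) ∈ regularDomain) :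
    DifferentiableAt ℂ (rankCrankDefect τ) u := by
  obtain ⟨C, h, hh, heq⟩ := exists_rankCrankOp_rankFun_eq τ
  have hV := (isOpen_setOf_mem_regularDomain τ).mem_nhds hp
  have hW := (isOpen_setOf_mem_puncturedDomain τ).mem_nhds (regularDomain_subset hp)
  have hhu := hh.differentiableAt hW
  have hz := one_sub_qExp_ne_zero hp
  have hq := differentiable_qExp u
  have hop : DifferentiableAt ℂ (fun u ↦ rankCrankOp rankFun (u, τ)) u := by
    refine DifferentiableAt.congr_of_eventuallyEq ?_ (eventually_of_mem hV heq)
    exact (((hq.fun_div ((hq.const_sub 1).fun_pow 3) (pow_ne_zero 3 hz)).const_mul _).fun_add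
      (((hq.const_sub 1).fun_inv hz).const_mul C)).fun_add hhu
  have hJ : DifferentiableAt ℂ (fun u ↦ thetaProd (qExp u) (qExp τ)) u := by
    have h1 := differentiable_qPochInf_qExp_mul hp.1 1 u
    simp only [mul_one] at h1
    exact h1.fun_mul (differentiable_qPochInf_inv_qExp_mul hp.1 _ u)
  refine ((((hJ.fun_pow 3).fun_mul hop).fun_div hq (qExp_ne_zero u)).sub_const
    (eulerFun τ ^ 5)).congr_of_eventuallyEq (eventually_of_mem hV fun w hw ↦ ?_)
  exact if_pos hw

theorem rankCrankDefect_zero (τ : ℂ) : rankCrankDefect τ 0 = 0 :=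
  if_neg fun h ↦ one_sub_qExp_ne_zero h (by simp [qExp_zero])

theorem continuousAt_rankCrankDefect_zero {τ : ℂ} (hτ : 0 < τ.im) :
    ContinuousAt (rankCrankDefect τ) 0 := by
  obtain ⟨C, h, hh, heq⟩ := exists_rankCrankOp_rankFun_eq τ
  have h0 := zero_mem_puncturedDomain hτ
  have hW := (isOpen_setOf_mem_puncturedDomain τ).mem_nhds h0
  have hφ := eulerFun_ne_zero hτ
  set K : ℂ → ℂ := fun u ↦
    qPochInf (qExp u * qExp τ) (qExp τ) * qPochInf ((qExp u)⁻¹ * qExp τ) (qExp τ) with hK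
  set k : ℂ → ℂ := fun u ↦ K u ^ 3 * ((eulerFun τ)⁻¹ +
    (C * (1 - qExp u) ^ 2 + h u * (1 - qExp u) ^ 3) / qExp u) - eulerFun τ ^ 5 with hk
  have hk0 : k 0 = 0 := by
    simp only [hk, hK, qExp_zero, inv_one, one_mul, sub_self]
    rw [← eulerFun]
    field_simp
    ring
  have hkc : ContinuousAt k 0 := by
    have hhc := (hh.differentiableAt hW).continuousAt
    have hKc : ContinuousAt K 0 := ((differentiable_qPochInf_qExp_mul hτ _).continuous.mul
      (differentiable_qPochInf_inv_qExp_mul hτ _).continuous).continuousAt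
    have hq : ContinuousAt (fun u ↦ 1 - qExp u) 0 :=
      (continuous_const.sub continuous_qExp).continuousAt
    exact ((hKc.pow 3).mul (continuousAt_const.add (((continuousAt_const.mul (hq.pow 2)).add
      (hhc.mul (hq.pow 3))).div continuous_qExp.continuousAt (qExp_ne_zero 0)))).sub
      continuousAt_const
  rw [ContinuousAt, rankCrankDefect_zero]
  refine squeeze_zero_norm' (a := fun u ↦ ‖k u‖) (eventually_of_mem hW fun u hu ↦ ?_) ?_
  · rw [rankCrankDefect]
    split_ifs with hr
    · have hz := one_sub_qExp_ne_zero hr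
      have hq := qExp_ne_zero u
      refine (congrArg norm ?_).le
      rw [heq u hr, thetaProd, qPochInf_eq_one_sub_mul (norm_qExp_lt_one hτ) (qExp u)]
      simp only at hz
      simp only [hk, hK]
      field_simp
      ring
    · simp
  · simpa [hk0] using hkc.tendsto.norm

theorem rankCrankOp_rankFun_eq {u τ : ℂ} (hp : (u, τ) ∈ regularDomain) :
    rankCrankOp rankFun (u, τ) =
      qExp u * eulerFun τ ^ 2 * crankStar (qExp u) (qExp τ) ^ 3 := by
  have hτ : 0 < τ.im := hp.1
  have hz := qExp_ne_zero u
  have hq := norm_qExp_lt_one hτ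
  have hzq : ∀ n : ℤ, 1 - qExp u * qExp τ ^ n ≠ 0 := hp.2
  have hJ := thetaProd_ne_zero hq hz hzq (qExp_ne_zero τ)
  have h := eq_zero_of_doublyPeriodic hτ
    (fun w hw ↦ differentiableAt_rankCrankDefect ((mem_regularDomain_iff hτ).mpr hw))
    (rankCrankDefect_add_one τ) (rankCrankDefect_add_tau hτ)
    (continuousAt_rankCrankDefect_zero hτ) (rankCrankDefect_zero τ) u
  rw [rankCrankDefect, if_pos hp, sub_eq_zero, div_eq_iff hz] at h
  rw [crankStar_eq_div_thetaProd hq hz hzq (qExp_ne_zero τ), ← eulerFun]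
  field_simp
  linear_combination h

end RankCrankIdentity

/-- The Atkin–Garvan Rank–Crank PDE. -/
theorem rank_crank_pde (τ u : ℂ) (hτ : 0 < τ.im)
    (hu : ∀ m n : ℤ, u ≠ (m : ℂ) * τ + (n : ℂ)) :
    Complex.exp (2 * π * I * u) *
        qPochInf (Complex.exp (2 * π * I * τ)) (Complex.exp (2 * π * I * τ)) ^ 2 *
        crankStar (Complex.exp (2 * π * I * u)) (Complex.exp (2 * π * I * τ)) ^ 3
    = 3 * ((2 * π * I)⁻¹ *
          deriv (fun t : ℂ =>
            rankStar (Complex.exp (2 * π * I * u)) (Complex.exp (2 * π * I * t))) τ)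
      + (1/2) * ((2 * π * I)⁻¹ *
          deriv (fun w : ℂ =>
            rankStar (Complex.exp (2 * π * I * w)) (Complex.exp (2 * π * I * τ))) u)
      + (1/2) * ((2 * π * I)⁻¹)^2 *
          iteratedDeriv 2 (fun w : ℂ =>
            rankStar (Complex.exp (2 * π * I * w)) (Complex.exp (2 * π * I * τ))) u := by
  rw [iteratedDeriv_succ, iteratedDeriv_one]
  exact (rankCrankOp_rankFun_eq ((mem_regularDomain_iff hτ).mpr hu)).symm

end
end
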